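/- Let N be a positive integer and let n be a positive integer with n ≤ N. Let x ∈ 𝕋 and suppose x = b/r + η, where b, r ∈ 𝔽_q[t] are coprime, r is monic nonzero with ⟨r⟩ ≤ q^{N/2}, and η ∈ K_∞ with ⟨η⟩ < (⟨r⟩ · q^{N/2})^{−1}. Then for every ε > 0 there is a constant C = C(q, ε) > 0 (independent of N, n, x, b, r, η) such that |Σ_{f monic, deg f = n} Λ'(f) · e(fx) − (μ(r)/φ(r)) · Σ_{f monic, deg f = n} e(fη)| ≤ C · q^{N(3/4 + ε)}. -/

import Mathlib

open Polynomial
open scoped Classical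

noncomputable section

variable (p : ℕ) [Fact p.Prime] (Fq : Type) [Field Fq] [Fintype Fq] [Algebra (ZMod p) Fq]

/-- `t` as an element of `K∞ = 𝔽_q((1/t))`; the exponent of the Hahn series variable records
the power of `1/t`, so that `res x = x.coeff 1` and `ord x = -x.order`. -/
def Kt : LaurentSeries Fq := HahnSeries.single (-1 : ℤ) 1

/-- The Laurent expansion at infinity of a polynomial. -/
def toK (f : Polynomial Fq) : LaurentSeries Fq := Polynomial.aeval (Kt Fq) f

/-- The additive character `e(x) = exp(2πi · tr(res x)/p)` on `K∞`. -/
def eC (x : LaurentSeries Fq) : ℂ :=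
  Complex.exp (2 * Real.pi * Complex.I *
    ((Algebra.trace (ZMod p) Fq (x.coeff 1)).val : ℂ) / (p : ℂ))

/-- The norm `⟨x⟩ = q^(ord x)` on `K∞` (with `⟨0⟩ = 0`). -/
def Knorm (x : LaurentSeries Fq) : ℝ :=
  if x = 0 then 0 else (Fintype.card Fq : ℝ) ^ (-x.order)

/-- The norm `⟨f⟩ = q^(deg f)` of a polynomial (with `⟨0⟩ = 0`). -/
def pnorm (f : Polynomial Fq) : ℝ :=
  if f = 0 then 0 else (Fintype.card Fq : ℝ) ^ f.natDegree

/-- The Euler totient function: the number of units of `𝔽_q[t]/(f)`. -/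
def phiP (f : Polynomial Fq) : ℕ := Nat.card ((Polynomial Fq ⧸ Ideal.span {f})ˣ)

/-- The Möbius function on `𝔽_q[t]`: `(-1)^(number of distinct monic irreducible factors)`
for squarefree `f`, and `0` otherwise. -/
def muP (f : Polynomial Fq) : ℤ :=
  if Squarefree f then
    (-1) ^ {P : Polynomial Fq | P.Monic ∧ Irreducible P ∧ P ∣ f}.ncard
  else 0

/-- The modified von Mangoldt function `Λ'(f) = deg f` if `f` is irreducible, `0` otherwise. -/
def vonMangoldt' (f : Polynomial Fq) : ℝ := if Irreducible f then (f.natDegree : ℝ) else 0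

namespace CoordDegree

variable {k R ι : Type*} [Field k] [CommRing R] [Algebra k[X] R] [Fintype ι]
  (B : Module.Basis ι k[X] R)

/-- The largest degree of a coordinate of `r` in a basis over a polynomial ring. -/
def cdeg (r : R) : ℕ := Finset.univ.sup fun i => (B.repr r i).natDegree

lemma natDegree_repr_le (r : R) (i : ι) : (B.repr r i).natDegree ≤ cdeg B r :=
  Finset.le_sup (f := fun i => (B.repr r i).natDegree) (Finset.mem_univ i)

lemma cdeg_le {r : R} {n : ℕ} (h : ∀ i, (B.repr r i).natDegree ≤ n) : cdeg B r ≤ n :=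
  Finset.sup_le fun i _ => h i

lemma cdeg_add_le {r s : R} {n : ℕ} (hr : cdeg B r ≤ n) (hs : cdeg B s ≤ n) :
    cdeg B (r + s) ≤ n := by
  refine cdeg_le B fun i => ?_
  rw [map_add, Finsupp.add_apply]
  exact natDegree_add_le_of_degree_le ((natDegree_repr_le B r i).trans hr)
    ((natDegree_repr_le B s i).trans hs)

lemma cdeg_zero : cdeg B (0 : R) = 0 := by simp [cdeg]

lemma cdeg_sum_le {κ : Type*} (t : Finset κ) (f : κ → R) {n : ℕ} (h : ∀ j ∈ t, cdeg B (f j) ≤ n) :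
    cdeg B (∑ j ∈ t, f j) ≤ n := by
  induction t using Finset.induction_on with
  | empty => simp [cdeg_zero]
  | insert a s ha ih =>
    rw [Finset.sum_insert ha]
    exact cdeg_add_le B (h a (by simp)) (ih fun j hj => h j (by simp [hj]))

lemma cdeg_smul_le (f : k[X]) (r : R) : cdeg B (f • r) ≤ f.natDegree + cdeg B r := by
  refine cdeg_le B fun i => ?_
  rw [map_smul, Finsupp.smul_apply, smul_eq_mul]
  exact natDegree_mul_le.trans (Nat.add_le_add_left (natDegree_repr_le B r i) _)

lemma exists_cdeg_map_le (T : R →ₗ[k[X]] R) : ∃ c, ∀ r, cdeg B (T r) ≤ cdeg B r + c := by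
  refine ⟨Finset.univ.sup fun i => cdeg B (T (B i)), fun r => ?_⟩
  conv_lhs => rw [← B.sum_repr r, map_sum]
  refine cdeg_sum_le B _ _ fun i _ => ?_
  rw [map_smul]
  exact (cdeg_smul_le B _ _).trans (add_le_add (natDegree_repr_le B r i)
    (Finset.le_sup (f := fun i => cdeg B (T (B i))) (Finset.mem_univ i)))

lemma exists_cdeg_mul_le : ∃ c, ∀ r s, cdeg B (r * s) ≤ cdeg B r + cdeg B s + c := by
  choose c hc using fun i => exists_cdeg_map_le B (LinearMap.mulLeft k[X] (B i))
  refine ⟨Finset.univ.sup c, fun r s => ?_⟩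
  conv_lhs => rw [← B.sum_repr r, Finset.sum_mul]
  refine cdeg_sum_le B _ _ fun i _ => ?_
  rw [smul_mul_assoc]
  have h1 := cdeg_smul_le B (B.repr r i) (B i * s)
  have h2 := hc i s
  have h3 := natDegree_repr_le B r i
  have h4 : c i ≤ Finset.univ.sup c := Finset.le_sup (Finset.mem_univ i)
  simp only [LinearMap.mulLeft_apply] at h2
  omega

lemma cdeg_pow_le {c : ℕ} (hc : ∀ r s, cdeg B (r * s) ≤ cdeg B r + cdeg B s + c) (r : R) (n : ℕ) :
    cdeg B (r ^ (n + 1)) + c ≤ (n + 1) * (cdeg B r + c) := by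
  induction n with
  | zero => simp
  | succ n ih =>
    have := hc (r ^ (n + 1)) r
    rw [pow_succ r (n + 1)]
    linarith [add_mul (n + 1) 1 (cdeg B r + c)]

lemma dvd_repr_of_dvd {P : k[X]} {r : R} (h : algebraMap k[X] R P ∣ r) (i : ι) :
    P ∣ B.repr r i := by
  obtain ⟨s, rfl⟩ := h
  rw [← Algebra.smul_def, map_smul, Finsupp.smul_apply, smul_eq_mul]
  exact dvd_mul_right _ _

lemma natDegree_le_cdeg {P : k[X]} {r : R} (hr : r ≠ 0) (h : ∀ i, P ∣ B.repr r i) :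
    P.natDegree ≤ cdeg B r := by
  obtain ⟨i, hi⟩ : ∃ i, B.repr r i ≠ 0 := by
    by_contra! hcon
    exact hr (B.repr.map_eq_zero_iff.mp (Finsupp.ext hcon))
  exact (natDegree_le_of_dvd (h i) hi).trans (natDegree_repr_le B r i)

lemma dvd_norm [Module.Free k[X] R] [Module.Finite k[X] R] (r : R) :
    r ∣ algebraMap k[X] R (Algebra.norm k[X] r) := by
  have h := LinearMap.aeval_self_charpoly (Algebra.lmul k[X] R r)
  have h0 : (Polynomial.aeval (Algebra.lmul k[X] R r)) (Algebra.lmul k[X] R r).charpoly (1 : R)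
      = 0 := by rw [h]; rfl
  have h1 : (Polynomial.aeval r) (Algebra.lmul k[X] R r).charpoly = 0 := by
    rw [Polynomial.aeval_algHom_apply] at h0
    simpa using h0
  have h2 := LinearMap.det_eq_sign_charpoly_coeff (Algebra.lmul k[X] R r)
  rw [Algebra.norm_apply, h2, map_mul]
  refine Dvd.dvd.mul_left ?_ _
  obtain ⟨q, hq⟩ := Polynomial.X_dvd_sub_C (p := (Algebra.lmul k[X] R r).charpoly)
  have h3 := congrArg (Polynomial.aeval r) hq
  rw [map_sub, h1, Polynomial.aeval_C, map_mul, Polynomial.aeval_X] at h3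
  exact ⟨-(Polynomial.aeval r q), by linear_combination (-1) * h3⟩

lemma natDegree_det_le {n : ℕ} (M : Matrix ι ι k[X]) (h : ∀ i j, (M i j).natDegree ≤ n) :
    M.det.natDegree ≤ Fintype.card ι * n := by
  rw [Matrix.det_apply]
  refine natDegree_sum_le_of_forall_le _ _ fun σ _ => ?_
  refine (natDegree_smul_le _ _).trans ((natDegree_prod_le _ _).trans ?_)
  refine (Finset.sum_le_card_nsmul _ _ n fun i _ => h _ _).trans ?_
  simp

lemma exists_natDegree_norm_le :
    ∃ c, ∀ r : R, (Algebra.norm k[X] r).natDegree ≤ Fintype.card ι * (cdeg B r + c) := by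
  obtain ⟨c, hc⟩ := exists_cdeg_mul_le B
  refine ⟨Finset.univ.sup (fun i => cdeg B (B i)) + c, fun r => ?_⟩
  rw [Algebra.norm_eq_matrix_det B]
  refine natDegree_det_le _ fun i j => ?_
  rw [Algebra.leftMulMatrix_eq_repr_mul]
  have h1 := natDegree_repr_le B (r * B j) i
  have h2 := hc r (B j)
  have h3 : cdeg B (B j) ≤ Finset.univ.sup (fun i => cdeg B (B i)) :=
    Finset.le_sup (f := fun i => cdeg B (B i)) (Finset.mem_univ j)
  omega

lemma exists_order_le [IsDomain R] (κ : R →ₐ[k[X]] PowerSeries k) :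
    ∃ c, ∀ r : R, r ≠ 0 → (κ r).order ≤ (Fintype.card ι * (cdeg B r + c) : ℕ) := by
  obtain ⟨c, hc⟩ := exists_natDegree_norm_le B
  refine ⟨c, fun r hr => ?_⟩
  have : Module.Free k[X] R := Module.Free.of_basis B
  have : Module.Finite k[X] R := Module.Finite.of_basis B
  obtain ⟨s, hs⟩ := dvd_norm (k := k) r
  have hN : Algebra.norm k[X] r ≠ 0 := (Algebra.norm_ne_zero_iff_of_basis B).mpr hr
  have h1 : (κ r).order ≤ (κ (algebraMap k[X] R (Algebra.norm k[X] r))).order := by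
    rw [hs, map_mul]
    exact le_self_add.trans (PowerSeries.le_order_mul _ _)
  refine h1.trans (le_trans ?_ (Nat.cast_le.mpr (hc r)))
  rw [AlgHom.commutes]
  refine PowerSeries.order_le _ ?_
  have : (algebraMap k[X] (PowerSeries k)) (Algebra.norm k[X] r)
      = ((Algebra.norm k[X] r : k[X]) : PowerSeries k) := by
    simp [PowerSeries.algebraMap_apply']
  rw [this, Polynomial.coeff_coe]
  exact leadingCoeff_ne_zero.mpr hN

end CoordDegree

namespace CoordDegree

variable {k R ι : Type*} [Field k] [CommRing R] [Algebra k[X] R] [Fintype ι]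
  (B : Module.Basis ι k[X] R)

/-- The element with prescribed coordinates of degree less than `A`. -/
def ofCoords (A : ℕ) : (ι → degreeLT k A) →+ R where
  toFun v := ∑ i, (v i : k[X]) • B i
  map_zero' := by simp
  map_add' v w := by simp [add_smul, Finset.sum_add_distrib]

lemma repr_ofCoords {A : ℕ} (v : ι → degreeLT k A) (i : ι) :
    B.repr (ofCoords B A v) i = v i := by
  simp only [ofCoords, AddMonoidHom.coe_mk, ZeroHom.coe_mk, B.repr_sum_self]

lemma ofCoords_injective (A : ℕ) : Function.Injective (ofCoords B A) := by
  intro v w h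
  funext i
  exact Subtype.ext (by rw [← repr_ofCoords B v i, ← repr_ofCoords B w i, h])

lemma cdeg_ofCoords_lt {A : ℕ} (hA : 0 < A) (v : ι → degreeLT k A) :
    cdeg B (ofCoords B A v) < A := by
  refine Nat.lt_of_le_pred hA (cdeg_le B fun i => ?_)
  rw [repr_ofCoords]
  have := (v i).2
  rw [mem_degreeLT] at this
  refine Nat.le_pred_of_lt ?_
  by_cases h : (v i : k[X]) = 0
  · simpa [h] using hA
  · exact (natDegree_lt_iff_degree_lt h).mpr this

lemma exists_ofCoords_eq {A : ℕ} {r : R} (h : cdeg B r < A) : ∃ v, ofCoords B A v = r := by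
  refine ⟨fun i => ⟨B.repr r i, ?_⟩, ?_⟩
  · rw [mem_degreeLT]
    refine degree_le_natDegree.trans_lt ?_
    exact_mod_cast (natDegree_repr_le B r i).trans_lt h
  · simp [ofCoords, B.sum_repr]

instance [Finite k] (A : ℕ) : Finite (degreeLT k A) :=
  Finite.of_equiv _ (degreeLTEquiv k A).toEquiv.symm

lemma card_coords [Finite k] (A : ℕ) :
    Nat.card (ι → degreeLT k A) = Nat.card k ^ (A * Fintype.card ι) := by
  rw [Nat.card_fun, Nat.card_congr (degreeLTEquiv k A).toEquiv, Nat.card_fun]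
  simp [pow_mul]

lemma exists_distinct_orders [Finite k] (κ : R →ₐ[k[X]] PowerSeries k)
    (hκ : Function.Injective κ) {J : ℕ} (hJ : 0 < J) :
    ∃ t : Finset ℕ, t.card = J * Fintype.card ι ∧ ∃ b : ℕ → R,
      ∀ o ∈ t, (κ (b o)).order = o ∧ cdeg B (b o) < J := by
  let O : Set ℕ := {o | ∃ v : ι → degreeLT k J, (κ (ofCoords B J v)).order = o}
  have hO : ((J * Fintype.card ι : ℕ) : ℕ∞) ≤ O.encard := by
    by_cases hfin : O.Finite
    · have : Finite O := hfin
      let f : (ι → degreeLT k J) → (O → k) := fun v o =>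
        PowerSeries.coeff o.1 (κ (ofCoords B J v))
      have hf : Function.Injective f := by
        intro v w hvw
        by_contra hne
        have hne' : κ (ofCoords B J (v - w)) ≠ 0 := by
          rw [map_sub, map_sub, sub_ne_zero]
          exact fun h => hne (ofCoords_injective B J (hκ h))
        have hmem : (κ (ofCoords B J (v - w))).order.toNat ∈ O :=
          ⟨v - w, (PowerSeries.coe_toNat_order hne').symm⟩
        have h1 := congrFun hvw ⟨_, hmem⟩
        have h2 := PowerSeries.coeff_order hne'
        simp only [f] at h1
        apply h2
        nth_rewrite 2 [map_sub]
        rw [map_sub κ, map_sub, h1, sub_self]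
      have hc := Nat.card_le_card_of_injective f hf
      rw [card_coords, Nat.card_fun] at hc
      have hk : 1 < Nat.card k := Finite.one_lt_card
      have hle := (Nat.pow_le_pow_iff_right hk).mp hc
      rw [← hfin.cast_ncard_eq]
      exact_mod_cast hle
    · rw [Set.Infinite.encard_eq hfin]
      exact le_top
  obtain ⟨t, htO, ht⟩ := Set.exists_subset_encard_eq hO
  have htf : t.Finite := Set.finite_of_encard_eq_coe ht
  choose! v hv using fun o (ho : o ∈ t) => htO ho
  refine ⟨htf.toFinset, ?_, fun o => ofCoords B J (v o), fun o ho =>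
    ⟨hv o (htf.mem_toFinset.mp ho), cdeg_ofCoords_lt B hJ _⟩⟩
  rw [htf.encard_eq_coe_toFinset_card] at ht
  exact_mod_cast ht

/-- If `κ (b o)` has order `o` for all `o ∈ t` and the nonzero elements `a o` have order
less than `ℓ`, then `∑ a o * b o ^ ℓ` vanishes only trivially. -/
lemma sum_mul_pow_ne_zero (κ : R →ₐ[k[X]] PowerSeries k) {t : Finset ℕ} {a b : ℕ → R} {ℓ : ℕ}
    (hb : ∀ o ∈ t, (κ (b o)).order = o)
    (ha : ∀ o ∈ t, a o ≠ 0 → (κ (a o)).order < ℓ) (hne : ∃ o ∈ t, a o ≠ 0) :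
    ∑ o ∈ t, a o * b o ^ ℓ ≠ 0 := by
  have hex : ∃ o, o ∈ t ∧ a o ≠ 0 := hne
  let m := Nat.find hex
  obtain ⟨hm, ham⟩ : m ∈ t ∧ a m ≠ 0 := Nat.find_spec hex
  have hmin : ∀ o ∈ t, o < m → a o = 0 := fun o ho hlt => by
    by_contra h
    exact Nat.find_min hex hlt ⟨ho, h⟩
  obtain ⟨e, he⟩ := ENat.ne_top_iff_exists.mp ((ha m hm ham).ne_top)
  have heℓ : e < ℓ := by
    have := ha m hm ham
    rw [← he] at this
    exact_mod_cast this
  have hord : ∀ o ∈ t, (κ (a o * b o ^ ℓ)).order = (κ (a o)).order + (ℓ * o : ℕ) := fun o ho => by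
    rw [map_mul, map_pow, PowerSeries.order_mul, PowerSeries.order_pow, hb o ho]
    simp
  intro h0
  have h1 := congrArg (fun r => PowerSeries.coeff (e + ℓ * m) (κ r)) h0
  simp only [map_sum, map_zero] at h1
  rw [Finset.sum_eq_single_of_mem m hm] at h1
  · have h2 := hord m hm
    rw [← he] at h2
    have h3 : (κ (a m * b m ^ ℓ)) ≠ 0 := by
      rw [← PowerSeries.order_finite_iff_ne_zero, h2]
      exact_mod_cast ENat.natCast_lt_top _
    have h4 := PowerSeries.coeff_order h3
    have h5 : ((e : ℕ∞) + ((ℓ * m : ℕ) : ℕ∞)).toNat = e + ℓ * m := by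
      rw [← Nat.cast_add]
      exact ENat.toNat_natCast _
    rw [h2, h5] at h4
    exact h4 h1
  · intro o ho hom
    rcases lt_or_gt_of_ne hom with hlt | hgt
    · simp [hmin o ho hlt]
    · refine PowerSeries.coeff_of_lt_order _ ?_
      rw [hord o ho]
      refine lt_of_lt_of_le ?_ le_add_self
      have : e + ℓ * m < ℓ * o := by nlinarith
      exact_mod_cast this

/-- Pigeonhole: an additive map out of a large space of coefficients has a kernel. -/
lemma exists_kernel [Finite k] {t : Finset ℕ} {A D : ℕ} (T : (t → ι → degreeLT k A) →+ R)
    (hT : ∀ v, cdeg B (T v) < D) (hcard : D < A * t.card) (hι : 0 < Fintype.card ι) :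
    ∃ v, v ≠ 0 ∧ T v = 0 := by
  choose g hg using fun v => exists_ofCoords_eq B (hT v)
  have hninj : ¬ Function.Injective g := by
    intro hinj
    have hc := Nat.card_le_card_of_injective g hinj
    rw [card_coords, Nat.card_fun, card_coords, ← pow_mul] at hc
    have hk : 1 < Nat.card k := Finite.one_lt_card
    have hle := (Nat.pow_le_pow_iff_right hk).mp hc
    simp only [Nat.card_eq_fintype_card, Fintype.card_coe] at hle
    nlinarith
  simp only [Function.Injective, not_forall] at hninj
  obtain ⟨v, w, hvw, hne⟩ := hninj
  refine ⟨v - w, sub_ne_zero.mpr hne, ?_⟩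
  rw [map_sub, ← hg v, ← hg w, hvw, sub_self]

lemma stepanov_parameters (d c₀ c₁ c₂ : ℕ) (hd : 0 < d) : ∃ C ℓ₀ : ℕ, ∀ ℓ, ℓ₀ ≤ ℓ →
    ∃ A J : ℕ, 0 < A ∧ 0 < J ∧ d * (A - 1 + c₂) < ℓ ∧
      ℓ * (A + c₀) + J + c₁ + c₀ < A * (J * d) ∧
      d * (A + c₀ + ℓ * (J + c₀)) ≤ ℓ ^ 2 + C * ℓ := by
  refine ⟨d * (3 * c₀ + 5), d * (c₂ * (c₀ + 2) + 3 * c₀ + c₁ + c₂ + 10), fun ℓ hℓ => ?_⟩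
  obtain ⟨e, ρ, hρ, rfl⟩ : ∃ e ρ, ρ < d ∧ ℓ = d * e + ρ :=
    ⟨ℓ / d, ℓ % d, Nat.mod_lt _ hd, (Nat.div_add_mod ℓ d).symm⟩
  have he : c₂ * (c₀ + 2) + 3 * c₀ + c₁ + c₂ + 10 ≤ e := by
    by_contra! hlt
    have : d * (e + 1) ≤ d * (c₂ * (c₀ + 2) + 3 * c₀ + c₁ + c₂ + 10) :=
      Nat.mul_le_mul_left _ hlt
    nlinarith
  obtain ⟨A, rfl⟩ : ∃ A, e = A + 1 + c₂ := ⟨e - 1 - c₂, by omega⟩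
  have hA : c₂ * (c₀ + 2) + 3 * c₀ + c₁ + 9 ≤ A := by omega
  clear he
  refine ⟨A + 1, A + 1 + c₂ + (c₀ + 3), by omega, by omega, ?_, ?_, ?_⟩
  · have : A + 1 - 1 + c₂ < A + 1 + c₂ := by omega
    nlinarith
  · have h1 : (d * (A + 1 + c₂) + ρ) * (A + 1 + c₀) ≤ d * (A + 1 + c₂ + 1) * (A + 1 + c₀) := by
      gcongr
      nlinarith
    have h2 : d * (c₂ * (c₀ + 2) + 3 * c₀ + c₁ + 9) ≤ d * A := Nat.mul_le_mul_left _ hA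
    have h3 : A + 2 * c₀ + c₁ + c₂ + 4 ≤ d * (A + 2 * c₀ + c₁ + c₂ + 4) :=
      Nat.le_mul_of_pos_left _ hd
    nlinarith
  · set L := d * (A + 1 + c₂) + ρ with hL
    have h1 : d * (A + 1 + c₂) ≤ L := Nat.le_add_right _ _
    have h2 : 1 ≤ L := by nlinarith
    have h3 : d * (A + 1) ≤ L := le_trans (Nat.mul_le_mul_left _ (by omega)) h1
    have h4 : d * c₀ ≤ d * c₀ * L := Nat.le_mul_of_pos_right _ h2
    have h5 : L ≤ d * L := Nat.le_mul_of_pos_left _ hd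
    have h6 : d * (A + 1 + c₂) * L ≤ L * L := Nat.mul_le_mul_right _ h1
    have h7 : d * (A + 1 + c₀ + L * (A + 1 + c₂ + (c₀ + 3) + c₀)) =
      d * (A + 1) + d * c₀ + d * (A + 1 + c₂) * L + d * (2 * c₀ + 3) * L := by ring
    rw [h7]
    have h8 : L ^ 2 + d * (3 * c₀ + 5) * L =
      L * L + d * (2 * c₀ + 3) * L + d * c₀ * L + d * L + d * L := by ring
    rw [h8]
    omega

theorem exists_natDegree_prod_le [Finite k] [IsDomain R] (p : ℕ) [ExpChar R p]
    (B : Module.Basis ι k[X] R) (κ : R →ₐ[k[X]] PowerSeries k) (hκ : Function.Injective κ) (σ : R ≃ₐ[k[X]] R) :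
    ∃ C ℓ₀ : ℕ, ∀ ν, ℓ₀ ≤ p ^ ν → ∀ {τ : Type} (s : Finset τ) (P : τ → k[X]),
      (s : Set τ).Pairwise (fun i j => IsCoprime (P i) (P j)) →
      (∀ i ∈ s, ∀ r : R, algebraMap k[X] R (P i) ∣ r ^ (p ^ ν) ^ 2 - σ r) →
      Fintype.card ι * (∏ i ∈ s, P i).natDegree ≤ (p ^ ν) ^ 2 + C * p ^ ν := by
  have hι : 0 < Fintype.card ι := by
    have : Nonempty ι := by
      by_contra h
      rw [not_nonempty_iff] at h
      exact one_ne_zero (by rw [← B.sum_repr (1 : R)]; simp)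
    exact Fintype.card_pos
  obtain ⟨c₀, hc₀⟩ := exists_cdeg_mul_le B
  obtain ⟨c₁, hc₁⟩ := exists_cdeg_map_le B σ.toLinearMap
  obtain ⟨c₂, hc₂⟩ := exists_order_le B κ
  obtain ⟨C, ℓ₀, hpar⟩ := stepanov_parameters (Fintype.card ι) c₀ c₁ c₂ hι
  refine ⟨C, ℓ₀, fun ν hν τ s P hcop hdvd => ?_⟩
  set ℓ := p ^ ν with hℓ
  obtain ⟨A, J, hA, hJ, hpar₁, hpar₂, hpar₃⟩ := hpar ℓ hν
  have hℓ0 : 0 < ℓ := by omega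
  obtain ⟨ℓ', hℓ'⟩ : ∃ ℓ', ℓ = ℓ' + 1 := ⟨ℓ - 1, by omega⟩
  obtain ⟨t, ht, b, hb⟩ := exists_distinct_orders B κ hκ hJ
  have hpow : ∀ r, cdeg B (r ^ ℓ) + c₀ ≤ ℓ * (cdeg B r + c₀) := fun r => by
    rw [hℓ']; exact cdeg_pow_le B hc₀ r ℓ'
  let T : (t → ι → degreeLT k A) →+ R :=
    { toFun := fun v => ∑ o : t, ofCoords B A (v o) ^ ℓ * σ (b o)
      map_zero' := by simp [hℓ0.ne']
      map_add' := fun v w => by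
        simp only [Pi.add_apply, map_add, hℓ, add_pow_expChar_pow, add_mul,
          Finset.sum_add_distrib] }
  have hT : ∀ v, cdeg B (T v) < ℓ * (A + c₀) + J + c₁ + c₀ := fun v => by
    refine lt_of_le_of_lt (cdeg_sum_le B _ _ (n := ℓ * (A + c₀) + J - 1 + c₁ + c₀)
      fun o _ => ?_) (by omega)
    have h1 := hc₀ (ofCoords B A (v o) ^ ℓ) (σ (b o))
    have h2 := hpow (ofCoords B A (v o))
    have h3 := hc₁ (b o)
    have h4 := cdeg_ofCoords_lt B hA (v o)
    have h5 := (hb o o.2).2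
    have h6 : ℓ * (cdeg B (ofCoords B A (v o)) + c₀) ≤ ℓ * (A + c₀) := by gcongr
    simp only [AlgEquiv.toLinearMap_apply] at h3
    omega
  obtain ⟨v, hv0, hTv⟩ := exists_kernel B T hT (by rw [ht]; exact hpar₂) hι
  let a : ℕ → R := fun o => if h : o ∈ t then ofCoords B A (v ⟨o, h⟩) else 0
  have hat : ∀ o : t, a o = ofCoords B A (v o) := fun o => by simp [a]
  have hadeg : ∀ o ∈ t, cdeg B (a o) < A := fun o ho => by
    simpa [a, ho] using cdeg_ofCoords_lt B hA _
  let G := ∑ o ∈ t, a o * b o ^ ℓ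
  have hG : G ≠ 0 := by
    refine sum_mul_pow_ne_zero κ (fun o ho => (hb o ho).1) (fun o ho hao => ?_) ?_
    · refine (hc₂ _ hao).trans_lt ?_
      have : Fintype.card ι * (cdeg B (a o) + c₂) < ℓ := by
        refine lt_of_le_of_lt (Nat.mul_le_mul_left _ ?_) hpar₁
        have := hadeg o ho
        omega
      exact_mod_cast this
    · obtain ⟨o, ho⟩ := Function.ne_iff.mp hv0
      refine ⟨o, o.2, fun h => ho (ofCoords_injective B A ?_)⟩
      rw [← hat, h, Pi.zero_apply, map_zero]
  have hGdvd : ∀ i ∈ s, algebraMap k[X] R (P i) ∣ G := fun i hi => by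
    have h1 : algebraMap k[X] R (P i) ∣ G ^ ℓ := by
      have h2 : G ^ ℓ = ∑ o : t, ofCoords B A (v o) ^ ℓ * (b o ^ ℓ ^ 2 - σ (b o)) := by
        have h3 : G ^ ℓ = ∑ o : t, ofCoords B A (v o) ^ ℓ * b o ^ ℓ ^ 2 := by
          simp only [G]
          rw [hℓ, sum_pow_char_pow, ← hℓ, ← Finset.sum_coe_sort]
          refine Finset.sum_congr rfl fun o _ => ?_
          rw [hat, mul_pow, ← pow_mul, sq]
        simp only [mul_sub, Finset.sum_sub_distrib, ← h3]
        have h4 : ∑ o : t, ofCoords B A (v o) ^ ℓ * σ (b o) = 0 := hTv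
        rw [h4, sub_zero]
      rw [h2]
      exact Finset.dvd_sum fun o _ => (hdvd i hi _).mul_left _
    have h5 : algebraMap k[X] R (P i) ∣ G ^ ℓ ^ 2 := by
      rw [sq, pow_mul]
      exact dvd_pow h1 hℓ0.ne'
    have h6 : algebraMap k[X] R (P i) ∣ σ G := by
      have := dvd_sub h5 (hdvd i hi G)
      rwa [sub_sub_cancel] at this
    have h7 := map_dvd σ.symm h6
    rwa [AlgEquiv.commutes, AlgEquiv.symm_apply_apply] at h7
  have hprod : ∀ i, (∏ j ∈ s, P j) ∣ B.repr G i := fun i =>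
    Finset.prod_dvd_of_coprime hcop fun j hj => dvd_repr_of_dvd B (hGdvd j hj) i
  refine le_trans (Nat.mul_le_mul_left _ ?_) hpar₃
  refine (natDegree_le_cdeg B hG hprod).trans (cdeg_sum_le B _ _ fun o ho => ?_)
  have h1 := hc₀ (a o) (b o ^ ℓ)
  have h2 := hpow (b o)
  have h3 := hadeg o ho
  have h4 : ℓ * (cdeg B (b o) + c₀) ≤ ℓ * (J + c₀) := by gcongr; exact (hb o ho).2.le
  omega

end CoordDegree

namespace HomEval

variable {S B : Type*} [CommRing S] [CommRing B] [Algebra S B] (a b : B)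

/-- The value at `(a, b)` of the binary form attached to a polynomial. -/
def homEval (f : S[X]) : B := MvPolynomial.aeval ![a, b] (f.homogenize f.natDegree)

lemma homEval_one : homEval a b (1 : S[X]) = 1 := by simp [homEval]

lemma homEval_mul {f g : S[X]} (hf : f.Monic) (hg : g.Monic) :
    homEval a b (f * g) = homEval a b f * homEval a b g := by
  rw [homEval, hf.natDegree_mul hg, homogenize_mul _ _ le_rfl le_rfl, map_mul, homEval, homEval]

lemma homEval_X_sub_C (c : S) : homEval a b (X - C c) = a - algebraMap S B c * b := by
  rcases subsingleton_or_nontrivial S with h | h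
  · have := (algebraMap S B).codomain_trivial
    exact Subsingleton.elim _ _
  · simp [homEval, natDegree_X_sub_C, homogenize_sub, homogenize_X]

lemma homEval_prod {κ : Type*} (s : Finset κ) (c : κ → S) :
    homEval a b (∏ i ∈ s, (X - C (c i))) = ∏ i ∈ s, (a - algebraMap S B (c i) * b) := by
  induction s using Finset.induction_on with
  | empty => simp [homEval_one]
  | insert j s hj ih =>
    rw [Finset.prod_insert hj, Finset.prod_insert hj, homEval_mul a b (monic_X_sub_C _)
      (monic_prod_of_monic _ _ fun i _ => monic_X_sub_C _), ih, homEval_X_sub_C]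

lemma homEval_map {S' B' : Type*} [CommRing S'] [CommRing B'] [Algebra S' B'] (g : S →+* S')
    (ψ : B →+* B') (h : ∀ s, ψ (algebraMap S B s) = algebraMap S' B' (g s)) {f : S[X]}
    (hf : f.Monic) : homEval (ψ a) (ψ b) (f.map g) = ψ (homEval a b f) := by
  rcases subsingleton_or_nontrivial S' with hs | hs
  · have := (algebraMap S' B').codomain_trivial
    exact Subsingleton.elim _ _
  · rw [homEval, homEval, hf.natDegree_map, homogenize_map, MvPolynomial.aeval_def,
      MvPolynomial.eval₂_map, MvPolynomial.aeval_def, MvPolynomial.hom_eval₂]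
    congr 1
    · ext s; simp [h]
    · funext i; fin_cases i <;> rfl

end HomEval

namespace FrobTwist

open TensorProduct HomEval

variable {F A : Type} [Field F] [Fintype F] [CommRing A] [Algebra F A]
  {S T : Type} [CommRing S] [Algebra F S] [CommRing T] [Algebra F T]

/-- The endomorphism of `S ⊗ A` induced by the `q`-power map of `S`. -/
def tw : S ⊗[F] A →ₐ[F] S ⊗[F] A :=
  Algebra.TensorProduct.map (FiniteField.frobeniusAlgHom F S) (AlgHom.id F A)

variable (A) in
/-- Change of the coefficient ring. -/
def baseMap (g : S →ₐ[F] T) : S ⊗[F] A →ₐ[F] T ⊗[F] A :=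
  Algebra.TensorProduct.map g (AlgHom.id F A)

@[simp] lemma tw_tmul (s : S) (x : A) : tw (s ⊗ₜ[F] x) = (s ^ Fintype.card F) ⊗ₜ x := by
  simp [tw]

@[simp] lemma baseMap_tmul (g : S →ₐ[F] T) (s : S) (x : A) :
    baseMap A g (s ⊗ₜ[F] x) = g s ⊗ₜ x := by
  simp [baseMap]

lemma tw_baseMap (g : S →ₐ[F] T) (x : S ⊗[F] A) : tw (baseMap A g x) = baseMap A g (tw x) := by
  induction x with
  | zero => simp
  | tmul s x => simp
  | add x y hx hy => simp only [map_add, hx, hy]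

lemma tw_iterate_baseMap (g : S →ₐ[F] T) (x : S ⊗[F] A) (n : ℕ) :
    tw^[n] (baseMap A g x) = baseMap A g (tw^[n] x) := by
  induction n with
  | zero => rfl
  | succ n ih => rw [Function.iterate_succ_apply', Function.iterate_succ_apply', ih, tw_baseMap]

lemma tw_iterate_tmul (s : S) (x : A) (n : ℕ) :
    tw^[n] (s ⊗ₜ[F] x) = (s ^ Fintype.card F ^ n) ⊗ₜ x := by
  induction n with
  | zero => simp
  | succ n ih => rw [Function.iterate_succ_apply', ih, tw_tmul, ← pow_mul, pow_succ]

lemma baseMap_comp {U : Type} [CommRing U] [Algebra F U] (g' : T →ₐ[F] U)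
    (g : S →ₐ[F] T) (x : S ⊗[F] A) : baseMap A g' (baseMap A g x) = baseMap A (g'.comp g) x := by
  induction x with
  | zero => simp
  | tmul s x => simp
  | add x y hx hy => simp only [map_add, hx, hy]

/-- The linear form `a - y b` over `S`. -/
def linForm (a b : A) (y : S) : S ⊗[F] A := 1 ⊗ₜ a - y ⊗ₜ b

lemma tw_linForm (a b : A) (y : S) :
    tw (linForm (F := F) a b y) = linForm a b (y ^ Fintype.card F) := by
  simp [linForm]

lemma baseMap_linForm (g : S →ₐ[F] T) (a b : A) (y : S) :
    baseMap A g (linForm (F := F) a b y) = linForm a b (g y) := by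
  simp [linForm]

lemma tw_iterate_linForm (a b : A) (y : S) (n : ℕ) :
    tw^[n] (linForm (F := F) a b y) = linForm a b (y ^ Fintype.card F ^ n) := by
  induction n with
  | zero => simp
  | succ n ih => rw [Function.iterate_succ_apply', ih, tw_linForm, ← pow_mul, pow_succ]

lemma tw_iterate_mul (x y : S ⊗[F] A) (n : ℕ) : tw^[n] (x * y) = tw^[n] x * tw^[n] y :=
  iterate_map_mul tw n x y

lemma tw_iterate_eq {w θ v : S ⊗[F] A} (h : tw w = θ * v * w) (n : ℕ) :
    tw^[n] w = (∏ i ∈ Finset.range n, tw^[i] θ) * (∏ i ∈ Finset.range n, tw^[i] v) * w := by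
  induction n with
  | zero => simp
  | succ n ih =>
    rw [Function.iterate_succ_apply, h, tw_iterate_mul, tw_iterate_mul, ih, Finset.prod_range_succ,
      Finset.prod_range_succ]
    ring

lemma homEval_includeRight (a b : A) {P : F[X]} (hP : P.Monic) :
    homEval ((1 : S) ⊗ₜ[F] a) (1 ⊗ₜ b) (P.map (algebraMap F S)) = (1 : S) ⊗ₜ homEval a b P :=
  homEval_map a b (algebraMap F S)
    (Algebra.TensorProduct.includeRight : A →ₐ[F] S ⊗[F] A).toRingHom
    (fun s => by
      simp only [AlgHom.toRingHom_eq_coe, RingHom.coe_coe, AlgHom.commutes]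
      rw [Algebra.TensorProduct.algebraMap_apply, Algebra.TensorProduct.algebraMap_apply]
      simp) hP

lemma prod_linForm (a b : A) {P : F[X]} (hP : P.Monic) {κ : Type*} (s : Finset κ) (y : κ → S)
    (h : ∏ i ∈ s, (X - C (y i)) = P.map (algebraMap F S)) :
    ∏ i ∈ s, linForm a b (y i) = (1 : S) ⊗ₜ[F] homEval a b P := by
  rw [← homEval_includeRight a b hP, ← h, homEval_prod]
  refine Finset.prod_congr rfl fun i _ => ?_
  rw [linForm, Algebra.TensorProduct.algebraMap_apply, Algebra.TensorProduct.tmul_mul_tmul]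
  simp

variable {ι : Type} [Fintype ι] (e : Module.Basis ι F A)

/-- Coordinates of an element of `S ⊗ A`. -/
def coord (x : S ⊗[F] A) (j : ι) : S := (Algebra.TensorProduct.basis S e).repr x j

lemma sum_coord (x : S ⊗[F] A) : ∑ j, coord e x j ⊗ₜ[F] e j = x := by
  conv_rhs => rw [← (Algebra.TensorProduct.basis S e).sum_repr x]
  refine Finset.sum_congr rfl fun j _ => ?_
  rw [Algebra.TensorProduct.basis_apply, TensorProduct.smul_tmul', smul_eq_mul, mul_one, coord]

lemma coord_sum (W : ι → S) (j : ι) : coord e (∑ i, W i ⊗ₜ[F] e i) j = W j := by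
  have : ∑ i, W i ⊗ₜ[F] e i = ∑ i, W i • Algebra.TensorProduct.basis S e i :=
    Finset.sum_congr rfl fun i _ => by
      rw [Algebra.TensorProduct.basis_apply, TensorProduct.smul_tmul', smul_eq_mul, mul_one]
  rw [coord, this, Module.Basis.repr_sum_self]

lemma coord_injective : Function.Injective (coord e : S ⊗[F] A → ι → S) := fun x y h => by
  rw [← sum_coord e x, h, sum_coord]

lemma coord_baseMap (g : S →ₐ[F] T) (x : S ⊗[F] A) (j : ι) :
    coord e (baseMap A g x) j = g (coord e x j) := by
  conv_lhs => rw [← sum_coord e x, map_sum]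
  simp only [baseMap_tmul]
  rw [coord_sum]

lemma coord_tw_iterate (x : S ⊗[F] A) (n : ℕ) (j : ι) :
    coord e (tw^[n] x) j = coord e x j ^ Fintype.card F ^ n := by
  have : tw^[n] x = ∑ j, (coord e x j ^ Fintype.card F ^ n) ⊗ₜ[F] e j := by
    conv_lhs => rw [← sum_coord e x]
    have h2 : ∀ y, (tw (S := S) (A := A) (F := F))^[n] y = (tw (F := F) ^ n) y := fun y => by
      rw [AlgHom.coe_pow]
    rw [h2, map_sum]
    refine Finset.sum_congr rfl fun j _ => ?_
    rw [← h2, tw_iterate_tmul]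
  rw [this, coord_sum]

end FrobTwist

namespace FrobTwist

open TensorProduct HomEval

section AdjoinRoot

variable {F : Type} [Field F] [Fintype F] {P : F[X]}

lemma adjoinRoot_pow_card (hP : P.Monic) (hirr : Irreducible P) (z : AdjoinRoot P) :
    z ^ Fintype.card F ^ P.natDegree = z := by
  have : Fact (Irreducible P) := ⟨hirr⟩
  have hfin : Module.Finite F (AdjoinRoot P) := hP.finite_adjoinRoot
  have : Finite (AdjoinRoot P) := Module.finite_of_finite F
  have := Fintype.ofFinite (AdjoinRoot P)
  have hc : Fintype.card (AdjoinRoot P) = Fintype.card F ^ P.natDegree := by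
    rw [Module.card_eq_pow_finrank (K := F), (AdjoinRoot.powerBasis' hP).finrank]
    rfl
  rw [← hc, FiniteField.pow_card]

lemma eq_of_root_pow_eq (hP : P.Monic) (hirr : Irreducible P) {i j : ℕ} (hj : j < P.natDegree)
    (hij : i ≤ j) (h : AdjoinRoot.root P ^ Fintype.card F ^ i =
      AdjoinRoot.root P ^ Fintype.card F ^ j) : i = j := by
  have : Fact (Irreducible P) := ⟨hirr⟩
  have hfin : Module.Finite F (AdjoinRoot P) := hP.finite_adjoinRoot
  have : Finite (AdjoinRoot P) := Module.finite_of_finite F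
  have := Fintype.ofFinite (AdjoinRoot P)
  have hc : Fintype.card (AdjoinRoot P) = Fintype.card F ^ P.natDegree := by
    rw [Module.card_eq_pow_finrank (K := F), (AdjoinRoot.powerBasis' hP).finrank]
    rfl
  by_contra hne
  obtain ⟨d, rfl⟩ : ∃ d, j = d + i := ⟨j - i, by omega⟩
  let φ := FiniteField.frobeniusAlgHom F (AdjoinRoot P)
  have happ : ∀ n z, (φ ^ n) z = z ^ Fintype.card F ^ n := fun n z => by
    rw [AlgHom.coe_pow, FiniteField.coe_frobeniusAlgHom, pow_iterate]
  have hroot : (φ ^ d) (AdjoinRoot.root P) = AdjoinRoot.root P := by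
    apply (φ ^ i).toRingHom.injective
    change (φ ^ i) _ = (φ ^ i) _
    rw [← AlgHom.mul_apply, ← pow_add, happ, happ, add_comm, h]
  have hid : φ ^ d = AlgHom.id F _ := AdjoinRoot.algHom_ext hroot
  have hd : 0 < d := by omega
  have hq : 1 < Fintype.card F := Fintype.one_lt_card
  have hle := Polynomial.card_roots' (X ^ Fintype.card F ^ d - X : (AdjoinRoot P)[X])
  have hq' : 1 < Fintype.card F ^ d := Nat.one_lt_pow hd.ne' hq
  rw [FiniteField.X_pow_card_sub_X_natDegree_eq _ hq'] at hle
  have h0 := FiniteField.X_pow_card_sub_X_ne_zero (AdjoinRoot P) hq'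
  have hsub : (Finset.univ : Finset (AdjoinRoot P)).val ≤
      (X ^ Fintype.card F ^ d - X : (AdjoinRoot P)[X]).roots := by
    rw [Finset.val_le_iff_val_subset]
    intro z _
    rw [mem_roots h0, IsRoot, eval_sub, eval_pow, eval_X, ← happ, hid]
    simp
  have hle2 := (Multiset.card_le_card hsub).trans hle
  rw [Finset.card_val, Finset.card_univ, hc] at hle2
  have := (Nat.pow_le_pow_iff_right hq).mp hle2
  omega

/-- The conjugates of a root of an irreducible polynomial over a finite field are its
iterated `q`-powers. -/
lemma prod_X_sub_root_pow (hP : P.Monic) (hirr : Irreducible P) :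
    ∏ i ∈ Finset.range P.natDegree, (X - C (AdjoinRoot.root P ^ Fintype.card F ^ i)) =
      P.map (algebraMap F (AdjoinRoot P)) := by
  have : Fact (Irreducible P) := ⟨hirr⟩
  let φ := FiniteField.frobeniusAlgHom F (AdjoinRoot P)
  have happ : ∀ n z, (φ ^ n) z = z ^ Fintype.card F ^ n := fun n z => by
    rw [AlgHom.coe_pow, FiniteField.coe_frobeniusAlgHom, pow_iterate]
  have hinj : Set.InjOn (fun i => AdjoinRoot.root P ^ Fintype.card F ^ i)
      (Finset.range P.natDegree : Set ℕ) := by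
    intro i hi j hj h
    simp only [Finset.coe_range, Set.mem_Iio] at hi hj
    rcases le_total i j with hij | hij
    · exact eq_of_root_pow_eq hP hirr hj hij h
    · exact (eq_of_root_pow_eq hP hirr hi hij h.symm).symm
  have hmon : (P.map (algebraMap F (AdjoinRoot P))).Monic := hP.map _
  have hdvd : ∏ i ∈ Finset.range P.natDegree, (X - C (AdjoinRoot.root P ^ Fintype.card F ^ i)) ∣
      P.map (algebraMap F (AdjoinRoot P)) := by
    refine Finset.prod_dvd_of_coprime (fun i hi j hj hij => ?_) fun i _ => ?_
    · exact pairwise_coprime_X_sub_C (Function.injective_id)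
        (fun h => hij (hinj hi hj h))
    · rw [dvd_iff_isRoot, IsRoot, eval_map_algebraMap, ← happ, aeval_algHom_apply]
      rw [AdjoinRoot.aeval_eq, AdjoinRoot.mk_self, map_zero]
  symm
  refine eq_of_monic_of_dvd_of_natDegree_le (monic_prod_of_monic _ _ fun i _ => monic_X_sub_C _)
    hmon hdvd ?_
  rw [hP.natDegree_map, natDegree_prod_of_monic _ _ fun i _ => monic_X_sub_C _]
  simp only [natDegree_X_sub_C, Finset.sum_const, Finset.card_range, smul_eq_mul, mul_one, le_refl]

end AdjoinRoot

variable {F A k R ι : Type} [Field F] [Fintype F] [CommRing A] [Algebra F A] [Field k] [Algebra F k]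
  [CommRing R] [Algebra k[X] R] [Algebra F R] [IsScalarTower F k[X] R] [Fintype ι]
  (e : Module.Basis ι F A) (a b : A)

variable (F k R) in
/-- Constants of a `k[X]`-algebra. -/
def constHom : k →ₐ[F] R := (IsScalarTower.toAlgHom F k[X] R).comp CAlgHom

/-- The polynomial `P(X + c)`. -/
def shift (c : k) (P : F[X]) : k[X] := aeval (X + C c) P

theorem shift_dvd {c : k} {w : R ⊗[F] A} {θ : k ⊗[F] A}
    (hw : tw w = baseMap A (constHom F k R) θ *
      linForm a b (algebraMap k[X] R (X + C c)) * w)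
    {P : F[X]} (hP : P.Monic) (hirr : Irreducible P)
    (hθ : ∏ i ∈ Finset.range P.natDegree, tw^[i] θ = 1)
    (hk : ∀ z : k, z ^ Fintype.card F ^ P.natDegree = z) (p : MvPolynomial ι k[X]) :
    algebraMap k[X] R (shift c P) ∣
      MvPolynomial.aeval (coord e w) p ^ Fintype.card F ^ P.natDegree -
        MvPolynomial.aeval (coord e ((1 ⊗ₜ homEval a b P) * w)) p := by
  set n := P.natDegree
  set I : Ideal R := Ideal.span {algebraMap k[X] R (shift c P)}
  let g : R →ₐ[F] R ⧸ I := Ideal.Quotient.mkₐ F I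
  set y : R ⧸ I := g (algebraMap k[X] R (X + C c)) with hy
  have hg0 : g (algebraMap k[X] R (shift c P)) = 0 :=
    Ideal.Quotient.eq_zero_iff_mem.mpr (Ideal.subset_span rfl)
  have hy0 : aeval y P = 0 := by
    rw [hy, aeval_algHom_apply, ← hg0, shift]
    congr 1
    rw [aeval_algebraMap_apply]
  let ψ : AdjoinRoot P →ₐ[F] R ⧸ I := AdjoinRoot.liftAlgHom P (Algebra.ofId F _) y hy0
  have hψ : ψ (AdjoinRoot.root P) = y := AdjoinRoot.liftAlgHom_root ..
  have hyn : y ^ Fintype.card F ^ n = y := by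
    rw [← hψ, ← map_pow, adjoinRoot_pow_card hP hirr]
  have hprod : ∏ i ∈ Finset.range n, (X - C (y ^ Fintype.card F ^ i)) =
      P.map (algebraMap F (R ⧸ I)) := by
    have h1 := congrArg (Polynomial.map ψ.toRingHom) (prod_X_sub_root_pow hP hirr)
    rw [Polynomial.map_map, Polynomial.map_prod] at h1
    have h2 : (ψ.toRingHom).comp (algebraMap F (AdjoinRoot P)) = algebraMap F (R ⧸ I) :=
      ψ.comp_algebraMap
    rw [h2] at h1
    rw [← h1]
    refine Finset.prod_congr rfl fun i _ => ?_
    simp [hψ]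
  have hw1 : tw^[n] (baseMap A g w) = (1 ⊗ₜ homEval a b P) * baseMap A g w := by
    have h1 : tw (baseMap A g w) = baseMap A (g.comp (constHom F k R)) θ * linForm a b y *
        baseMap A g w := by
      rw [tw_baseMap, hw, map_mul, map_mul, baseMap_comp, baseMap_linForm]
    rw [tw_iterate_eq h1]
    congr 1
    have h2 : ∏ i ∈ Finset.range n, tw^[i] (baseMap A (g.comp (constHom F k R)) θ) = 1 := by
      simp only [tw_iterate_baseMap]
      rw [← map_prod, hθ, map_one]
    rw [h2, one_mul]
    simp only [tw_iterate_linForm]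
    exact prod_linForm a b hP _ _ hprod
  have hcoord : ∀ j, g (coord e w j) ^ Fintype.card F ^ n =
      g (coord e ((1 ⊗ₜ homEval a b P) * w) j) := fun j => by
    rw [← coord_baseMap, ← coord_tw_iterate, hw1, ← coord_baseMap, map_mul, baseMap_tmul, map_one]
  let φ := FiniteField.frobeniusAlgHom F (R ⧸ I) ^ n
  have happ : ∀ z, φ z = z ^ Fintype.card F ^ n := fun z => by
    rw [AlgHom.coe_pow, FiniteField.coe_frobeniusAlgHom, pow_iterate]
  have hhom : (φ.toRingHom.comp g.toRingHom).comp
        (MvPolynomial.aeval (R := k[X]) (coord e w)).toRingHom =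
      g.toRingHom.comp
        (MvPolynomial.aeval (R := k[X]) (coord e ((1 ⊗ₜ homEval a b P) * w))).toRingHom := by
    refine MvPolynomial.ringHom_ext' ?_ fun j => ?_
    · have hC : ∀ z : k, φ (g (algebraMap k[X] R (C z))) = g (algebraMap k[X] R (C z)) :=
        fun z => by rw [happ, ← map_pow, ← map_pow, ← C_pow, hk]
      refine Polynomial.ringHom_ext (fun z => ?_) ?_
      · simpa using hC z
      · have h1 : g (algebraMap k[X] R X) = y - g (algebraMap k[X] R (C c)) := by
          rw [hy, map_add, map_add, add_sub_cancel_right]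
        have h2 : φ (g (algebraMap k[X] R X)) = g (algebraMap k[X] R X) := by
          rw [h1, map_sub, hC, happ, hyn]
        simpa using h2
    · have h1 : φ (g (coord e w j)) = g (coord e ((1 ⊗ₜ homEval a b P) * w) j) := by
        rw [happ, hcoord]
      simpa using h1
  have hfin := RingHom.congr_fun hhom p
  rw [← Ideal.mem_span_singleton, ← Ideal.Quotient.eq_zero_iff_mem]
  change g _ = 0
  rw [map_sub, sub_eq_zero, map_pow, ← happ]
  exact hfin

end FrobTwist

namespace FrobTwist

open TensorProduct HomEval

variable {F A : Type} [Field F] [Fintype F] [CommRing A] [Algebra F A]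
  {S : Type} [CommRing S] [Algebra F S] {ι : Type} [Fintype ι] (e : Module.Basis ι F A)

lemma coord_sub (x y : S ⊗[F] A) (j : ι) : coord e (x - y) j = coord e x j - coord e y j := by
  simp [coord]

lemma coord_smul (s : S) (x : S ⊗[F] A) (j : ι) : coord e (s • x) j = s * coord e x j := by
  simp [coord]

lemma coord_finset_sum {κ : Type*} (t : Finset κ) (x : κ → S ⊗[F] A) (j : ι) :
    coord e (∑ i ∈ t, x i) j = ∑ i ∈ t, coord e (x i) j := by
  simp [coord]

lemma coord_mul (τ x : S ⊗[F] A) (j : ι) :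
    coord e (τ * x) j = ∑ i, coord e x i * coord e (τ * (1 ⊗ₜ e i)) j := by
  conv_lhs => rw [← sum_coord e x, Finset.mul_sum]
  rw [coord_finset_sum]
  refine Finset.sum_congr rfl fun i _ => ?_
  rw [← coord_smul, mul_comm τ, mul_comm τ, ← smul_mul_assoc, TensorProduct.smul_tmul',
    smul_eq_mul, mul_one]

lemma coord_tw (x : S ⊗[F] A) (j : ι) : coord e (tw x) j = coord e x j ^ Fintype.card F := by
  simpa using coord_tw_iterate e x 1 j

lemma baseMap_injective (e : Module.Basis ι F A) {T : Type} [CommRing T] [Algebra F T] {g : S →ₐ[F] T}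
    (hg : Function.Injective g) : Function.Injective (baseMap A g) := fun x y h => by
  refine coord_injective e (funext fun j => hg ?_)
  rw [← coord_baseMap, ← coord_baseMap, h]

variable {k : Type} [Field k] [Algebra F k]

lemma coeff_pow_card (f : PowerSeries k) (n : ℕ) :
    PowerSeries.coeff n (f ^ Fintype.card F) =
      if Fintype.card F ∣ n then PowerSeries.coeff (n / Fintype.card F) f ^ Fintype.card F
      else 0 := by
  obtain ⟨p, hp⟩ := CharP.exists F
  obtain ⟨m, hpp, hm⟩ := FiniteField.card F p
  have : Fact p.Prime := ⟨hpp⟩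
  have : CharP k p := charP_of_injective_algebraMap (algebraMap F k).injective p
  have hne : p ^ (m : ℕ) ≠ 0 := pow_ne_zero _ hpp.ne_zero
  have h := MvPowerSeries.map_iterateFrobenius_expand p hpp.ne_zero f (m : ℕ)
  rw [hm, ← h]
  change PowerSeries.coeff n (PowerSeries.map (iterateFrobenius k p m)
    (PowerSeries.expand (p ^ (m : ℕ)) hne f)) = _
  rw [PowerSeries.coeff_map, PowerSeries.coeff_expand]
  split_ifs
  · rw [iterateFrobenius_def]
  · simp

variable (F) in
lemma succ_div_card_lt (n : ℕ) : (n + 1) / Fintype.card F < n + 1 :=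
  Nat.div_lt_self (Nat.succ_pos n) Fintype.one_lt_card

instance : IsScalarTower F k[X] (PowerSeries k) :=
  IsScalarTower.of_algebraMap_eq fun r => by
    rw [PowerSeries.algebraMap_apply, Polynomial.algebraMap_apply, PowerSeries.algebraMap_apply']
    simp

/-- The coefficients of the solution of `tw w = (1 - X τ) w`. -/
def solCoeff (τ : k ⊗[F] A) : ℕ → k ⊗[F] A
  | 0 => 1
  | n + 1 =>
    have := succ_div_card_lt F n
    τ * solCoeff τ n +
      if Fintype.card F ∣ n + 1 then tw (solCoeff τ ((n + 1) / Fintype.card F)) else 0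
  decreasing_by
  · omega
  · assumption

/-- The solution of `tw w = (1 - X τ) w` with constant coefficient `1`. -/
def sol (τ : k ⊗[F] A) : PowerSeries k ⊗[F] A :=
  ∑ j, PowerSeries.mk (fun n => coord e (solCoeff τ n) j) ⊗ₜ e j

lemma coord_sol (τ : k ⊗[F] A) (j : ι) :
    coord e (sol e τ) j = PowerSeries.mk fun n => coord e (solCoeff τ n) j :=
  coord_sum e _ j

variable (F k) in
/-- The constant coefficient. -/
def constCoeff : PowerSeries k →ₐ[F] k :=
  { PowerSeries.constantCoeff with
    commutes' := fun r => by
      rw [PowerSeries.algebraMap_apply]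
      simp }

lemma baseMap_sol (τ : k ⊗[F] A) : baseMap A (constCoeff F k) (sol e τ) = 1 := by
  refine coord_injective e (funext fun j => ?_)
  rw [coord_baseMap, coord_sol]
  change PowerSeries.constantCoeff _ = _
  rw [← PowerSeries.coeff_zero_eq_constantCoeff_apply, PowerSeries.coeff_mk, solCoeff]

lemma tw_sol (τ : k ⊗[F] A) :
    tw (sol e τ) = sol e τ -
      (PowerSeries.X : PowerSeries k) • (baseMap A (constHom F k (PowerSeries k)) τ * sol e τ) := by
  refine coord_injective e (funext fun j => ?_)
  rw [coord_tw, coord_sub, coord_smul, coord_mul]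
  have h1 : ∀ i, coord e (baseMap A (constHom F k (PowerSeries k)) τ * 1 ⊗ₜ[F] e i) j =
      PowerSeries.C (coord e (τ * 1 ⊗ₜ[F] e i) j) := fun i => by
    rw [← map_one (constHom F k (PowerSeries k)), ← baseMap_tmul, ← map_mul, coord_baseMap]
    simp [constHom, PowerSeries.algebraMap_apply']
  simp only [h1, coord_sol]
  ext n
  rw [coeff_pow_card (F := F), map_sub, PowerSeries.coeff_mk, PowerSeries.coeff_mk]
  cases n with
  | zero =>
    simp only [dvd_zero, if_true, Nat.zero_div, PowerSeries.coeff_zero_X_mul, sub_zero]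
    rw [← coord_tw, solCoeff, map_one]
  | succ n =>
    rw [PowerSeries.coeff_succ_X_mul, map_sum]
    simp only [PowerSeries.coeff_mul_C, PowerSeries.coeff_mk]
    rw [← coord_mul, ← coord_sub, ← coord_tw, solCoeff, add_sub_cancel_left]
    split_ifs
    · rfl
    · simp [coord]

end FrobTwist

namespace FrobTwist

open TensorProduct HomEval

section Integral

variable {K L ι : Type} [CommRing K] [IsNoetherianRing K] [CommRing L] [Algebra K L] [Finite ι]

lemma pow_mem_span {q : ℕ} (hadd : ∀ x y : L, (x + y) ^ q = x ^ q + y ^ q) (hq : q ≠ 0)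
    {W : ι → L} (hW : ∀ j, W j ^ q ∈ Submodule.span K (Set.range W)) {x : L}
    (hx : x ∈ Submodule.span K (Set.range W)) : x ^ q ∈ Submodule.span K (Set.range W) := by
  induction hx using Submodule.span_induction with
  | mem x h => obtain ⟨j, rfl⟩ := h; exact hW j
  | zero => simp [hq]
  | add x y _ _ hx hy => rw [hadd]; exact add_mem hx hy
  | smul c x _ hx => rw [_root_.smul_pow]; exact Submodule.smul_mem _ _ hx

/-- If the `q`-powers of finitely many elements are linear combinations of them, where
`q` is a power of the characteristic, then these elements are integral. -/
lemma isIntegral_of_pow_mem_span {q : ℕ} (hadd : ∀ x y : L, (x + y) ^ q = x ^ q + y ^ q)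
    (hq : 1 < q) {W : ι → L} (hW : ∀ j, W j ^ q ∈ Submodule.span K (Set.range W)) (j : ι) :
    IsIntegral K (W j) := by
  nontriviality K
  set M := Submodule.span K (Set.range W)
  have hM : IsNoetherian K M := isNoetherian_span_of_finite K (Set.finite_range W)
  set x := W j
  have hx : ∀ i, x ^ q ^ i ∈ M := fun i => by
    induction i with
    | zero => simpa using Submodule.subset_span (Set.mem_range_self j)
    | succ i ih =>
      rw [pow_succ, pow_mul]
      exact pow_mem_span hadd (by omega) hW ih
  let N : ℕ →o Submodule K M :=
    { toFun := fun n => Submodule.span K ((fun i => (⟨x ^ q ^ i, hx i⟩ : M)) '' Set.Iio n)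
      monotone' := fun m n h => Submodule.span_mono (Set.image_mono (Set.Iio_subset_Iio h)) }
  obtain ⟨n, hn⟩ := monotone_stabilizes_iff_noetherian.mpr hM N
  have h1 : (⟨x ^ q ^ n, hx n⟩ : M) ∈ N n := by
    rw [hn (n + 1) (by omega)]
    exact Submodule.subset_span ⟨n, by simp, rfl⟩
  have h2 : N n ≤ ((degreeLT K (q ^ n)).map (aeval x).toLinearMap).comap M.subtype := by
    refine Submodule.span_le.mpr ?_
    rintro _ ⟨i, hi, rfl⟩
    refine ⟨X ^ q ^ i, ?_, by simp⟩
    rw [SetLike.mem_coe, mem_degreeLT, degree_X_pow]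
    exact_mod_cast Nat.pow_lt_pow_right hq hi
  obtain ⟨f, hf, hfx⟩ := h2 h1
  rw [SetLike.mem_coe, mem_degreeLT] at hf
  refine ⟨X ^ q ^ n - f, monic_X_pow_sub (by exact_mod_cast hf), ?_⟩
  rw [← aeval_def, map_sub, map_pow, aeval_X, sub_eq_zero]
  exact hfx.symm

lemma finite_adjoin_of_pow_mem_span {q : ℕ} (hadd : ∀ x y : L, (x + y) ^ q = x ^ q + y ^ q)
    (hq : 1 < q) {W : ι → L} (hW : ∀ j, W j ^ q ∈ Submodule.span K (Set.range W)) :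
    Module.Finite K (Algebra.adjoin K (Set.range W)) := by
  have h := fg_adjoin_of_finite (R := K) (Set.finite_range W) fun x hx => by
    obtain ⟨j, rfl⟩ := hx
    exact isIntegral_of_pow_mem_span hadd hq hW j
  exact Module.Finite.iff_fg.mpr h

end Integral

variable {F A k R ι : Type} [Field F] [Fintype F] [CommRing A] [Algebra F A] [Field k] [Algebra F k]
  [CommRing R] [Algebra k[X] R] [Algebra F R] [IsScalarTower F k[X] R] [Fintype ι]
  (e : Module.Basis ι F A) (a b : A)

/-- A `k[X]`-algebra endomorphism as an `F`-algebra endomorphism. -/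
def restr (σ : R →ₐ[k[X]] R) : R →ₐ[F] R := σ.restrictScalars F

/-- The units of `A` acting on the algebra generated by the coordinates of `w`. -/
def autGroup [Finite A] (w : R ⊗[F] A) : Subgroup Aˣ :=
  let M : Submonoid Aˣ :=
    { carrier := {h | ∃ σ : R →ₐ[k[X]] R, baseMap A (restr (F := F) σ) w = (1 ⊗ₜ (h : A)) * w}
      one_mem' := ⟨AlgHom.id _ _, by
        rw [show restr (F := F) (AlgHom.id k[X] R) = AlgHom.id F R from rfl, baseMap,
          Algebra.TensorProduct.map_id]
        simp [← Algebra.TensorProduct.one_def]⟩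
      mul_mem' := by
        rintro g h ⟨σ, hσ⟩ ⟨τ, hτ⟩
        refine ⟨σ.comp τ, ?_⟩
        have : restr (F := F) (σ.comp τ) = (restr σ).comp (restr τ) := rfl
        rw [this, ← baseMap_comp, hτ, map_mul, hσ, baseMap_tmul, map_one, ← mul_assoc,
          Algebra.TensorProduct.tmul_mul_tmul, mul_one, mul_comm, Units.val_mul]
        ring_nf }
  { M with
    inv_mem' := fun {h} hh => by
      have h1 : h⁻¹ ∈ Submonoid.powers h := by
        rw [mem_powers_iff_mem_zpowers]
        exact inv_mem (Subgroup.mem_zpowers h)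
      exact (Submonoid.powers_le (P := M)).mpr hh h1 }

lemma mem_autGroup [Finite A] {w : R ⊗[F] A} {h : Aˣ} : h ∈ autGroup (k := k) w ↔
    ∃ σ : R →ₐ[k[X]] R, baseMap A (restr (F := F) σ) w = (1 ⊗ₜ (h : A)) * w := Iff.rfl

lemma algHom_ext_of_baseMap {w : R ⊗[F] A}
    (hgen : Algebra.adjoin k[X] (Set.range (coord e w)) = ⊤) {σ τ : R →ₐ[k[X]] R}
    (h : baseMap A (restr (F := F) σ) w = baseMap A (restr τ) w) : σ = τ := by
  refine AlgHom.ext_of_adjoin_eq_top hgen ?_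
  rintro _ ⟨j, rfl⟩
  have := congrArg (fun x => coord e x j) h
  simp only [coord_baseMap] at this
  exact this

lemma exists_algEquiv [Finite A] {w : R ⊗[F] A}
    (hgen : Algebra.adjoin k[X] (Set.range (coord e w)) = ⊤) {h : Aˣ}
    (hh : h ∈ autGroup (k := k) w) :
    ∃ σ : R ≃ₐ[k[X]] R, baseMap A (restr (F := F) σ.toAlgHom) w = (1 ⊗ₜ (h : A)) * w := by
  have key : ∀ g g' : Aˣ, ∀ σ τ : R →ₐ[k[X]] R, g * g' = 1 →
      baseMap A (restr (F := F) σ) w = (1 ⊗ₜ (g : A)) * w →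
      baseMap A (restr (F := F) τ) w = (1 ⊗ₜ (g' : A)) * w → σ.comp τ = AlgHom.id _ _ := by
    intro g g' σ τ hg hσ hτ
    refine algHom_ext_of_baseMap e hgen ?_
    have h1 : restr (F := F) (σ.comp τ) = (restr σ).comp (restr τ) := rfl
    have h2 : restr (F := F) (AlgHom.id k[X] R) = AlgHom.id F R := rfl
    rw [h1, ← baseMap_comp, hτ, map_mul, hσ, baseMap_tmul, map_one, ← mul_assoc,
      Algebra.TensorProduct.tmul_mul_tmul, mul_one, mul_comm, ← Units.val_mul, mul_comm g', hg, h2,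
      baseMap, Algebra.TensorProduct.map_id]
    simp [← Algebra.TensorProduct.one_def]
  obtain ⟨σ, hσ⟩ := mem_autGroup.mp hh
  obtain ⟨τ, hτ⟩ := mem_autGroup.mp (inv_mem hh)
  exact ⟨AlgEquiv.ofAlgHom σ τ (key _ _ σ τ (mul_inv_cancel h) hσ hτ)
    (key _ _ τ σ (inv_mul_cancel h) hτ hσ), hσ⟩

lemma exists_relation [Finite A] {w : R ⊗[F] A}
    (hgen : Algebra.adjoin k[X] (Set.range (coord e w)) = ⊤) {h : Aˣ}
    (hh : h ∉ autGroup (k := k) w) :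
    ∃ p : MvPolynomial ι k[X], MvPolynomial.aeval (coord e w) p = 0 ∧
      MvPolynomial.aeval (coord e ((1 ⊗ₜ (h : A)) * w)) p ≠ 0 := by
  by_contra! hcon
  apply hh
  let π : MvPolynomial ι k[X] →ₐ[k[X]] R := MvPolynomial.aeval (coord e w)
  let π' : MvPolynomial ι k[X] →ₐ[k[X]] R := MvPolynomial.aeval (coord e ((1 ⊗ₜ (h : A)) * w))
  have hsurj : Function.Surjective π := by
    rw [← AlgHom.range_eq_top, ← hgen, Algebra.adjoin_range_eq_range_aeval]
  let σ : R →ₐ[k[X]] R := (Ideal.Quotient.liftₐ (RingHom.ker π) π' hcon).comp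
    (Ideal.quotientKerAlgEquivOfSurjective hsurj).symm.toAlgHom
  have hσ : ∀ p, σ (π p) = π' p := fun p => by
    have : (Ideal.quotientKerAlgEquivOfSurjective hsurj).symm (π p) =
        Ideal.Quotient.mk (RingHom.ker π) p := by
      rw [AlgEquiv.symm_apply_eq]; rfl
    change Ideal.Quotient.liftₐ (RingHom.ker π) π' hcon
      ((Ideal.quotientKerAlgEquivOfSurjective hsurj).symm (π p)) = _
    rw [this]; rfl
  refine ⟨σ, coord_injective e (funext fun j => ?_)⟩
  rw [coord_baseMap]
  change σ (coord e w j) = _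
  have := hσ (MvPolynomial.X j)
  simpa [π, π'] using this

/-- The number of automorphisms is at most the rank. -/
lemma card_autGroup_le [Finite A] [IsDomain R] [Module.Finite k[X] R] [Module.Free k[X] R]
    {w : R ⊗[F] A} {ev : R →ₐ[F] k} (hev : baseMap A ev w = 1) :
    Nat.card (autGroup (k := k) w) ≤ Module.finrank k[X] R := by
  choose σ hσ using fun h : autGroup (k := k) w => mem_autGroup.mp h.2
  have hinj : Function.Injective σ := fun g h hgh => by
    have h1 := hσ g
    rw [hgh, hσ h] at h1
    have h2 := congrArg (baseMap A ev) h1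
    rw [map_mul, map_mul, hev, mul_one, mul_one, baseMap_tmul, baseMap_tmul, map_one] at h2
    have h3 := Algebra.TensorProduct.includeRight_injective (R := F) (A := k) (B := A)
      (algebraMap F k).injective h2
    exact Subtype.ext (Units.ext h3.symm)
  have hlin := (linearIndependent_toLinearMap k[X] R R).comp σ hinj
  have := Fintype.ofFinite (autGroup (k := k) w)
  have := hlin.fintype_card_le_finrank
  rwa [Module.finrank_linearMap_self, ← Nat.card_eq_fintype_card] at this

end FrobTwist

namespace FrobTwist

open TensorProduct HomEval

variable {F A k R ι : Type} [Field F] [Fintype F] [CommRing A] [Algebra F A] [Field k] [Algebra F k]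
  [CommRing R] [Algebra k[X] R] [Algebra F R] [IsScalarTower F k[X] R] [Fintype ι]
  (e : Module.Basis ι F A) (a b : A)

lemma natDegree_shift (c : k) (P : F[X]) : (shift c P).natDegree = P.natDegree := by
  have : shift c P = (P.map (algebraMap F k)).comp (X + C c) := by
    rw [shift, aeval_def, Polynomial.comp, eval₂_map]
    rfl
  rw [this, natDegree_comp, natDegree_X_add_C, mul_one, natDegree_map]

lemma isCoprime_shift (c : k) {P Q : F[X]} (hP : P.Monic) (hPi : Irreducible P) (hQ : Q.Monic)
    (hQi : Irreducible Q) (h : P ≠ Q) : IsCoprime (shift c P) (shift c Q) := by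
  refine IsCoprime.map ?_ (aeval (X + C c) : F[X] →ₐ[F] k[X]).toRingHom
  refine (hPi.coprime_iff_not_dvd).mpr fun hdvd => h ?_
  exact eq_of_monic_of_associated hP hQ (hPi.associated_of_dvd hQi hdvd)

/-- The distribution among the values of `homEval a b` of the monic irreducible polynomials
of degree `n`: in each class of `H` there are at most `q ^ n / (n |H|) + O(q ^ (n / 2))`, and
none outside `H`. -/
def UpperDistribution (a b : A) (H : Subgroup Aˣ) (C n : ℕ) : Prop :=
  (∀ h : Aˣ, h ∉ H → ∀ P : F[X], P.Monic → Irreducible P → P.natDegree = n →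
    homEval a b P ≠ h) ∧
  ∀ h ∈ H, ∀ s : Finset F[X],
    (∀ P ∈ s, P.Monic ∧ Irreducible P ∧ P.natDegree = n ∧ homEval a b P = h) →
    Nat.card H * (n * s.card) ≤ Fintype.card F ^ n + C * Fintype.card F ^ (n / 2)

lemma natDegree_le_of_not_mem [Finite A] [IsDomain R] [Module.Finite k[X] R] [Module.Free k[X] R]
    {w : R ⊗[F] A} (hgen : Algebra.adjoin k[X] (Set.range (coord e w)) = ⊤) {c : k}
    {θ : k ⊗[F] A}
    (hw : tw w = baseMap A (constHom F k R) θ * linForm a b (algebraMap k[X] R (X + C c)) * w)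
    {h : Aˣ} (hh : h ∉ autGroup (k := k) w) :
    ∃ n₀, ∀ P : F[X], P.Monic → Irreducible P → homEval a b P = h →
      ∏ i ∈ Finset.range P.natDegree, tw^[i] θ = 1 →
      (∀ z : k, z ^ Fintype.card F ^ P.natDegree = z) → P.natDegree ≤ n₀ := by
  obtain ⟨p, hp0, hp1⟩ := exists_relation e hgen hh
  let B := Module.Free.chooseBasis k[X] R
  refine ⟨CoordDegree.cdeg B (MvPolynomial.aeval (coord e ((1 ⊗ₜ (h : A)) * w)) p),
    fun P hP hPi hPh hθ hk => ?_⟩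
  have hdvd := shift_dvd e a b hw hP hPi hθ hk p
  rw [hp0, hPh, zero_pow (pow_ne_zero _ Fintype.card_ne_zero), zero_sub, dvd_neg] at hdvd
  rw [← natDegree_shift c P]
  exact CoordDegree.natDegree_le_cdeg B hp1 fun i => CoordDegree.dvd_repr_of_dvd B hdvd i

lemma card_le_of_mem [Finite A] [IsDomain R] [Module.Finite k[X] R] [Module.Free k[X] R] [Finite k]
    {κ : R →ₐ[k[X]] PowerSeries k} (hκ : Function.Injective κ)
    {w : R ⊗[F] A} (hgen : Algebra.adjoin k[X] (Set.range (coord e w)) = ⊤) {c : k}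
    {ev : R →ₐ[F] k} (hev : baseMap A ev w = 1)
    {θ : k ⊗[F] A}
    (hw : tw w = baseMap A (constHom F k R) θ * linForm a b (algebraMap k[X] R (X + C c)) * w)
    {h : Aˣ} (hh : h ∈ autGroup (k := k) w) :
    ∃ C n₀ : ℕ, ∀ n, n₀ ≤ n → Even n → ∏ i ∈ Finset.range n, tw^[i] θ = 1 →
      (∀ z : k, z ^ Fintype.card F ^ n = z) → ∀ s : Finset F[X],
      (∀ P ∈ s, P.Monic ∧ Irreducible P ∧ P.natDegree = n ∧ homEval a b P = h) →
      Nat.card (autGroup (k := k) w) * (n * s.card) ≤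
        Fintype.card F ^ n + C * Fintype.card F ^ (n / 2) := by
  obtain ⟨p, hp⟩ := CharP.exists F
  obtain ⟨f, hpp, hf⟩ := FiniteField.card F p
  have : Fact p.Prime := ⟨hpp⟩
  have : Nontrivial R := inferInstance
  have : CharP R p := charP_of_injective_algebraMap (algebraMap F R).injective p
  have : ExpChar R p := ExpChar.prime hpp
  obtain ⟨σ, hσ⟩ := exists_algEquiv e hgen hh
  let B := Module.Free.chooseBasis k[X] R
  obtain ⟨C, ℓ₀, hC⟩ := CoordDegree.exists_natDegree_prod_le p B κ hκ σ
  refine ⟨C, 2 * ℓ₀, fun n hn heven hθ hk s hs => ?_⟩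
  obtain ⟨ν, rfl⟩ := heven.two_dvd
  have hq : Fintype.card F ^ ν = p ^ ((f : ℕ) * ν) := by rw [hf, pow_mul]
  have hq2 : Fintype.card F ^ (2 * ν) = (p ^ ((f : ℕ) * ν)) ^ 2 := by
    rw [← hq, ← pow_mul, mul_comm]
  have hbig : ℓ₀ ≤ p ^ ((f : ℕ) * ν) := by
    rw [← hq]
    have := (Nat.lt_pow_self (n := ν) (Fintype.one_lt_card : 1 < Fintype.card F)).le
    omega
  have hmain := hC _ hbig s (fun P => shift c P)
    (fun P hP Q hQ hPQ => isCoprime_shift c (hs P hP).1 (hs P hP).2.1 (hs Q hQ).1 (hs Q hQ).2.1 hPQ)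
    (fun P hP r => ?_)
  · have hdeg : (∏ P ∈ s, shift c P).natDegree = 2 * ν * s.card := by
      rw [natDegree_prod _ _ fun P hP h0 => ?_]
      · rw [Finset.sum_congr rfl fun P hP => (natDegree_shift c P).trans (hs P hP).2.2.1,
          Finset.sum_const, smul_eq_mul, mul_comm]
      · have h1 := natDegree_shift c P
        rw [h0, natDegree_zero] at h1
        exact (hs P hP).2.1.natDegree_pos.ne h1
    rw [hdeg] at hmain
    have hcard := card_autGroup_le (k := k) (R := R) hev
    rw [Module.finrank_eq_card_basis B] at hcard
    rw [hq2, Nat.mul_div_cancel_left _ two_pos, hq]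
    exact (Nat.mul_le_mul_right _ hcard).trans hmain
  · obtain ⟨hPm, hPi, hPd, hPh⟩ := hs P hP
    have hsurj : Function.Surjective (MvPolynomial.aeval (coord e w) :
        MvPolynomial ι k[X] →ₐ[k[X]] R) := by
      rw [← AlgHom.range_eq_top, ← hgen, Algebra.adjoin_range_eq_range_aeval]
    obtain ⟨p, rfl⟩ := hsurj r
    have hdvd := shift_dvd e a b hw hPm hPi (by rwa [hPd]) (by rwa [hPd]) p
    have hσp : σ (MvPolynomial.aeval (coord e w) p) =
        MvPolynomial.aeval (coord e ((1 ⊗ₜ (h : A)) * w)) p := by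
      have h1 : σ.toAlgHom.comp (MvPolynomial.aeval (coord e w)) =
          MvPolynomial.aeval (coord e ((1 ⊗ₜ (h : A)) * w)) := by
        refine MvPolynomial.algHom_ext fun j => ?_
        rw [← hσ]
        simp only [AlgHom.comp_apply, MvPolynomial.aeval_X, coord_baseMap]
        rfl
      rw [← h1]; rfl
    rw [hσp, ← hq2]
    rwa [hPh, hPd] at hdvd

theorem upperDistribution_of_model [Finite A] [IsDomain R] [Module.Finite k[X] R]
    [Module.Free k[X] R] [Finite k]
    {κ : R →ₐ[k[X]] PowerSeries k} (hκ : Function.Injective κ)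
    {w : R ⊗[F] A} (hgen : Algebra.adjoin k[X] (Set.range (coord e w)) = ⊤) {c : k}
    {ev : R →ₐ[F] k} (hev : baseMap A ev w = 1)
    {θ : k ⊗[F] A}
    (hw : tw w = baseMap A (constHom F k R) θ * linForm a b (algebraMap k[X] R (X + C c)) * w) :
    ∃ (H : Subgroup Aˣ) (C n₀ : ℕ), ∀ n, n₀ ≤ n → Even n → ∏ i ∈ Finset.range n, tw^[i] θ = 1 →
      (∀ z : k, z ^ Fintype.card F ^ n = z) → UpperDistribution (F := F) a b H C n := by
  have hA := Fintype.ofFinite Aˣ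
  have h1 : ∀ h : Aˣ, ∃ n₀, h ∉ autGroup (k := k) w → ∀ P : F[X], P.Monic → Irreducible P →
      homEval a b P = h → ∏ i ∈ Finset.range P.natDegree, tw^[i] θ = 1 →
      (∀ z : k, z ^ Fintype.card F ^ P.natDegree = z) → P.natDegree ≤ n₀ := fun h => by
    by_cases hh : h ∈ autGroup (k := k) w
    · exact ⟨0, fun h' => absurd hh h'⟩
    · obtain ⟨n₀, hn⟩ := natDegree_le_of_not_mem e a b hgen hw hh
      exact ⟨n₀, fun _ => hn⟩
  have h2 : ∀ h : Aˣ, ∃ C n₀ : ℕ, h ∈ autGroup (k := k) w → ∀ n, n₀ ≤ n → Even n →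
      ∏ i ∈ Finset.range n, tw^[i] θ = 1 →
      (∀ z : k, z ^ Fintype.card F ^ n = z) → ∀ s : Finset F[X],
      (∀ P ∈ s, P.Monic ∧ Irreducible P ∧ P.natDegree = n ∧ homEval a b P = h) →
      Nat.card (autGroup (k := k) w) * (n * s.card) ≤
        Fintype.card F ^ n + C * Fintype.card F ^ (n / 2) := fun h => by
    by_cases hh : h ∈ autGroup (k := k) w
    · obtain ⟨C, n₀, hn⟩ := card_le_of_mem e a b hκ hgen hev hw hh
      exact ⟨C, n₀, fun _ => hn⟩
    · exact ⟨0, 0, fun h' => absurd h' hh⟩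
  choose N₁ hN₁ using h1
  choose C N₂ hN₂ using h2
  refine ⟨autGroup (k := k) w, Finset.univ.sup C, Finset.univ.sup N₁ + Finset.univ.sup N₂ + 1,
    fun n hn heven hθ hk => ⟨fun h hh P hP hPi hPd hPh => ?_, fun h hh s hs => ?_⟩⟩
  · have := hN₁ h hh P hP hPi hPh (by rwa [hPd]) (by rwa [hPd])
    have : N₁ h ≤ Finset.univ.sup N₁ := Finset.le_sup (Finset.mem_univ h)
    omega
  · have h3 : N₂ h ≤ Finset.univ.sup N₂ := Finset.le_sup (Finset.mem_univ h)
    refine (hN₂ h hh n (by omega) heven hθ hk s hs).trans ?_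
    gcongr
    exact Finset.le_sup (Finset.mem_univ h)

end FrobTwist

namespace FrobTwist

open TensorProduct HomEval

variable {F A : Type} [Field F] [Fintype F] [CommRing A] [Algebra F A]

section Model

variable {k ι : Type} [Field k] [Algebra F k] [Fintype ι] (e : Module.Basis ι F A) (a b : A)

instance : Module.IsTorsionFree k[X] (PowerSeries k) :=
  Module.IsTorsionFree.of_smul_eq_zero fun p f h => by
    rw [Algebra.smul_def, mul_eq_zero] at h
    refine h.imp_left fun h => Polynomial.coe_injective k ?_
    simpa [PowerSeries.algebraMap_apply'] using h

lemma tw_sol_eq_linForm {c : k} {θ : k ⊗[F] A} (hθ : θ * linForm a b c = 1) :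
    tw (sol e (θ * (1 ⊗ₜ b))) = baseMap A (constHom F k (PowerSeries k)) θ *
      linForm a b (algebraMap k[X] (PowerSeries k) (X + C c)) * sol e (θ * (1 ⊗ₜ b)) := by
  have h1 : linForm a b (algebraMap k[X] (PowerSeries k) (X + C c)) =
      baseMap A (constHom F k (PowerSeries k)) (linForm (F := F) a b c) -
        (PowerSeries.X : PowerSeries k) • (1 ⊗ₜ[F] b) := by
    rw [baseMap_linForm, linForm, linForm, sub_sub, TensorProduct.smul_tmul', smul_eq_mul, mul_one,
      ← add_tmul]
    congr 2
    rw [map_add, add_comm]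
    congr 1
    simp [PowerSeries.algebraMap_apply']
  rw [tw_sol, h1, mul_sub, ← map_mul, hθ, map_one, sub_mul, one_mul, map_mul, baseMap_tmul, map_one,
    mul_smul_comm, smul_mul_assoc]

lemma finite_adjoin_coord_sol (τ : k ⊗[F] A) :
    Module.Finite k[X] (Algebra.adjoin k[X] (Set.range (coord e (sol e τ)))) := by
  refine finite_adjoin_of_pow_mem_span (q := Fintype.card F) (fun x y => ?_)
    Fintype.one_lt_card fun j => ?_
  · simpa using map_add (FiniteField.frobeniusAlgHom F (PowerSeries k)) x y
  · have hc : ∀ z : PowerSeries k, ∀ f : k[X], ∀ i,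
        z = algebraMap k[X] (PowerSeries k) f → coord e (sol e τ) i * z ∈
          Submodule.span k[X] (Set.range (coord e (sol e τ))) := fun z f i hz => by
      rw [hz, mul_comm, ← Algebra.smul_def]
      exact Submodule.smul_mem _ _ (Submodule.subset_span ⟨i, rfl⟩)
    rw [← coord_tw, tw_sol, coord_sub, coord_smul, coord_mul, Finset.mul_sum]
    refine Submodule.sub_mem _ (Submodule.subset_span ⟨j, rfl⟩) (Submodule.sum_mem _ fun i _ => ?_)
    rw [mul_left_comm]
    refine hc _ (X * C (coord e (τ * 1 ⊗ₜ[F] e i) j)) i ?_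
    rw [← map_one (constHom F k (PowerSeries k)), ← baseMap_tmul, ← map_mul, coord_baseMap]
    simp [constHom, PowerSeries.algebraMap_apply', mul_comm (PowerSeries.X)]

theorem upperDistribution_of_mul_linForm_eq_one [Finite A] [Finite k] {κ : Type} [Fintype κ]
    (e : Module.Basis κ F A) {c : k} {θ : k ⊗[F] A}
    (hθ : θ * linForm a b c = 1) :
    ∃ (H : Subgroup Aˣ) (C n₀ : ℕ), ∀ n, n₀ ≤ n → Even n → ∏ i ∈ Finset.range n, tw^[i] θ = 1 →
      (∀ z : k, z ^ Fintype.card F ^ n = z) → UpperDistribution (F := F) a b H C n := by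
  set w₀ := sol e (θ * (1 ⊗ₜ b)) with hw₀
  let R := Algebra.adjoin k[X] (Set.range (coord e w₀))
  have hfin : Module.Finite k[X] R := finite_adjoin_coord_sol e _
  have : Module.Free k[X] R := inferInstance
  let W : κ → R := fun j => ⟨coord e w₀ j, Algebra.subset_adjoin ⟨j, rfl⟩⟩
  let w : R ⊗[F] A := ∑ j, W j ⊗ₜ e j
  have hcoord : coord e w = W := funext fun j => coord_sum e W j
  let v : R →ₐ[F] PowerSeries k := R.val.restrictScalars F
  have hv : Function.Injective v := Subtype.val_injective
  have hvw : baseMap A v w = w₀ := by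
    refine coord_injective e (funext fun j => ?_)
    rw [coord_baseMap, hcoord]
    rfl
  have hgen : Algebra.adjoin k[X] (Set.range (coord e w)) = ⊤ := by
    rw [hcoord]
    have := Algebra.adjoin_adjoin_coe_preimage (R := k[X]) (s := Set.range (coord e w₀))
    rw [← this]
    congr 1
    ext ⟨x, hx⟩
    simp [W]
  refine upperDistribution_of_model e a b (R := R) (κ := R.val) Subtype.val_injective hgen
    (ev := (constCoeff F k).comp v) ?_ (c := c) (θ := θ) ?_
  · rw [← baseMap_comp, hvw, hw₀, baseMap_sol]
  · refine baseMap_injective e hv ?_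
    rw [← tw_baseMap, hvw, hw₀, tw_sol_eq_linForm e a b hθ, map_mul, map_mul, ← hw₀, hvw,
      baseMap_comp, baseMap_linForm]
    rfl

end Model

lemma prod_range_mul_eq_pow {M : Type*} [CommMonoid M] {f : ℕ → M} {m : ℕ}
    (hf : ∀ i, f (i + m) = f i) (j : ℕ) :
    ∏ i ∈ Finset.range (m * j), f i = (∏ i ∈ Finset.range m, f i) ^ j := by
  induction j with
  | zero => simp
  | succ j ih =>
    rw [Nat.mul_succ, Finset.prod_range_add, ih, pow_succ]
    congr 1
    refine Finset.prod_congr rfl fun i _ => ?_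
    clear ih
    induction j with
    | zero => simp
    | succ j ih => rw [← ih, Nat.mul_succ, add_right_comm, hf]

theorem exists_upperDistribution [Finite A] (a b : A) {P : F[X]} (hP : P.Monic)
    (hPi : Irreducible P) (hu : IsUnit (homEval a b P)) :
    ∃ (H : Subgroup Aˣ) (C n₀ m : ℕ), 0 < m ∧ ∀ n, n₀ ≤ n → m ∣ n →
      UpperDistribution (F := F) a b H C n := by
  have : Fact (Irreducible P) := ⟨hPi⟩
  have hfin : Module.Finite F (AdjoinRoot P) := hP.finite_adjoinRoot
  have : Finite (AdjoinRoot P) := Module.finite_of_finite F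
  have : Module.Finite F A := Module.Finite.of_finite
  let e := Module.Free.chooseBasis F A
  have : Finite (AdjoinRoot P ⊗[F] A) := Module.finite_of_finite F
  set c := AdjoinRoot.root P
  have hdvd : (X - C c) ∣ P.map (algebraMap F (AdjoinRoot P)) := by
    rw [dvd_iff_isRoot, IsRoot, eval_map_algebraMap, AdjoinRoot.aeval_eq, AdjoinRoot.mk_self]
  obtain ⟨g, hg⟩ := hdvd
  have hgm : g.Monic := (monic_X_sub_C c).of_mul_monic_left (hg ▸ hP.map _)
  have hlu : IsUnit (linForm (F := F) a b c) := by
    have h1 := homEval_includeRight (S := AdjoinRoot P) a b hP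
    rw [hg, homEval_mul _ _ (monic_X_sub_C c) hgm, homEval_X_sub_C] at h1
    have h2 : IsUnit ((1 : AdjoinRoot P) ⊗ₜ[F] homEval a b P) :=
      hu.map (Algebra.TensorProduct.includeRight : A →ₐ[F] AdjoinRoot P ⊗[F] A)
    rw [← h1] at h2
    have h3 := isUnit_of_mul_isUnit_left h2
    convert h3 using 1
    rw [linForm, Algebra.TensorProduct.algebraMap_apply, Algebra.TensorProduct.tmul_mul_tmul]
    simp
  obtain ⟨u, huc⟩ := hlu
  have hθ : ((u⁻¹ : _ˣ) : AdjoinRoot P ⊗[F] A) * linForm a b c = 1 := by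
    rw [← huc, Units.inv_mul]
  obtain ⟨H, C₀, n₀, h⟩ := upperDistribution_of_mul_linForm_eq_one a b e hθ
  have hper : ∀ x : AdjoinRoot P ⊗[F] A, tw^[P.natDegree] x = x := fun x => by
    refine coord_injective e (funext fun j => ?_)
    rw [coord_tw_iterate, adjoinRoot_pow_card hP hPi]
  refine ⟨H, C₀, n₀, 2 * (P.natDegree * Nat.card (AdjoinRoot P ⊗[F] A)ˣ),
    mul_pos two_pos (mul_pos hPi.natDegree_pos Nat.card_pos), fun n hn hm => ?_⟩
  obtain ⟨j, rfl⟩ := hm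
  refine h _ hn ((even_two_mul _).mul_right j) ?_ fun z => ?_
  · have hun : IsUnit (∏ i ∈ Finset.range P.natDegree, tw^[i]
        ((u⁻¹ : _ˣ) : AdjoinRoot P ⊗[F] A)) := by
      refine IsUnit.prod_iff.mpr fun i hi => ?_
      clear hi
      induction i with
      | zero => exact (u⁻¹).isUnit
      | succ i ih => rw [Function.iterate_succ_apply']; exact ih.map tw
    obtain ⟨y, hy⟩ := hun
    rw [show 2 * (P.natDegree * Nat.card (AdjoinRoot P ⊗[F] A)ˣ) * j =
        P.natDegree * (Nat.card (AdjoinRoot P ⊗[F] A)ˣ * (2 * j)) by ring,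
      prod_range_mul_eq_pow (fun i => by rw [Function.iterate_add_apply, hper]), ← hy,
      pow_mul, ← Units.val_pow_eq_pow_val, pow_card_eq_one', Units.val_one, one_pow]
  · rw [show 2 * (P.natDegree * Nat.card (AdjoinRoot P ⊗[F] A)ˣ) * j =
        P.natDegree * (Nat.card (AdjoinRoot P ⊗[F] A)ˣ * (2 * j)) by ring, pow_mul]
    generalize Nat.card (AdjoinRoot P ⊗[F] A)ˣ * (2 * j) = i
    induction i with
    | zero => simp
    | succ i ih => rw [pow_succ, pow_mul, ih, adjoinRoot_pow_card hP hPi]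

end FrobTwist

namespace MonicPoly

variable (F : Type) [Field F] [Fintype F]

/-- The monic polynomials of degree `n`. -/
def monics (n : ℕ) : Finset F[X] :=
  Finset.univ.image fun c : Fin n → F => X ^ n + ((degreeLTEquiv F n).symm c : F[X])

variable {F}

lemma mem_monics {n : ℕ} {f : F[X]} : f ∈ monics F n ↔ f.Monic ∧ f.natDegree = n := by
  simp only [monics, Finset.mem_image, Finset.mem_univ, true_and]
  constructor
  · rintro ⟨c, rfl⟩
    have h := mem_degreeLT.mp ((degreeLTEquiv F n).symm c).2
    exact ⟨monic_X_pow_add h, natDegree_eq_of_degree_eq_some (by rw [degree_add_eq_left_of_degree_lt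
      (by rwa [degree_X_pow]), degree_X_pow])⟩
  · rintro ⟨hf, rfl⟩
    have h : f - X ^ f.natDegree ∈ degreeLT F f.natDegree := by
      rw [mem_degreeLT, ← degree_eq_natDegree hf.ne_zero]
      refine degree_sub_lt_left ?_ hf.ne_zero ?_
      · rw [degree_X_pow, degree_eq_natDegree hf.ne_zero]
      · rw [hf.leadingCoeff, leadingCoeff_X_pow]
    exact ⟨degreeLTEquiv F _ ⟨_, h⟩, by simp⟩

lemma card_monics (n : ℕ) : (monics F n).card = Fintype.card F ^ n := by
  rw [monics, Finset.card_image_of_injective, Finset.card_univ, Fintype.card_fun, Fintype.card_fin]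
  intro c d h
  exact (degreeLTEquiv F n).symm.injective (Subtype.ext (add_left_cancel h))

variable (F) in
/-- The monic irreducible polynomials of degree `n`. -/
def irreds (n : ℕ) : Finset F[X] := (monics F n).filter Irreducible

lemma mem_irreds {n : ℕ} {f : F[X]} :
    f ∈ irreds F n ↔ f.Monic ∧ f.natDegree = n ∧ Irreducible f := by
  rw [irreds, Finset.mem_filter, mem_monics, and_assoc]

section Sums

variable (χ : F[X] → ℂ)

/-- The sum of `χ` over the monic polynomials of degree `n`. -/
def monicSum (n : ℕ) : ℂ := ∑ f ∈ monics F n, χ f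

/-- The sum of `deg P * χ P` over the monic irreducible polynomials of degree `n`. -/
def primeSum (n : ℕ) : ℂ := n * ∑ P ∈ irreds F n, χ P

/-- The sum of `deg P * χ (P ^ k)` over the powers of degree `n` of monic irreducible
polynomials. -/
def primePowSum (n : ℕ) : ℂ :=
  ∑ d ∈ Finset.Icc 1 n, ∑ k ∈ Finset.Icc 1 n, if k * d = n then d * ∑ P ∈ irreds F d, χ P ^ k else 0

lemma primePowSum_eq {n N : ℕ} (hn : n ≤ N) (h0 : n ≠ 0) : primePowSum χ n =
    ∑ d ∈ Finset.Icc 1 N, ∑ k ∈ Finset.Icc 1 N,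
      if k * d = n then d * ∑ P ∈ irreds F d, χ P ^ k else 0 := by
  rw [primePowSum]
  have hsub := Finset.Icc_subset_Icc_right (a := 1) hn
  have hout : ∀ d ∈ Finset.Icc 1 N, ∀ k ∈ Finset.Icc 1 N, k * d = n → d ≤ n ∧ k ≤ n := by
    intro d hd k hk h
    rw [Finset.mem_Icc] at hd hk
    exact ⟨Nat.le_of_dvd (Nat.pos_of_ne_zero h0) ⟨k, by rw [← h, mul_comm]⟩,
      Nat.le_of_dvd (Nat.pos_of_ne_zero h0) ⟨d, h.symm⟩⟩
  rw [← Finset.sum_subset hsub fun d hd hd' => Finset.sum_eq_zero fun k hk => if_neg fun h =>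
    hd' (Finset.mem_Icc.mpr ⟨(Finset.mem_Icc.mp hd).1, (hout d hd k hk h).1⟩)]
  refine Finset.sum_congr rfl fun d hd => Finset.sum_subset hsub fun k hk hk' => if_neg fun h =>
    hk' (Finset.mem_Icc.mpr ⟨(Finset.mem_Icc.mp hk).1, (hout d (hsub hd) k hk h).2⟩)

variable {χ}

lemma monicSum_zero (h1 : χ 1 = 1) : monicSum χ 0 = 1 := by
  have : monics F 0 = {1} := by
    ext f
    rw [mem_monics, Finset.mem_singleton]
    exact ⟨fun h => h.1.natDegree_eq_zero.mp h.2, fun h => h ▸ ⟨monic_one, natDegree_one⟩⟩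
  rw [monicSum, this, Finset.sum_singleton, h1]

lemma natDegree_eq_sum {f : F[X]} (hf : f.Monic) {N : ℕ} (hN : f.natDegree ≤ N) : f.natDegree =
    ∑ d ∈ Finset.Icc 1 N, ∑ k ∈ Finset.Icc 1 N, ∑ P ∈ irreds F d, if P ^ k ∣ f then d else 0 := by
  have hcount : ∀ d, ∀ P ∈ irreds F d, ∑ k ∈ Finset.Icc 1 N, (if P ^ k ∣ f then d else 0) =
      (UniqueFactorizationMonoid.normalizedFactors f).count P * d := by
    intro d P hP
    rw [mem_irreds] at hP
    have hdvd : ∀ k, P ^ k ∣ f ↔ k ≤ (UniqueFactorizationMonoid.normalizedFactors f).count P :=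
      fun k => by
        rw [Multiset.le_count_iff_replicate_le]
        rw [UniqueFactorizationMonoid.dvd_iff_normalizedFactors_le_normalizedFactors
          (pow_ne_zero _ hP.1.ne_zero) hf.ne_zero,
          UniqueFactorizationMonoid.normalizedFactors_pow,
          UniqueFactorizationMonoid.normalizedFactors_irreducible hP.2.2,
          hP.1.normalize_eq_self, Multiset.nsmul_singleton]
    have hle : (UniqueFactorizationMonoid.normalizedFactors f).count P ≤ N := by
      have h2 := natDegree_le_of_dvd ((hdvd _).mpr le_rfl) hf.ne_zero
      rw [hP.1.natDegree_pow] at h2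
      exact (Nat.le_mul_of_pos_right _ hP.2.2.natDegree_pos).trans (h2.trans hN)
    simp only [hdvd]
    rw [← Finset.sum_filter, Finset.sum_const, smul_eq_mul]
    congr 1
    have : (Finset.Icc 1 N).filter
        (· ≤ (UniqueFactorizationMonoid.normalizedFactors f).count P) =
        Finset.Icc 1 ((UniqueFactorizationMonoid.normalizedFactors f).count P) := by
      ext k
      simp only [Finset.mem_filter, Finset.mem_Icc]
      omega
    rw [this, Nat.card_Icc, Nat.add_sub_cancel]
  have hstep : ∀ d ∈ Finset.Icc 1 N,
      ∑ k ∈ Finset.Icc 1 N, ∑ P ∈ irreds F d, (if P ^ k ∣ f then d else 0) =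
      ∑ P ∈ irreds F d, (UniqueFactorizationMonoid.normalizedFactors f).count P * P.natDegree :=
    fun d _ => by
      rw [Finset.sum_comm]
      exact Finset.sum_congr rfl fun P hP => by rw [hcount d P hP, (mem_irreds.mp hP).2.1]
  rw [Finset.sum_congr rfl hstep, ← Finset.sum_biUnion]
  · have hprod : (UniqueFactorizationMonoid.normalizedFactors f).prod = f := by
      rw [UniqueFactorizationMonoid.prod_normalizedFactors_eq hf.ne_zero, hf.normalize_eq_self]
    have hne : (0 : F[X]) ∉ UniqueFactorizationMonoid.normalizedFactors f :=
      UniqueFactorizationMonoid.zero_notMem_normalizedFactors f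
    conv_lhs => rw [← hprod, natDegree_multiset_prod _ hne]
    rw [Finset.sum_multiset_map_count]
    simp only [smul_eq_mul]
    refine Finset.sum_subset (fun P hP => ?_) fun P _ hP => ?_
    · rw [Multiset.mem_toFinset] at hP
      have hPi := UniqueFactorizationMonoid.irreducible_of_normalized_factor P hP
      have hPd := UniqueFactorizationMonoid.dvd_of_mem_normalizedFactors hP
      have hPm : P.Monic := by
        rw [← UniqueFactorizationMonoid.normalize_normalized_factor P hP]
        exact monic_normalize hPi.ne_zero
      exact Finset.mem_biUnion.mpr ⟨P.natDegree, Finset.mem_Icc.mpr ⟨hPi.natDegree_pos,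
        (natDegree_le_of_dvd hPd hf.ne_zero).trans hN⟩, mem_irreds.mpr ⟨hPm, rfl, hPi⟩⟩
    · rw [Multiset.mem_toFinset] at hP
      rw [Multiset.count_eq_zero_of_notMem hP, zero_mul]
  · intro d _ d' _ hdd
    rw [Function.onFun, Finset.disjoint_left]
    exact fun P hP hP' => hdd ((mem_irreds.mp hP).2.1.symm.trans (mem_irreds.mp hP').2.1)

lemma sum_filter_dvd (hmul : ∀ f g : F[X], f.Monic → g.Monic → χ (f * g) = χ f * χ g)
    {P : F[X]} (hP : P.Monic) (n : ℕ) :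
    (∑ f ∈ (monics F n).filter (P ∣ ·), χ f) =
      if P.natDegree ≤ n then χ P * monicSum χ (n - P.natDegree) else 0 := by
  split_ifs with h
  · rw [monicSum, Finset.mul_sum]
    symm
    refine Finset.sum_bij (fun g _ => P * g) (fun g hg => ?_) (fun g _ g' _ hgg => ?_)
      (fun f hf => ?_) (fun g hg => ?_)
    · rw [mem_monics] at hg
      rw [Finset.mem_filter, mem_monics, hP.natDegree_mul hg.1]
      exact ⟨⟨hP.mul hg.1, by omega⟩, dvd_mul_right _ _⟩
    · exact mul_left_cancel₀ hP.ne_zero hgg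
    · rw [Finset.mem_filter, mem_monics] at hf
      obtain ⟨⟨hm, hn⟩, g, rfl⟩ := hf
      have hg := hP.of_mul_monic_left hm
      rw [hP.natDegree_mul hg] at hn
      exact ⟨g, mem_monics.mpr ⟨hg, by omega⟩, rfl⟩
    · rw [hmul _ _ hP (mem_monics.mp hg).1]
  · refine Finset.sum_eq_zero fun f hf => ?_
    rw [Finset.mem_filter, mem_monics] at hf
    have := natDegree_le_of_dvd hf.2 hf.1.1.ne_zero
    omega

lemma map_pow_of_monic (h1 : χ 1 = 1)
    (hmul : ∀ f g : F[X], f.Monic → g.Monic → χ (f * g) = χ f * χ g)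
    {P : F[X]} (hP : P.Monic) (k : ℕ) : χ (P ^ k) = χ P ^ k := by
  induction k with
  | zero => simp [h1]
  | succ k ih => rw [pow_succ, hmul _ _ (hP.pow k) hP, ih, pow_succ]

/-- The coefficient form of `T L'(T) = L(T) ∑ S_j T^j`. -/
theorem mul_monicSum (h1 : χ 1 = 1)
    (hmul : ∀ f g : F[X], f.Monic → g.Monic → χ (f * g) = χ f * χ g) (n : ℕ) :
    n * monicSum χ n = ∑ j ∈ Finset.Icc 1 n, primePowSum χ j * monicSum χ (n - j) := by
  have hR : ∑ j ∈ Finset.Icc 1 n, primePowSum χ j * monicSum χ (n - j) =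
      ∑ d ∈ Finset.Icc 1 n, ∑ k ∈ Finset.Icc 1 n, ∑ P ∈ irreds F d,
        if k * d ≤ n then d * (χ P ^ k * monicSum χ (n - k * d)) else 0 := by
    have hj : ∀ j ∈ Finset.Icc 1 n, primePowSum χ j * monicSum χ (n - j) =
        ∑ d ∈ Finset.Icc 1 n, ∑ k ∈ Finset.Icc 1 n, ∑ P ∈ irreds F d,
          if k * d = j then d * (χ P ^ k * monicSum χ (n - k * d)) else 0 := fun j hj => by
      rw [Finset.mem_Icc] at hj
      rw [primePowSum_eq χ hj.2 (by omega), Finset.sum_mul]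
      refine Finset.sum_congr rfl fun d _ => ?_
      rw [Finset.sum_mul]
      refine Finset.sum_congr rfl fun k _ => ?_
      split_ifs with h
      · rw [← h, mul_assoc, Finset.sum_mul, Finset.mul_sum]
      · simp
    rw [Finset.sum_congr rfl hj, Finset.sum_comm]
    refine Finset.sum_congr rfl fun d hd => ?_
    rw [Finset.sum_comm]
    refine Finset.sum_congr rfl fun k hk => ?_
    rw [Finset.sum_comm]
    refine Finset.sum_congr rfl fun P _ => ?_
    rw [Finset.sum_ite_eq]
    congr 1
    rw [Finset.mem_Icc] at *
    simp only [eq_iff_iff, and_iff_right_iff_imp]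
    intro _
    exact Nat.mul_pos hk.1 hd.1
  rw [hR, monicSum, Finset.mul_sum]
  have hf : ∀ f ∈ monics F n, (n : ℂ) * χ f = ∑ d ∈ Finset.Icc 1 n, ∑ k ∈ Finset.Icc 1 n,
      ∑ P ∈ irreds F d, if P ^ k ∣ f then d * χ f else 0 := fun f hf => by
    rw [mem_monics] at hf
    conv_lhs => rw [← hf.2, natDegree_eq_sum hf.1 hf.2.le]
    push_cast
    simp only [Finset.sum_mul, ite_mul, zero_mul]
  rw [Finset.sum_congr rfl hf, Finset.sum_comm]
  refine Finset.sum_congr rfl fun d hd => ?_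
  rw [Finset.sum_comm]
  refine Finset.sum_congr rfl fun k hk => ?_
  rw [Finset.sum_comm]
  refine Finset.sum_congr rfl fun P hP => ?_
  rw [mem_irreds] at hP
  rw [← Finset.sum_filter, ← Finset.mul_sum, sum_filter_dvd hmul (hP.1.pow k),
    hP.1.natDegree_pow, hP.2.1, map_pow_of_monic h1 hmul hP.1, mul_ite, mul_zero]

end Sums

end MonicPoly

namespace MonicPoly

variable {F : Type} [Field F] [Fintype F]

lemma primePowSum_eq_sum_dvd (χ : F[X] → ℂ) {n : ℕ} (hn : n ≠ 0) : primePowSum χ n =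
    ∑ d ∈ Finset.Icc 1 n, if d ∣ n then d * ∑ P ∈ irreds F d, χ P ^ (n / d) else 0 := by
  refine Finset.sum_congr rfl fun d hd => ?_
  rw [Finset.mem_Icc] at hd
  split_ifs with h
  · obtain ⟨k, rfl⟩ := h
    have hk : 0 < k := Nat.pos_of_ne_zero (by rintro rfl; simp at hn)
    rw [Finset.sum_eq_single k, if_pos (mul_comm _ _), Nat.mul_div_cancel_left _ hd.1]
    · intro k' _ hk'
      refine if_neg fun h => hk' ?_
      rw [mul_comm] at h
      exact Nat.eq_of_mul_eq_mul_left hd.1 h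
    · intro hk'
      exact absurd (Finset.mem_Icc.mpr ⟨hk, Nat.le_mul_of_pos_left _ hd.1⟩) hk'
  · exact Finset.sum_eq_zero fun k _ => if_neg fun hk => h ⟨k, by rw [← hk, mul_comm]⟩

lemma primePowSum_one {n : ℕ} (hn : n ≠ 0) :
    primePowSum (fun _ : F[X] => 1) n = (Fintype.card F : ℂ) ^ n := by
  induction n using Nat.strong_induction_on with
  | _ n ih =>
    have h := mul_monicSum (χ := fun _ : F[X] => (1 : ℂ)) rfl (fun _ _ _ _ => (mul_one _).symm) n
    have hm : ∀ j, monicSum (fun _ : F[X] => (1 : ℂ)) j = (Fintype.card F : ℂ) ^ j := fun j => by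
      simp [monicSum, card_monics]
    obtain ⟨m, rfl⟩ : ∃ m, n = m + 1 := Nat.exists_eq_add_one_of_ne_zero hn
    have hs : ∀ j ∈ Finset.Icc 1 m, primePowSum (fun _ : F[X] => (1 : ℂ)) j *
        monicSum (fun _ : F[X] => (1 : ℂ)) (m + 1 - j) = (Fintype.card F : ℂ) ^ (m + 1) :=
      fun j hj => by
        rw [Finset.mem_Icc] at hj
        rw [ih j (by omega) (by omega), hm, ← pow_add, Nat.add_sub_cancel' (by omega)]
    rw [Finset.sum_Icc_succ_top (by omega), Finset.sum_congr rfl hs,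
      Nat.sub_self, hm, hm, Finset.sum_const, Nat.card_Icc] at h
    simp only [Nat.add_sub_cancel, nsmul_eq_mul, pow_zero, mul_one] at h
    push_cast at h
    linear_combination -h

lemma primePowSum_one_eq_cast {n : ℕ} (hn : n ≠ 0) : primePowSum (fun _ : F[X] => 1) n =
    ((∑ d ∈ Finset.Icc 1 n, if d ∣ n then d * (irreds F d).card else 0 : ℕ) : ℂ) := by
  rw [primePowSum_eq_sum_dvd _ hn]
  push_cast
  simp

lemma sum_card_irreds {n : ℕ} (hn : n ≠ 0) :
    (∑ d ∈ Finset.Icc 1 n, if d ∣ n then d * (irreds F d).card else 0) = Fintype.card F ^ n := by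
  have := (primePowSum_one_eq_cast (F := F) hn).symm.trans (primePowSum_one hn)
  exact_mod_cast this

lemma mul_card_irreds_le (n : ℕ) : n * (irreds F n).card ≤ Fintype.card F ^ n := by
  rcases eq_or_ne n 0 with rfl | hn
  · simp
  rw [← sum_card_irreds hn]
  have := Finset.single_le_sum (f := fun d => if d ∣ n then d * (irreds F d).card else 0)
    (s := Finset.Icc 1 n) (fun _ _ => Nat.zero_le _)
    (Finset.mem_Icc.mpr ⟨Nat.pos_of_ne_zero hn, le_rfl⟩)
  simpa using this

lemma sum_pow_le (q : ℕ) (hq : 2 ≤ q) (m : ℕ) : ∑ d ∈ Finset.Icc 1 m, q ^ d ≤ 2 * q ^ m := by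
  induction m with
  | zero => simp
  | succ m ih =>
    rw [Finset.sum_Icc_succ_top (by omega), pow_succ]
    nlinarith [Nat.mul_le_mul_left (q ^ m) hq]

lemma pow_half_le_sqrt_pow (n : ℕ) :
    (Fintype.card F : ℝ) ^ (n / 2) ≤ √(Fintype.card F) ^ n := by
  have h0 : (0 : ℝ) ≤ Fintype.card F := Nat.cast_nonneg _
  have h1 : 1 ≤ √(Fintype.card F : ℝ) :=
    Real.one_le_sqrt.mpr (by exact_mod_cast Fintype.card_pos (α := F))
  conv_lhs => rw [← Real.sq_sqrt h0, ← pow_mul]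
  exact pow_le_pow_right₀ h1 (Nat.mul_div_le n 2)

/-- Proper prime powers contribute little. -/
lemma norm_primePowSum_sub_primeSum_le {χ : F[X] → ℂ} (hχ : ∀ f, ‖χ f‖ ≤ 1) {n : ℕ} (hn : n ≠ 0) :
    ‖primePowSum χ n - primeSum χ n‖ ≤ 2 * √(Fintype.card F) ^ n := by
  have hmem : n ∈ Finset.Icc 1 n := Finset.mem_Icc.mpr ⟨Nat.pos_of_ne_zero hn, le_rfl⟩
  rw [primePowSum_eq_sum_dvd _ hn, ← Finset.add_sum_erase _ _ hmem, if_pos dvd_rfl,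
    Nat.div_self (Nat.pos_of_ne_zero hn)]
  simp only [pow_one]
  rw [primeSum, add_sub_cancel_left]
  have hb : ∀ d k : ℕ, ‖(d : ℂ) * ∑ P ∈ irreds F d, χ P ^ k‖ ≤ ((Fintype.card F ^ d : ℕ) : ℝ) := by
    intro d k
    calc ‖(d : ℂ) * ∑ P ∈ irreds F d, χ P ^ k‖ ≤ d * ∑ P ∈ irreds F d, (1 : ℝ) := by
          rw [norm_mul, Complex.norm_natCast]
          gcongr
          refine norm_sum_le_of_le _ fun P _ => ?_
          rw [norm_pow]
          exact pow_le_one₀ (norm_nonneg _) (hχ P)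
      _ ≤ _ := by
          rw [Finset.sum_const, nsmul_eq_mul, mul_one]
          exact_mod_cast mul_card_irreds_le d
  calc ‖∑ d ∈ (Finset.Icc 1 n).erase n,
        if d ∣ n then (d : ℂ) * ∑ P ∈ irreds F d, χ P ^ (n / d) else 0‖
      ≤ ∑ d ∈ (Finset.Icc 1 n).erase n,
          if d ∈ Finset.Icc 1 (n / 2) then ((Fintype.card F ^ d : ℕ) : ℝ) else 0 := by
        refine norm_sum_le_of_le _ fun d hd => ?_
        rw [Finset.mem_erase, Finset.mem_Icc] at hd
        by_cases h : d ∣ n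
        · rw [if_pos h, if_pos]
          · exact hb d _
          · obtain ⟨k, rfl⟩ := h
            have h2 : 2 ≤ k := by
              by_contra hk
              have : k = 0 ∨ k = 1 := by omega
              rcases this with rfl | rfl <;> simp at hd hn
            refine Finset.mem_Icc.mpr ⟨hd.2.1, ?_⟩
            rw [Nat.le_div_iff_mul_le two_pos]
            exact Nat.mul_le_mul_left _ h2
        · rw [if_neg h, norm_zero]
          split_ifs <;> positivity
    _ ≤ ∑ d ∈ Finset.Icc 1 (n / 2), ((Fintype.card F ^ d : ℕ) : ℝ) := by
        rw [← Finset.sum_filter]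
        refine Finset.sum_le_sum_of_subset_of_nonneg (fun d hd => (Finset.mem_filter.mp hd).2)
          fun _ _ _ => by positivity
    _ ≤ 2 * (Fintype.card F : ℝ) ^ (n / 2) := by
        exact_mod_cast sum_pow_le _ Fintype.one_lt_card _
    _ ≤ _ := by gcongr; exact pow_half_le_sqrt_pow n

lemma le_mul_card_irreds {n : ℕ} (hn : n ≠ 0) :
    (Fintype.card F : ℝ) ^ n - 2 * √(Fintype.card F) ^ n ≤ n * (irreds F n).card := by
  have h := norm_primePowSum_sub_primeSum_le (χ := fun _ : F[X] => 1) (by simp) hn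
  rw [primePowSum_one hn, primeSum] at h
  have h2 : (Fintype.card F : ℂ) ^ n - n * ∑ P ∈ irreds F n, (1 : ℂ) =
      (((Fintype.card F : ℝ) ^ n - n * (irreds F n).card : ℝ) : ℂ) := by
    push_cast
    simp
  rw [h2, Complex.norm_real] at h
  linarith [(abs_le.mp h).2]

end MonicPoly

namespace PowerSums

lemma exists_fin_map_eq {α : Type*} (s : Multiset α) {B : ℕ} (h : s.card = B) :
    ∃ v : Fin B → α, Finset.univ.val.map v = s := by
  subst h
  induction s using Quotient.inductionOn with
  | _ l =>
    refine ⟨fun i => l.get i, ?_⟩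
    change Multiset.map (fun i => l.get i) Finset.univ.val = (l : Multiset α)
    rw [Fin.univ_val_map, List.ofFn_get]

lemma exists_esymm {a : ℕ → ℂ} {B : ℕ} (h0 : a 0 = 1) (hB : ∀ n, B < n → a n = 0) :
    ∃ v : Fin B → ℂ, ∀ n, a n = (-1) ^ n * (Finset.univ.val.map v).esymm n := by
  set Q : ℂ[X] := ∑ i ∈ Finset.range (B + 1), C (a (B - i)) * X ^ i with hQ
  have hcoeff : ∀ i, i ≤ B → Q.coeff i = a (B - i) := fun i hi => by
    rw [hQ, finsetSum_coeff]
    simp only [coeff_C_mul, coeff_X_pow]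
    rw [Finset.sum_eq_single i (by intros; simp; omega) (by intro h; simp at h; omega)]
    simp
  have hdeg : Q.natDegree = B := by
    refine natDegree_eq_of_le_of_coeff_ne_zero ?_ (by rw [hcoeff _ le_rfl]; simp [h0])
    refine natDegree_sum_le_of_forall_le _ _ fun i hi => ?_
    exact (natDegree_C_mul_X_pow_le _ _).trans (by simp at hi; omega)
  have hlead : Q.leadingCoeff = 1 := by rw [leadingCoeff, hdeg, hcoeff _ le_rfl, Nat.sub_self, h0]
  have hroots : Q.roots.card = Q.natDegree := IsAlgClosed.card_roots_eq_natDegree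
  obtain ⟨v, hv⟩ := exists_fin_map_eq Q.roots (hroots.trans hdeg)
  refine ⟨v, fun n => ?_⟩
  rw [hv]
  rcases le_or_gt n B with hn | hn
  · have h := Polynomial.coeff_eq_esymm_roots_of_card hroots (k := B - n) (by omega)
    rw [hcoeff _ (by omega), hlead, hdeg, one_mul, Nat.sub_sub_self hn] at h
    exact h
  · rw [hB n hn, Multiset.esymm, Multiset.powersetCard_eq_empty]
    · simp
    · rw [hroots, hdeg]; exact hn

theorem exists_powerSum {a S : ℕ → ℂ} {B : ℕ} (h0 : a 0 = 1) (hB : ∀ n, B < n → a n = 0)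
    (hrec : ∀ n : ℕ, n * a n = ∑ j ∈ Finset.Icc 1 n, S j * a (n - j)) :
    ∃ v : Fin B → ℂ, ∀ n, n ≠ 0 → S n = -∑ i, v i ^ n := by
  obtain ⟨v, hv⟩ := exists_esymm h0 hB
  refine ⟨v, fun n => ?_⟩
  have hnewton : ∀ n : ℕ, n * a n = ∑ j ∈ Finset.Icc 1 n, (-∑ i, v i ^ j) * a (n - j) := by
    intro n
    have h := congrArg (MvPolynomial.aeval v) (MvPolynomial.mul_esymm_eq_sum (Fin B) ℂ n)
    simp only [map_mul, map_sum, map_natCast, map_pow, map_neg, map_one,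
      MvPolynomial.aeval_esymm_eq_multiset_esymm, MvPolynomial.psum, MvPolynomial.aeval_X] at h
    have h2 : (n : ℂ) * a n = (-1) ^ n * (n * (Finset.univ.val.map v).esymm n) := by
      rw [hv]; ring
    rw [h2, h, ← mul_assoc, ← pow_add, show n + (n + 1) = 2 * n + 1 by ring, pow_succ, pow_mul]
    simp only [even_two, Even.neg_pow, one_pow, mul_neg, mul_one, neg_mul, one_mul,
      Finset.sum_neg_distrib]
    congr 1
    rw [Finset.sum_filter, Finset.Nat.sum_antidiagonal_eq_sum_range_succ_mk]
    rw [Finset.sum_range_succ, if_neg (lt_irrefl _), add_zero, ← Finset.sum_range_reflect,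
      Finset.range_eq_Ico, Finset.sum_Ico_eq_sum_range,
      ← Finset.Ico_add_one_right_eq_Icc, Finset.sum_Ico_eq_sum_range, Nat.sub_zero,
      Nat.add_sub_cancel]
    refine Finset.sum_congr rfl fun j hj => ?_
    rw [Finset.mem_range] at hj
    rw [if_pos (by omega), hv, show n - 1 - (0 + j) = n - (1 + j) by omega,
      Nat.sub_sub_self (by omega)]
    ring
  induction n using Nat.strong_induction_on with
  | _ n ih =>
    intro hn
    have h := (hrec n).symm.trans (hnewton n)
    obtain ⟨m, rfl⟩ : ∃ m, n = m + 1 := Nat.exists_eq_add_one_of_ne_zero hn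
    rw [Finset.sum_Icc_succ_top (by omega), Finset.sum_Icc_succ_top (by omega),
      Finset.sum_congr rfl fun j hj => by
        rw [ih j (by rw [Finset.mem_Icc] at hj; omega) (by rw [Finset.mem_Icc] at hj; omega)],
      Nat.sub_self, h0, mul_one, mul_one] at h
    exact add_left_cancel h

/-- Simultaneously, infinitely many powers of finitely many complex numbers are close to the
positive real axis. -/
lemma exists_re_pow_ge {ι : Type*} [Finite ι] (v : ι → ℂ) (N : ℕ) :
    ∃ n, N ≤ n ∧ ∀ i, ‖v i‖ ^ n / 2 ≤ (v i ^ n).re := by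
  let u : ι → Circle := fun i => Circle.exp (v i).arg
  have hu : ∀ i, v i = ‖v i‖ * (u i : ℂ) := fun i => by
    rw [Circle.coe_exp, Complex.norm_mul_exp_arg_mul_I]
  have hcl := mapClusterPt_one_atTop_pow u
  have hopen : IsOpen {w : ι → Circle | ∀ i, (1 / 2 : ℝ) < (w i : ℂ).re} := by
    simp only [Set.ofPred_forall]
    exact isOpen_iInter_of_finite fun i => isOpen_lt continuous_const
      (Complex.continuous_re.comp (continuous_induced_dom.comp (continuous_apply i)))
  have hfreq := hcl.frequently (hopen.mem_nhds (by simp; norm_num))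
  obtain ⟨n, hn, h⟩ := (hfreq.and_eventually (Filter.eventually_ge_atTop N)).exists
  refine ⟨n, h, fun i => ?_⟩
  have h1 : (1 / 2 : ℝ) < ((u i : ℂ) ^ n).re := by simpa using hn i
  have h2 : (v i ^ n).re = ‖v i‖ ^ n * ((u i : ℂ) ^ n).re := by
    conv_lhs => rw [hu i]
    rw [mul_pow, ← Complex.ofReal_pow, Complex.re_ofReal_mul]
  rw [h2]
  have := pow_nonneg (norm_nonneg (v i)) n
  nlinarith

lemma le_of_forall_pow_le {x y C : ℝ} (hy : 0 < y)
    (h : ∀ N : ℕ, ∃ n, N ≤ n ∧ x ^ n ≤ C * y ^ n) : x ≤ y := by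
  by_contra! hxy
  have h1 : 1 < x / y := (one_lt_div hy).mpr hxy
  obtain ⟨N, hN⟩ := ((tendsto_pow_atTop_atTop_of_one_lt h1).eventually
    (Filter.eventually_gt_atTop C)).exists_forall_of_atTop
  obtain ⟨n, hn, hle⟩ := h N
  have h2 := hN n hn
  rw [div_pow, lt_div_iff₀ (pow_pos hy n)] at h2
  linarith

lemma norm_pow_le_of_re {ι : Type*} [Fintype ι] {v : ι → ℂ} {n : ℕ}
    (h : ∀ i, ‖v i‖ ^ n / 2 ≤ (v i ^ n).re) (i : ι) : ‖v i‖ ^ n / 2 ≤ (∑ i, v i ^ n).re := by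
  rw [Complex.re_sum]
  refine (h i).trans (Finset.single_le_sum (f := fun i => (v i ^ n).re) (fun j _ => ?_)
    (Finset.mem_univ i))
  exact (by positivity : (0 : ℝ) ≤ ‖v j‖ ^ n / 2).trans (h j)

/-- If `∑ v_i ^ n` is `O(s ^ n)` or `-s ^ (2 n) + O(s ^ n)` along the multiples of `m`, then
`|v_i| ≤ s` for all `i`. -/
theorem norm_le_of_powerSum {ι : Type*} [Fintype ι] {v : ι → ℂ} {s C : ℝ} (hs : 1 < s) {m n₀ : ℕ}
    (hm : 0 < m) {δ : ℝ} (hδ : 0 ≤ δ)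
    (h : ∀ n, n₀ ≤ n → m ∣ n → ‖∑ i, v i ^ n + ((δ * s ^ (2 * n) : ℝ) : ℂ)‖ ≤ C * s ^ n) (i : ι) :
    ‖v i‖ ≤ s := by
  have hsm : 0 < s ^ m := pow_pos (by linarith) m
  refine (pow_le_pow_iff_left₀ (norm_nonneg _) (by linarith) hm.ne').mp ?_
  refine le_of_forall_pow_le (C := 2 * C) hsm fun N => ?_
  obtain ⟨n, hn, hre⟩ := exists_re_pow_ge (fun i => v i ^ m) (N + n₀)
  refine ⟨n, by omega, ?_⟩
  have h1 := norm_pow_le_of_re hre i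
  have h2 := h (m * n) (by nlinarith) (dvd_mul_right _ _)
  have h3 := (Complex.re_le_norm _).trans h2
  rw [Complex.add_re, Complex.ofReal_re] at h3
  simp only [norm_pow, ← pow_mul] at h1 h3 ⊢
  have h4 : 0 ≤ δ * s ^ (2 * (m * n)) := mul_nonneg hδ (by positivity)
  linarith

end PowerSums

namespace MonicPoly

variable {F : Type} [Field F] [Fintype F] {G : Type} [CommGroup G] [Fintype G]

lemma norm_monoidHom_eq_one (χ : G →* ℂ) (g : G) : ‖χ g‖ = 1 :=
  Complex.norm_eq_one_of_pow_eq_one (n := Fintype.card G) (by rw [← _root_.map_pow, pow_card_eq_one, map_one])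
    Fintype.card_ne_zero

/-- The extension by zero of a character. -/
def ext (χ : G →* ℂ) : WithZero G →*₀ ℂ := WithZero.lift' χ

@[simp] lemma ext_coe (χ : G →* ℂ) (g : G) : ext χ g = χ g := WithZero.lift'_coe χ g

lemma norm_ext_le (χ : G →* ℂ) (x : WithZero G) : ‖ext χ x‖ ≤ 1 := by
  induction x using WithZero.recZeroCoe with
  | zero => simp
  | coe g => rw [ext_coe, norm_monoidHom_eq_one]

variable (γ : F[X] → WithZero G)

/-- The irreducible polynomials of degree `n` have classes in `H`, and none of the classes
contains much more than its share. -/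
def Distribution (H : Subgroup G) (C n : ℕ) : Prop :=
  (∀ P ∈ irreds F n, ∃ h : H, γ P = (h : G)) ∧
  ∀ h : H, Fintype.card H * (n * ((irreds F n).filter fun P => γ P = (h : G)).card) ≤
    Fintype.card F ^ n + C * Fintype.card F ^ (n / 2)

variable {γ}

lemma sqrt_card_pow_two_mul (n : ℕ) :
    √(Fintype.card F : ℝ) ^ (2 * n) = (Fintype.card F : ℝ) ^ n := by
  rw [pow_mul, Real.sq_sqrt (Nat.cast_nonneg _)]

theorem norm_primeSum_sub_le {H : Subgroup G} {C n : ℕ} (hn : n ≠ 0) (h : Distribution γ H C n)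
    (χ : G →* ℂ) :
    ‖primeSum (fun f => ext χ (γ f)) n -
      (((if χ.comp H.subtype = 1 then 1 else 0 : ℝ) * √(Fintype.card F) ^ (2 * n) : ℝ) : ℂ)‖ ≤
      (2 * C + 2) * √(Fintype.card F) ^ n := by
  set δ : ℝ := if χ.comp H.subtype = 1 then 1 else 0 with hδ
  set s := √(Fintype.card F : ℝ) with hs
  have hs0 : 0 ≤ s := Real.sqrt_nonneg _
  set ν : H → ℝ := fun h => n * ((irreds F n).filter fun P => γ P = (h : G)).card with hν
  set K : ℝ := (Fintype.card H : ℝ) with hK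
  have hK0 : 0 < K := Nat.cast_pos.mpr Fintype.card_pos
  set T : ℝ := (s ^ (2 * n) + C * s ^ n) / K with hT
  have hfib : ∀ f : H → F[X] → ℂ, ∑ P ∈ irreds F n, ∑ h : H, (if γ P = (h : G) then f h P else 0) =
      ∑ h : H, ∑ P ∈ (irreds F n).filter fun P => γ P = (h : G), f h P := fun f => by
    rw [Finset.sum_comm]
    exact Finset.sum_congr rfl fun h _ => (Finset.sum_filter _ _).symm
  have hsplit : ∀ ψ : G →* ℂ, primeSum (fun f => ext ψ (γ f)) n = ∑ h : H, (ν h : ℂ) * ψ h := by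
    intro ψ
    have h1 : ∀ P ∈ irreds F n, ext ψ (γ P) =
        ∑ h : H, (if γ P = (h : G) then ψ h else 0) := fun P hP => by
      obtain ⟨h0, h0'⟩ := h.1 P hP
      rw [h0', Finset.sum_eq_single h0]
      · simp
      · intro h1 _ h2
        exact if_neg fun h3 => h2 (Subtype.ext (WithZero.coe_injective h3).symm)
      · simp
    rw [primeSum, Finset.sum_congr rfl h1, hfib (fun h _ => ψ h), Finset.mul_sum]
    refine Finset.sum_congr rfl fun h _ => ?_
    rw [Finset.sum_const, nsmul_eq_mul, hν]
    push_cast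
    ring
  have htot : ∑ h : H, ν h = n * (irreds F n).card := by
    have h1 := hsplit 1
    have h2 : primeSum (fun f => ext (1 : G →* ℂ) (γ f)) n = n * (irreds F n).card := by
      rw [primeSum, Finset.sum_congr rfl (g := fun _ => 1) fun P hP => ?_]
      · simp
      · obtain ⟨h0, h0'⟩ := h.1 P hP
        simp [h0']
    rw [h2] at h1
    simp only [MonoidHom.one_apply, mul_one] at h1
    exact_mod_cast h1.symm
  have hle : ∀ h : H, ν h ≤ T := fun h' => by
    rw [hT, le_div_iff₀ hK0, mul_comm]
    have h1 : (Fintype.card H * (n * ((irreds F n).filter fun P => γ P = (h' : G)).card) : ℝ) ≤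
      (Fintype.card F : ℝ) ^ n + C * (Fintype.card F : ℝ) ^ (n / 2) := by exact_mod_cast h.2 h'
    refine h1.trans ?_
    rw [sqrt_card_pow_two_mul]
    gcongr
    exact pow_half_le_sqrt_pow n
  have hdef : ∑ h : H, (T - ν h) ≤ (C + 2) * s ^ n := by
    rw [Finset.sum_sub_distrib, htot, Finset.sum_const, Finset.card_univ, nsmul_eq_mul, hT,
      mul_div_cancel₀ _ hK0.ne']
    have := le_mul_card_irreds (F := F) hn
    rw [sqrt_card_pow_two_mul]
    linarith
  have hsum : ∑ h : H, χ h = (δ * K : ℝ) := by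
    have := sum_hom_units (χ.comp H.subtype)
    simp only [MonoidHom.comp_apply, Subgroup.subtype_apply] at this
    rw [this, hδ]
    split_ifs <;> simp [hK]
  have heq : primeSum (fun f => ext χ (γ f)) n - ((δ * s ^ (2 * n) : ℝ) : ℂ) =
      ((δ * (C * s ^ n) : ℝ) : ℂ) - ∑ h : H, ((T - ν h : ℝ) : ℂ) * χ h := by
    have h1 : ∑ h : H, ((T - ν h : ℝ) : ℂ) * χ h =
        T * ∑ h : H, χ h - ∑ h : H, (ν h : ℂ) * χ h := by
      rw [Finset.mul_sum, ← Finset.sum_sub_distrib]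
      exact Finset.sum_congr rfl fun h _ => by push_cast; ring
    rw [h1, hsplit, hsum]
    have h2 : (T : ℂ) * ((δ * K : ℝ) : ℂ) = ((δ * (s ^ (2 * n) + C * s ^ n) : ℝ) : ℂ) := by
      rw [← Complex.ofReal_mul, hT]
      congr 1
      field_simp
    rw [h2]
    push_cast
    ring
  rw [heq]
  refine (norm_sub_le _ _).trans ?_
  have h3 : ‖((δ * (C * s ^ n) : ℝ) : ℂ)‖ ≤ C * s ^ n := by
    rw [Complex.norm_real, Real.norm_eq_abs, abs_of_nonneg (by rw [hδ]; split_ifs <;> positivity)]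
    have : δ ≤ 1 := by rw [hδ]; split_ifs <;> norm_num
    exact mul_le_of_le_one_left (by positivity) this
  have h4 : ‖∑ h : H, ((T - ν h : ℝ) : ℂ) * χ h‖ ≤ (C + 2) * s ^ n := by
    refine (norm_sum_le_of_le _ fun h' _ => ?_).trans hdef
    rw [norm_mul, norm_monoidHom_eq_one, mul_one, Complex.norm_real, Real.norm_eq_abs,
      abs_of_nonneg (sub_nonneg.mpr (hle h'))]
  linarith

/-- The Riemann hypothesis for the `L`-function of `χ`, from the distribution of the classes of
irreducible polynomials in many degrees. -/
theorem norm_primeSum_le (h1 : γ 1 = 1)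
    (hmul : ∀ f g : F[X], f.Monic → g.Monic → γ (f * g) = γ f * γ g)
    {H : Subgroup G} {C n₀ m : ℕ} (hm : 0 < m) (hdist : ∀ n, n₀ ≤ n → m ∣ n → Distribution γ H C n)
    (χ : G →* ℂ) {B : ℕ} (hB : ∀ n, B < n → monicSum (fun f => ext χ (γ f)) n = 0)
    {n : ℕ} (hn : n ≠ 0) :
    ‖primeSum (fun f => ext χ (γ f)) n‖ ≤ (B + 2) * √(Fintype.card F) ^ n := by
  have hX1 : ext χ (γ 1) = 1 := by rw [h1, map_one]
  have hXmul : ∀ f g : F[X], f.Monic → g.Monic → ext χ (γ (f * g)) = ext χ (γ f) * ext χ (γ g) :=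
    fun f g hf hg => by rw [hmul f g hf hg, map_mul]
  have hXle : ∀ f, ‖ext χ (γ f)‖ ≤ 1 := fun f => norm_ext_le χ _
  obtain ⟨v, hv⟩ := PowerSums.exists_powerSum (a := monicSum fun f => ext χ (γ f))
    (S := primePowSum fun f => ext χ (γ f)) (monicSum_zero hX1) hB (mul_monicSum hX1 hXmul)
  have hs : 1 < √(Fintype.card F : ℝ) :=
    Real.lt_sqrt_of_sq_lt (by rw [one_pow]; exact_mod_cast Fintype.one_lt_card)
  have hroot := PowerSums.norm_le_of_powerSum (v := v) (C := 2 * C + 4) (n₀ := n₀ + 1)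
    (δ := if χ.comp H.subtype = 1 then 1 else 0) hs hm (by split_ifs <;> norm_num)
    fun n hn hmn => by
      have hn0 : n ≠ 0 := by omega
      have h2 := norm_primeSum_sub_le hn0 (hdist n (by omega) hmn) χ
      have h3 := norm_primePowSum_sub_primeSum_le hXle hn0
      rw [hv n hn0] at h3
      have h4 := norm_add_le (-∑ i, v i ^ n - primeSum (fun f => ext χ (γ f)) n)
        (primeSum (fun f => ext χ (γ f)) n - (((if χ.comp H.subtype = 1 then 1 else 0 : ℝ) *
          √(Fintype.card F) ^ (2 * n) : ℝ) : ℂ))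
      rw [sub_add_sub_cancel, ← norm_neg, neg_sub, sub_neg_eq_add, add_comm] at h4
      linarith
  have h3 := norm_primePowSum_sub_primeSum_le hXle hn
  rw [hv n hn] at h3
  have h4 : ‖-∑ i, v i ^ n‖ ≤ B * √(Fintype.card F : ℝ) ^ n := by
    rw [norm_neg]
    refine (norm_sum_le_of_le _ (f := fun i => v i ^ n)
      (n := fun _ => √(Fintype.card F : ℝ) ^ n) fun i _ => ?_).trans ?_
    · rw [norm_pow]
      exact pow_le_pow_left₀ (norm_nonneg _) (hroot i) n
    · simp
  have h5 := norm_sub_le (-∑ i, v i ^ n)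
    (-∑ i, v i ^ n - primeSum (fun f => ext χ (γ f)) n)
  rw [sub_sub_cancel] at h5
  linarith

end MonicPoly

namespace HomEval

variable {S : Type*} [CommRing S] {B : Type*} [CommRing B] [Algebra S B]

lemma homEval_apply_one (a : B) (f : S[X]) : homEval a 1 f = aeval a f := by
  rw [homEval, aeval_homogenize_of_eq_one le_rfl _ rfl]
  rfl

lemma homEval_one_apply (b : B) (f : S[X]) : homEval 1 b f = aeval b f.reverse := by
  rw [homEval, reverse]
  refine induction_with_natDegree_le
    (fun p => MvPolynomial.aeval ![1, b] (p.homogenize f.natDegree) =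
      aeval b (p.reflect f.natDegree)) f.natDegree (by simp) (fun m c _ hm => ?_)
    (fun p q _ _ hp hq => ?_) f le_rfl
  · rw [reflect_C_mul_X_pow, homogenize_C_mul, homogenize_X_pow hm, revAt_le hm]
    simp
  · rw [homogenize_add, reflect_add, map_add, map_add, hp, hq]

end HomEval

section UnitPart

variable {A K : Type} [CommRing A] [CommRing K] (ρ : A →+* K)

/-- The units of `A` that `ρ` maps to `1`. -/
def oneUnits : Subgroup Aˣ := (Units.map (ρ : A →* K)).ker

variable {ρ} in
lemma mem_oneUnits {u : Aˣ} : u ∈ oneUnits ρ ↔ ρ u = 1 := by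
  rw [oneUnits, MonoidHom.mem_ker, Units.ext_iff]
  rfl

/-- The element `x` of `oneUnits ρ`, or zero if `x` is not in this group. -/
def unitPart (x : A) : WithZero (oneUnits ρ) :=
  if h : IsUnit x ∧ ρ x = 1 then ((⟨h.1.unit, mem_oneUnits.mpr h.2⟩ : oneUnits ρ) : WithZero _) else 0

variable {ρ}

lemma unitPart_eq_coe {x : A} {g : oneUnits ρ} : unitPart ρ x = g ↔ x = (g : Aˣ) := by
  rw [unitPart]
  split_ifs with h
  · rw [WithZero.coe_inj, ← Subtype.coe_inj, Units.ext_iff]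
    rfl
  · refine ⟨fun h' => absurd h'.symm WithZero.coe_ne_zero, fun h' => absurd ?_ h⟩
    rw [h']
    exact ⟨Units.isUnit _, mem_oneUnits.mp g.2⟩

lemma unitPart_eq_zero {x : A} (hx : ρ x = 1) : unitPart ρ x = 0 ↔ ¬ IsUnit x := by
  rw [unitPart]
  split_ifs with h
  · exact iff_of_false WithZero.coe_ne_zero (not_not.mpr h.1)
  · exact iff_of_true rfl fun h' => h ⟨h', hx⟩

lemma unitPart_one : unitPart ρ (1 : A) = 1 := by
  rw [← WithZero.coe_one, unitPart_eq_coe]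
  rfl

lemma unitPart_mul {x y : A} (hx : ρ x = 1) (hy : ρ y = 1) :
    unitPart ρ (x * y) = unitPart ρ x * unitPart ρ y := by
  by_cases h : IsUnit x ∧ IsUnit y
  · have h1 := unitPart_eq_coe (ρ := ρ) (g := ⟨h.1.unit, mem_oneUnits.mpr hx⟩).mpr rfl
    have h2 := unitPart_eq_coe (ρ := ρ) (g := ⟨h.2.unit, mem_oneUnits.mpr hy⟩).mpr rfl
    simp only [IsUnit.unit_spec] at h1 h2
    rw [h1, h2, ← WithZero.coe_mul, unitPart_eq_coe]
    rfl
  · rw [(unitPart_eq_zero (by rw [map_mul, hx, hy, one_mul])).mpr (by rwa [IsUnit.mul_iff]), eq_comm,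
      mul_eq_zero, unitPart_eq_zero hx, unitPart_eq_zero hy]
    exact not_and_or.mp h

end UnitPart

namespace MonicPoly

open HomEval FrobTwist

variable {F A : Type} [Field F] [Fintype F] [CommRing A] [Finite A] [Algebra F A] {ρ : A →+* F}

variable [Fintype (oneUnits ρ)]

theorem distribution_of_upperDistribution {a b : A} (hρ : ∀ f : F[X], f.Monic → ρ (homEval a b f) = 1)
    {H : Subgroup Aˣ} {C n : ℕ} (h : UpperDistribution (F := F) a b H C n)
    (hu : ∀ P : F[X], P.Monic → Irreducible P → P.natDegree = n → IsUnit (homEval a b P)) :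
    Distribution (fun f : F[X] => unitPart ρ (homEval a b f)) (H.subgroupOf (oneUnits ρ)) C n := by
  refine ⟨fun P hP => ?_, fun g => ?_⟩
  · rw [mem_irreds] at hP
    have hPu := hu P hP.1 hP.2.2 hP.2.1
    refine ⟨⟨⟨hPu.unit, mem_oneUnits.mpr (hρ P hP.1)⟩, ?_⟩, unitPart_eq_coe.mpr rfl⟩
    by_contra hH
    exact h.1 hPu.unit hH P hP.1 hP.2.2 hP.2.1 rfl
  · have h1 := h.2 (g : oneUnits ρ) g.2
      ((irreds F n).filter fun P => unitPart ρ (homEval a b P) = ((g : oneUnits ρ) : WithZero _))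
      fun P hP => by
        rw [Finset.mem_filter, mem_irreds, unitPart_eq_coe] at hP
        exact ⟨hP.1.1, hP.1.2.2, hP.1.2.1, hP.2⟩
    refine Nat.le_trans (Nat.mul_le_mul_right _ (m := Nat.card H) ?_) (by convert h1)
    rw [← Nat.card_eq_fintype_card]
    exact Nat.card_le_card_of_injective (fun x : H.subgroupOf (oneUnits ρ) => (⟨x, x.2⟩ : H))
      fun x y hxy => Subtype.ext (Subtype.ext (Subtype.mk.inj hxy))

end MonicPoly

namespace MonicPoly

variable (F : Type) [Field F] [Fintype F]

/-- The polynomials of degree less than `m`. -/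
def lowDeg (m : ℕ) : Finset F[X] :=
  Finset.univ.image fun c : Fin m → F => ((degreeLTEquiv F m).symm c : F[X])

variable {F}

lemma mem_lowDeg {m : ℕ} {f : F[X]} : f ∈ lowDeg F m ↔ f ∈ degreeLT F m := by
  simp only [lowDeg, Finset.mem_image, Finset.mem_univ, true_and]
  exact ⟨fun ⟨c, hc⟩ => hc ▸ ((degreeLTEquiv F m).symm c).2,
    fun hf => ⟨degreeLTEquiv F m ⟨f, hf⟩, by simp⟩⟩

lemma card_lowDeg (m : ℕ) : (lowDeg F m).card = Fintype.card F ^ m := by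
  rw [lowDeg, Finset.card_image_of_injective, Finset.card_univ, Fintype.card_fun, Fintype.card_fin]
  exact fun c d h => (degreeLTEquiv F m).symm.injective (Subtype.ext h)

end MonicPoly

namespace HayesRing

open HomEval MonicPoly

variable {F : Type} [Field F]

lemma isUnit_mk_iff_isCoprime {R : Type*} [CommRing R] {f r : R} :
    IsUnit (Ideal.Quotient.mk (Ideal.span {r}) f) ↔ IsCoprime f r := by
  constructor
  · intro h
    obtain ⟨b, hb⟩ := h.exists_right_inv
    obtain ⟨c, rfl⟩ := Ideal.Quotient.mk_surjective b
    rw [← map_mul, ← map_one (Ideal.Quotient.mk _), Ideal.Quotient.eq,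
      Ideal.mem_span_singleton] at hb
    obtain ⟨k, hk⟩ := hb
    exact ⟨c, -k, by linear_combination hk⟩
  · rintro ⟨u, v, h⟩
    refine IsUnit.of_mul_eq_one (Ideal.Quotient.mk _ u) ?_
    rw [← map_mul, ← map_one (Ideal.Quotient.mk _), Ideal.Quotient.eq, Ideal.mem_span_singleton]
    exact ⟨-v, by linear_combination h⟩

variable (r : F[X]) (l : ℕ)

/-- The ring whose units record the class of a monic polynomial modulo `r` together with its `l`
coefficients below the leading one. -/
abbrev _root_.HayesRing : Type :=
  (F[X] ⧸ Ideal.span {r}) × (F[X] ⧸ Ideal.span {(X ^ (l + 1) : F[X])})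

/-- The constant coefficient of the second component. -/
def augmentation : HayesRing r l →+* F :=
  (Ideal.Quotient.lift (Ideal.span {(X ^ (l + 1) : F[X])}) (evalRingHom 0) fun a ha => by
    obtain ⟨b, rfl⟩ := Ideal.mem_span_singleton.mp ha
    simp).comp (RingHom.snd _ _)

/-- The class of `X` at the finite places. -/
def clsX : HayesRing r l := (Ideal.Quotient.mk _ X, 1)

/-- The local parameter at infinity. -/
def clsInv : HayesRing r l := (1, Ideal.Quotient.mk _ X)

/-- The class of a monic polynomial. -/
def cls (f : F[X]) : HayesRing r l := homEval (clsX r l) (clsInv r l) f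

variable {r l} {f g : F[X]}

lemma aeval_mk (I : Ideal F[X]) (f : F[X]) : aeval (Ideal.Quotient.mk I X) f = Ideal.Quotient.mk I f := by
  have h := aeval_algHom_apply (Ideal.Quotient.mkₐ F I) X f
  rwa [aeval_X_left, AlgHom.id_apply] at h

lemma cls_fst (hf : f.Monic) : (cls r l f).1 = Ideal.Quotient.mk _ f := by
  have h := homEval_map (clsX r l) (clsInv r l) (RingHom.id F) (RingHom.fst _ _)
    (fun s => rfl) hf
  rw [Polynomial.map_id] at h
  rw [cls, ← aeval_mk, ← homEval_apply_one]
  exact h.symm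

lemma cls_snd (hf : f.Monic) : (cls r l f).2 = Ideal.Quotient.mk _ f.reverse := by
  have h := homEval_map (clsX r l) (clsInv r l) (RingHom.id F) (RingHom.snd _ _)
    (fun s => rfl) hf
  rw [Polynomial.map_id] at h
  rw [cls, ← aeval_mk, ← homEval_one_apply]
  exact h.symm

lemma augmentation_cls (hf : f.Monic) : augmentation r l (cls r l f) = 1 := by
  rw [augmentation, RingHom.comp_apply, RingHom.coe_snd, cls_snd hf, Ideal.Quotient.lift_mk,
    coe_evalRingHom, ← coeff_zero_eq_eval_zero, coeff_zero_reverse, hf.leadingCoeff]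

lemma isUnit_cls (hf : f.Monic) : IsUnit (cls r l f) ↔ IsCoprime f r := by
  rw [Prod.isUnit_iff, cls_fst hf, cls_snd hf, isUnit_mk_iff_isCoprime, isUnit_mk_iff_isCoprime]
  refine and_iff_left (IsCoprime.pow_right ?_)
  have h := divX_mul_X_add f.reverse
  rw [coeff_zero_reverse, hf.leadingCoeff, C_1] at h
  exact ⟨1, -f.reverse.divX, by linear_combination -h⟩

lemma mk_eq_mk_X_pow {f g : F[X]} : Ideal.Quotient.mk (Ideal.span {(X ^ (l + 1) : F[X])}) f =
    Ideal.Quotient.mk _ g ↔ ∀ i ≤ l, f.coeff i = g.coeff i := by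
  rw [Ideal.Quotient.eq, Ideal.mem_span_singleton, X_pow_dvd_iff]
  simp only [coeff_sub, sub_eq_zero, Nat.lt_succ_iff]

lemma cls_eq_cls_iff {n : ℕ} (hf : f ∈ {f : F[X] | f.Monic ∧ f.natDegree = n})
    (hg : g ∈ {f : F[X] | f.Monic ∧ f.natDegree = n}) (hl : l ≤ n) :
    cls r l f = cls r l g ↔ r ∣ f - g ∧ f - g ∈ degreeLT F (n - l) := by
  obtain ⟨hf, hfn⟩ := hf
  obtain ⟨hg, hgn⟩ := hg
  rw [Prod.ext_iff, cls_fst hf, cls_fst hg, cls_snd hf, cls_snd hg, Ideal.Quotient.eq,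
    Ideal.mem_span_singleton, mk_eq_mk_X_pow, mem_degreeLT, degree_lt_iff_coeff_zero]
  refine and_congr_right fun _ => ⟨fun h j hj => ?_, fun h i hi => ?_⟩
  · rw [coeff_sub, sub_eq_zero]
    rcases le_or_gt j n with hjn | hjn
    · have := h (n - j) (by omega)
      rwa [coeff_reverse, coeff_reverse, hfn, hgn, revAt_le (by omega), Nat.sub_sub_self hjn] at this
    · rw [coeff_eq_zero_of_natDegree_lt (by omega), coeff_eq_zero_of_natDegree_lt (by omega)]
  · rw [coeff_reverse, coeff_reverse, hfn, hgn, revAt_le (by omega), ← sub_eq_zero, ← coeff_sub]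
    exact h _ (by omega)

lemma mul_left_mem_degreeLT_iff (hr : r.Monic) {h : F[X]} {m : ℕ} :
    r * h ∈ degreeLT F (r.natDegree + m) ↔ h ∈ degreeLT F m := by
  rcases eq_or_ne h 0 with rfl | h0
  · simp
  · rw [mem_degreeLT, mem_degreeLT, degree_eq_natDegree (mul_ne_zero hr.ne_zero h0),
      degree_eq_natDegree h0, natDegree_mul hr.ne_zero h0, Nat.cast_lt, Nat.cast_lt,
      Nat.add_lt_add_iff_left]

variable [Fintype F]

lemma exists_cls_eq (hr : r.Monic) {n : ℕ} (hn : r.natDegree + l ≤ n) {x : HayesRing r l}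
    (hx : augmentation r l x = 1) : ∃ f ∈ monics F n, cls r l f = x := by
  obtain ⟨u, hu⟩ := Ideal.Quotient.mk_surjective x.1
  obtain ⟨v, hv⟩ := Ideal.Quotient.mk_surjective x.2
  have hv0 : v.coeff 0 = 1 := by
    rw [augmentation, RingHom.comp_apply, RingHom.coe_snd, ← hv, Ideal.Quotient.lift_mk,
      coe_evalRingHom, ← coeff_zero_eq_eval_zero] at hx
    exact hx
  set w : F[X] := ∑ j ∈ Finset.Icc 1 l, C (v.coeff j) * X ^ (n - j) with hw
  set f : F[X] := X ^ n + (w + (u - (X ^ n + w)) %ₘ r) with hf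
  have hwc : ∀ i, w.coeff i = if n - l ≤ i ∧ i < n then v.coeff (n - i) else 0 := fun i => by
    rw [hw, finsetSum_coeff]
    simp only [coeff_C_mul_X_pow]
    split_ifs with h
    · rw [Finset.sum_eq_single (n - i)]
      · rw [if_pos (by omega)]
      · intro j hj hji
        rw [Finset.mem_Icc] at hj
        exact if_neg (by omega)
      · intro h'
        rw [Finset.mem_Icc] at h'
        omega
    · refine Finset.sum_eq_zero fun j hj => if_neg ?_
      rw [Finset.mem_Icc] at hj
      omega
  have hmod : ∀ i, n - l ≤ i → ((u - (X ^ n + w)) %ₘ r).coeff i = 0 := fun i hi => by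
    refine coeff_eq_zero_of_degree_lt ((degree_modByMonic_lt _ hr).trans_le ?_)
    rw [degree_eq_natDegree hr.ne_zero]
    exact_mod_cast (by omega : r.natDegree ≤ i)
  have hlow : (w + (u - (X ^ n + w)) %ₘ r).degree < n := by
    rw [degree_lt_iff_coeff_zero]
    intro i hi
    rw [coeff_add, hwc, hmod i (by omega), if_neg (by omega), add_zero]
  have hfm : f ∈ monics F n := by
    rw [mem_monics]
    exact ⟨monic_X_pow_add hlow, natDegree_eq_of_degree_eq_some (by rw [hf, degree_add_eq_left_of_degree_lt
      (by rwa [degree_X_pow]), degree_X_pow])⟩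
  refine ⟨f, hfm, ?_⟩
  rw [mem_monics] at hfm
  rw [Prod.ext_iff, cls_fst hfm.1, cls_snd hfm.1, ← hu, ← hv, mk_eq_mk_X_pow, Ideal.Quotient.eq,
    Ideal.mem_span_singleton]
  constructor
  · have h := modByMonic_add_div (u - (X ^ n + w)) r
    exact ⟨-((u - (X ^ n + w)) /ₘ r), by rw [hf]; linear_combination h⟩
  · intro i hi
    rw [coeff_reverse, hfm.2, revAt_le (by omega), hf, coeff_add, coeff_add, hmod _ (by omega), hwc,
      coeff_X_pow, add_zero]
    rcases Nat.eq_zero_or_pos i with rfl | hi0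
    · rw [if_pos (by omega), if_neg (by omega), add_zero, hv0]
    · rw [if_neg (by omega), if_pos (by omega), zero_add, Nat.sub_sub_self (by omega)]

lemma card_filter_cls_eq (hr : r.Monic) {n : ℕ} (hn : r.natDegree + l ≤ n) {x : HayesRing r l}
    (hx : augmentation r l x = 1) :
    ((monics F n).filter fun f => cls r l f = x).card = Fintype.card F ^ (n - l - r.natDegree) := by
  obtain ⟨f, hf, rfl⟩ := exists_cls_eq hr hn hx
  rw [mem_monics] at hf
  have : (monics F n).filter (fun g => cls r l g = cls r l f) =
      (lowDeg F (n - l - r.natDegree)).image fun h => f + r * h := by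
    ext g
    rw [Finset.mem_filter, mem_monics, Finset.mem_image]
    constructor
    · rintro ⟨hg, h⟩
      obtain ⟨⟨h, h1⟩, h2⟩ := (cls_eq_cls_iff hg hf (by omega)).mp h
      rw [h1, show n - l = r.natDegree + (n - l - r.natDegree) by omega,
        mul_left_mem_degreeLT_iff hr] at h2
      exact ⟨h, mem_lowDeg.mpr h2, by rw [← h1]; ring⟩
    · rintro ⟨h, hh, rfl⟩
      rw [mem_lowDeg, ← mul_left_mem_degreeLT_iff hr,
        show r.natDegree + (n - l - r.natDegree) = n - l by omega] at hh
      have hd : (r * h).degree < f.degree := by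
        rw [degree_eq_natDegree hf.1.ne_zero, hf.2]
        exact (mem_degreeLT.mp hh).trans_le (by exact_mod_cast Nat.sub_le n l)
      have hg : (f + r * h).Monic ∧ (f + r * h).natDegree = n :=
        ⟨hf.1.add_of_left hd, by rw [natDegree_add_eq_left_of_degree_lt hd, hf.2]⟩
      refine ⟨hg, (cls_eq_cls_iff hg hf (by omega)).mpr ?_⟩
      rw [add_sub_cancel_left]
      exact ⟨dvd_mul_right _ _, hh⟩
  rw [this, Finset.card_image_of_injective, card_lowDeg]
  exact fun h h' heq => mul_left_cancel₀ hr.ne_zero (add_left_cancel heq)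

end HayesRing

namespace HayesRing

open HomEval MonicPoly FrobTwist

variable {F : Type} [Field F]

lemma sum_eq_zero_of_ne_one {G : Type*} [CommGroup G] [Fintype G] {χ : G →* ℂ} (hχ : χ ≠ 1) : ∑ g, χ g = 0 := by
  obtain ⟨a, ha⟩ : ∃ a, χ a ≠ 1 := by
    by_contra! h
    exact hχ (MonoidHom.ext h)
  have h : χ a * ∑ g, χ g = ∑ g, χ g := by
    rw [Finset.mul_sum, ← Equiv.sum_comp (Equiv.mulLeft a) χ]
    simp [map_mul]
  have h' : (χ a - 1) * ∑ g, χ g = 0 := by rw [sub_mul, h, one_mul, sub_self]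
  exact (mul_eq_zero.mp h').resolve_left (sub_ne_zero.mpr ha)

variable (r : F[X]) (l : ℕ)

/-- The group of classes of monic polynomials prime to `r`. -/
abbrev classGroup : Subgroup (HayesRing r l)ˣ := oneUnits (augmentation r l)

/-- The class of a monic polynomial in `classGroup r l`, or zero if it is not prime to `r`. -/
def grp (f : F[X]) : WithZero (classGroup r l) := unitPart (augmentation r l) (cls r l f)

variable {r l}

lemma grp_one : grp r l 1 = 1 := by rw [grp, cls, homEval_one, unitPart_one]

lemma grp_mul {f g : F[X]} (hf : f.Monic) (hg : g.Monic) :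
    grp r l (f * g) = grp r l f * grp r l g := by
  rw [grp, cls, homEval_mul _ _ hf hg]
  exact unitPart_mul (augmentation_cls hf) (augmentation_cls hg)

lemma grp_eq_zero_iff {f : F[X]} (hf : f.Monic) : grp r l f = 0 ↔ ¬ IsCoprime f r := by
  rw [grp, unitPart_eq_zero (augmentation_cls hf), isUnit_cls hf]

lemma isCoprime_of_natDegree_lt (hr : r ≠ 0) {P : F[X]} (hP : Irreducible P)
    (h : r.natDegree < P.natDegree) : IsCoprime P r :=
  hP.coprime_iff_not_dvd.mpr fun hd => (natDegree_le_of_dvd hd hr).not_gt h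

section Finite

variable [Fintype F]

lemma finite_quotient_span (hr : r.Monic) : Finite (F[X] ⧸ Ideal.span {r}) := by
  have : Module.Finite F (AdjoinRoot r) := hr.finite_adjoinRoot
  exact Module.finite_of_finite (M := AdjoinRoot r) F

lemma finite (hr : r.Monic) (l : ℕ) : Finite (HayesRing r l) := by
  have := finite_quotient_span hr
  have := finite_quotient_span (monic_X_pow (R := F) (l + 1))
  exact Finite.instProd

variable [Fintype (classGroup r l)]

lemma sum_monics_grp (hr : r.Monic) {n : ℕ} (hn : r.natDegree + l ≤ n)
    (Φ : WithZero (classGroup r l) → ℂ) (h0 : Φ 0 = 0) : ∑ f ∈ monics F n, Φ (grp r l f) =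
      (Fintype.card F : ℂ) ^ (n - l - r.natDegree) * ∑ g : classGroup r l, Φ g := by
  have h1 : ∀ f ∈ monics F n, Φ (grp r l f) =
      ∑ g : classGroup r l, if cls r l f = (g : (HayesRing r l)ˣ) then Φ g else 0 := fun f _ => by
    rcases eq_or_ne (grp r l f) 0 with h | h
    · rw [h, h0]
      refine (Finset.sum_eq_zero fun g _ => if_neg fun hg => ?_).symm
      rw [grp, unitPart_eq_coe.mpr hg] at h
      exact WithZero.coe_ne_zero h
    · obtain ⟨g, hg⟩ := WithZero.ne_zero_iff_exists.mp h
      have hg' := unitPart_eq_coe.mp hg.symm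
      rw [← hg, Finset.sum_eq_single g, if_pos hg']
      · intro g' _ hne
        refine if_neg fun hg2 => hne ?_
        rw [← unitPart_eq_coe] at hg2
        exact WithZero.coe_inj.mp (hg2.symm.trans hg.symm)
      · exact fun h => absurd (Finset.mem_univ _) h
  rw [Finset.sum_congr rfl h1, Finset.sum_comm, Finset.mul_sum]
  refine Finset.sum_congr rfl fun g _ => ?_
  rw [← Finset.sum_filter, Finset.sum_const, card_filter_cls_eq hr hn (mem_oneUnits.mp g.2),
    nsmul_eq_mul, Nat.cast_pow]

theorem norm_primeSum_le (hr : r.Monic) {χ : classGroup r l →* ℂ} (hχ : χ ≠ 1) {n : ℕ} (hn : n ≠ 0) :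
    ‖primeSum (fun f => ext χ (grp r l f)) n‖ ≤
      (r.natDegree + l + 2) * √(Fintype.card F : ℝ) ^ n := by
  have := finite hr l
  have hsum : ∑ g, χ g = 0 := sum_eq_zero_of_ne_one (G := classGroup r l) hχ
  obtain ⟨P, hP, hPi, hPd⟩ := exists_monic_irreducible_factor (1 + X * r) fun hu => by
    have h : (1 + X * r).natDegree = r.natDegree + 1 := by
      rw [natDegree_add_eq_right_of_natDegree_lt, natDegree_X_mul hr.ne_zero]
      rw [natDegree_X_mul hr.ne_zero, natDegree_one]
      exact Nat.succ_pos _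
    rw [natDegree_eq_zero_of_isUnit hu] at h
    omega
  have hPr : IsCoprime P r := by
    obtain ⟨k, hk⟩ := hPd
    exact ⟨k, -X, by linear_combination -hk⟩
  obtain ⟨H, C, n₀, m, hm, hU⟩ := exists_upperDistribution (clsX r l) (clsInv r l) hP hPi
    ((isUnit_cls hP).mpr hPr)
  have h := MonicPoly.norm_primeSum_le (γ := grp r l) grp_one (fun f g => grp_mul) hm
    (H := H.subgroupOf (classGroup r l)) (C := C) (n₀ := max n₀ (r.natDegree + 1))
    (fun n hn hmn => by
      convert distribution_of_upperDistribution (ρ := augmentation r l) (fun f => augmentation_cls)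
        (hU n (le_of_max_le_left hn) hmn) fun P hP hPi hPn => (isUnit_cls hP).mpr
          (isCoprime_of_natDegree_lt hr.ne_zero hPi (by have := le_of_max_le_right hn; omega))
      rfl)
    χ (B := r.natDegree + l) (fun n hn => by
      rw [monicSum, sum_monics_grp hr hn.le (fun x => ext χ x) (map_zero _)]
      simp only [ext_coe]
      rw [hsum, mul_zero]) hn
  exact_mod_cast h

end Finite

end HayesRing

namespace FiniteFourier

open ComplexConjugate

theorem sum_norm_sq_addChar {α : Type*} [AddCommGroup α] [Fintype α] (w : α → ℂ) :
    ∑ ψ : AddChar α ℂ, ‖∑ g, w g * ψ g‖ ^ 2 = Fintype.card α * ∑ g, ‖w g‖ ^ 2 := by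
  have h : ∀ ψ : AddChar α ℂ, ((‖∑ g, w g * ψ g‖ ^ 2 : ℝ) : ℂ) =
      ∑ g, ∑ k, w g * conj (w k) * ψ (g - k) := fun ψ => by
    rw [Complex.ofReal_pow, ← Complex.mul_conj', map_sum, Finset.sum_mul_sum]
    refine Finset.sum_congr rfl fun g _ => Finset.sum_congr rfl fun k _ => ?_
    rw [map_mul, ← AddChar.map_neg_eq_conj, sub_eq_add_neg, AddChar.map_add_eq_mul]
    ring
  refine Complex.ofReal_injective ?_
  rw [Complex.ofReal_sum, Finset.sum_congr rfl fun ψ _ => h ψ, Finset.sum_comm, Complex.ofReal_mul,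
    Complex.ofReal_sum, Finset.mul_sum]
  refine Finset.sum_congr rfl fun g _ => ?_
  rw [Finset.sum_comm]
  simp only [← Finset.mul_sum, AddChar.sum_apply_eq_ite, sub_eq_zero]
  rw [Finset.sum_eq_single g]
  · rw [if_pos rfl, Complex.mul_conj', Complex.ofReal_pow, Complex.ofReal_natCast, mul_comm]
  · exact fun k _ hk => by rw [if_neg hk.symm, mul_zero]
  · exact fun h => absurd (Finset.mem_univ _) h

theorem norm_sum_mul_sub_le {G : Type*} [CommGroup G] [Fintype G] {v Ψ : G → ℂ}
    (hΨ : ∀ g, ‖Ψ g‖ ≤ 1) {M : ℝ} (hM0 : 0 ≤ M)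
    (hM : ∀ χ : G →* ℂ, χ ≠ 1 → ‖∑ g, v g * χ g‖ ≤ M) :
    ‖∑ g, v g * Ψ g - (∑ g, v g) * (∑ g, Ψ g) / Fintype.card G‖ ≤ √(Fintype.card G) * M := by
  set K : ℝ := (Fintype.card G : ℝ) with hK
  have hK0 : 0 < K := Nat.cast_pos.mpr Fintype.card_pos
  have hKc : (Fintype.card G : ℂ) ≠ 0 := Nat.cast_ne_zero.mpr Fintype.card_ne_zero
  set w : G → ℂ := fun g => v g - (∑ g, v g) / Fintype.card G with hw
  have hsum : ∑ g, v g * Ψ g - (∑ g, v g) * (∑ g, Ψ g) / Fintype.card G = ∑ g, w g * Ψ g := by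
    simp only [hw, sub_mul, Finset.sum_sub_distrib, ← Finset.mul_sum]
    ring
  have hw0 : ∑ g, w g = 0 := by
    simp only [hw, Finset.sum_sub_distrib, Finset.sum_const, Finset.card_univ, nsmul_eq_mul]
    rw [mul_div_cancel₀ _ hKc, sub_self]
  have hchar : ∀ ψ : AddChar (Additive G) ℂ, ‖∑ g, w (Additive.toMul g) * ψ g‖ ^ 2 ≤ M ^ 2 := by
    intro ψ
    refine pow_le_pow_left₀ (norm_nonneg _) ?_ 2
    set χ : G →* ℂ :=
      { toFun := fun g => ψ (Additive.ofMul g)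
        map_one' := ψ.map_zero_eq_one
        map_mul' := fun a b => ψ.map_add_eq_mul _ _ } with hχ
    have h1 : ∑ g, w (Additive.toMul g) * ψ g = ∑ g, w g * χ g :=
      Fintype.sum_equiv Additive.toMul _ _ fun g => rfl
    rw [h1]
    rcases eq_or_ne χ 1 with h | h
    · simpa [h, hw0] using hM0
    · have h2 : ∑ g, w g * χ g = ∑ g, v g * χ g := by
        simp only [hw, sub_mul, Finset.sum_sub_distrib, ← Finset.mul_sum]
        rw [HayesRing.sum_eq_zero_of_ne_one h, mul_zero, sub_zero]
      rw [h2]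
      exact hM χ h
  have hl2 : ∑ g, ‖w g‖ ^ 2 ≤ M ^ 2 := by
    have h1 := sum_norm_sq_addChar fun g : Additive G => w (Additive.toMul g)
    have h2 : ∑ g : Additive G, ‖w (Additive.toMul g)‖ ^ 2 = ∑ g, ‖w g‖ ^ 2 :=
      Fintype.sum_equiv Additive.toMul _ _ fun g => rfl
    have h3 := Finset.sum_le_card_nsmul (Finset.univ : Finset (AddChar (Additive G) ℂ)) _ _
      fun ψ _ => hchar ψ
    rw [h1, h2, Finset.card_univ, AddChar.card_eq, nsmul_eq_mul, Fintype.card_additive] at h3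
    exact le_of_mul_le_mul_left h3 hK0
  rw [hsum]
  refine (norm_sum_le _ _).trans ?_
  have h4 : ∑ g, ‖w g * Ψ g‖ ≤ ∑ g, ‖w g‖ := Finset.sum_le_sum fun g _ => by
    rw [norm_mul]
    exact mul_le_of_le_one_right (norm_nonneg _) (hΨ g)
  refine h4.trans (le_of_sq_le_sq ?_ (by positivity))
  have h5 := sq_sum_le_card_mul_sum_sq (s := Finset.univ) (f := fun g => ‖w g‖)
  rw [Finset.card_univ] at h5
  rw [mul_pow, Real.sq_sqrt hK0.le]
  exact h5.trans (mul_le_mul_of_nonneg_left hl2 hK0.le)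

end FiniteFourier

namespace MonicPoly

variable {F : Type} [Field F] [Fintype F] {r : F[X]}

lemma mul_mem_monics (hr : r.Monic) {m : ℕ} {h ρ : F[X]} (hh : h ∈ monics F m)
    (hρ : ρ ∈ lowDeg F r.natDegree) : r * h + ρ ∈ monics F (r.natDegree + m) := by
  rw [mem_monics] at hh ⊢
  rw [mem_lowDeg, mem_degreeLT, ← degree_eq_natDegree hr.ne_zero] at hρ
  have hd : ρ.degree < (r * h).degree := hρ.trans_le (degree_le_mul_left _ hh.1.ne_zero)
  exact ⟨(hr.mul hh.1).add_of_left hd, by rw [natDegree_add_eq_left_of_degree_lt hd,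
    hr.natDegree_mul hh.1, hh.2]⟩

lemma sum_monics_add {M : Type*} [AddCommMonoid M] (hr : r.Monic) (m : ℕ) (Θ : F[X] → M) :
    ∑ f ∈ monics F (r.natDegree + m), Θ f =
      ∑ h ∈ monics F m, ∑ ρ ∈ lowDeg F r.natDegree, Θ (r * h + ρ) := by
  have h0 := (Finset.sum_product' (monics F m) (lowDeg F r.natDegree)
    fun h ρ => Θ (r * h + ρ)).symm
  rw [h0]
  symm
  refine Finset.sum_nbij (fun x : F[X] × F[X] => r * x.1 + x.2) (fun x hx => ?_) ?_ ?_
    fun x _ => rfl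
  · rw [Finset.mem_product] at hx
    exact mul_mem_monics hr hx.1 hx.2
  · rintro ⟨h, ρ⟩ hx ⟨h', ρ'⟩ hx' heq
    simp only [Finset.coe_product, Set.mem_prod, Finset.mem_coe, mem_lowDeg, mem_degreeLT,
      ← degree_eq_natDegree hr.ne_zero] at hx hx'
    have h1 := div_modByMonic_unique h ρ hr ⟨add_comm _ _, hx.2⟩
    have h2 := div_modByMonic_unique h' ρ' hr ⟨add_comm _ _, hx'.2⟩
    simp only at heq
    rw [heq] at h1
    exact Prod.ext (h1.1.symm.trans h2.1) (h1.2.symm.trans h2.2)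
  · intro f hf
    rw [Finset.mem_coe, mem_monics] at hf
    have hd : r.degree ≤ f.degree := by
      rw [degree_eq_natDegree hr.ne_zero, degree_eq_natDegree hf.1.ne_zero, hf.2]
      exact_mod_cast Nat.le_add_right _ _
    refine ⟨(f /ₘ r, f %ₘ r), ?_, ?_⟩
    · simp only [Finset.coe_product, Set.mem_prod, Finset.mem_coe, mem_lowDeg, mem_degreeLT,
        mem_monics, ← degree_eq_natDegree hr.ne_zero]
      refine ⟨⟨?_, ?_⟩, degree_modByMonic_lt _ hr⟩
      · rw [Monic, leadingCoeff_divByMonic_of_monic hr hd, hf.1.leadingCoeff]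
      · rw [natDegree_divByMonic _ hr, hf.2, Nat.add_sub_cancel_left]
    · exact (add_comm _ _).trans (modByMonic_add_div f r)

/-- The monic irreducible divisors of `r`. -/
def primeDivisors (r : F[X]) : Finset F[X] :=
  (UniqueFactorizationMonoid.normalizedFactors r).toFinset

lemma mem_primeDivisors (hr : r ≠ 0) {P : F[X]} :
    P ∈ primeDivisors r ↔ Irreducible P ∧ P.Monic ∧ P ∣ r := by
  rw [primeDivisors, Multiset.mem_toFinset, Polynomial.mem_normalizedFactors_iff hr]

lemma muP_eq (hr : r ≠ 0) :
    muP F r = if Squarefree r then (-1) ^ (primeDivisors r).card else 0 := by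
  have h : {P : F[X] | P.Monic ∧ Irreducible P ∧ P ∣ r} = primeDivisors r := by
    ext P
    rw [Finset.mem_coe, mem_primeDivisors hr]
    exact and_left_comm
  rw [muP, h, Set.ncard_coe_finset]

lemma pairwise_isCoprime (hr : r ≠ 0) {S : Finset F[X]} (hS : S ⊆ primeDivisors r) :
    (S : Set F[X]).Pairwise fun P Q => IsCoprime P Q := by
  intro P hP Q hQ hPQ
  have hP' := (mem_primeDivisors hr).mp (hS hP)
  have hQ' := (mem_primeDivisors hr).mp (hS hQ)
  refine hP'.1.coprime_iff_not_dvd.mpr fun hd => hPQ ?_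
  exact eq_of_monic_of_associated hP'.2.1 hQ'.2.1 (hP'.1.associated_of_dvd hQ'.1 hd)

lemma prod_dvd_iff (hr : r ≠ 0) {S : Finset F[X]} (hS : S ⊆ primeDivisors r) {ρ : F[X]} :
    ∏ P ∈ S, P ∣ ρ ↔ ∀ P ∈ S, P ∣ ρ :=
  ⟨fun h _ hP => (Finset.dvd_prod_of_mem _ hP).trans h,
    fun h => Finset.prod_dvd_of_coprime (pairwise_isCoprime hr hS) h⟩

lemma monic_prod_subset (hr : r ≠ 0) {S : Finset F[X]} (hS : S ⊆ primeDivisors r) :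
    (∏ P ∈ S, P).Monic :=
  monic_prod_of_monic _ _ fun _ hP => ((mem_primeDivisors hr).mp (hS hP)).2.1

lemma prod_eq_iff (hr : r.Monic) {S : Finset F[X]} (hS : S ⊆ primeDivisors r) :
    ∏ P ∈ S, P = r ↔ Squarefree r ∧ S = primeDivisors r := by
  have h0 := hr.ne_zero
  constructor
  · intro h
    refine ⟨?_, hS.antisymm fun Q hQ => ?_⟩
    · rw [← h]
      exact Finset.squarefree_prod_of_pairwise_isCoprime
        (fun P hP Q hQ hPQ => (pairwise_isCoprime h0 hS hP hQ hPQ).isRelPrime)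
        fun P hP => ((mem_primeDivisors h0).mp (hS hP)).1.squarefree
    · have hQ' := (mem_primeDivisors h0).mp hQ
      obtain ⟨P, hP, hd⟩ := hQ'.1.prime.exists_mem_finset_dvd (h ▸ hQ'.2.2)
      have hP' := (mem_primeDivisors h0).mp (hS hP)
      rwa [eq_of_monic_of_associated hQ'.2.1 hP'.2.1 (hQ'.1.associated_of_dvd hP'.1 hd)]
  · rintro ⟨hsq, rfl⟩
    rw [UniqueFactorizationMonoid.squarefree_iff_nodup_normalizedFactors h0] at hsq
    have h := UniqueFactorizationMonoid.prod_normalizedFactors_eq h0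
    rw [hr.normalize_eq_self] at h
    rw [Finset.prod, primeDivisors, Multiset.toFinset_val, hsq.dedup, Multiset.map_id', h]

lemma isCoprime_iff_forall (hr : r ≠ 0) {ρ : F[X]} :
    IsCoprime ρ r ↔ ∀ P ∈ primeDivisors r, ¬ P ∣ ρ := by
  constructor
  · intro h P hP hd
    have hP' := (mem_primeDivisors hr).mp hP
    exact hP'.1.not_isUnit (h.isUnit_of_dvd' hd hP'.2.2)
  · intro h
    refine isCoprime_of_irreducible_dvd (fun h' => hr h'.2) fun P hP hd hd' => ?_
    refine h (normalize P) ((mem_primeDivisors hr).mpr ⟨?_, monic_normalize hP.ne_zero, ?_⟩) ?_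
    · exact (associated_normalize P).irreducible hP
    · exact (associated_normalize P).symm.dvd.trans hd'
    · exact (associated_normalize P).symm.dvd.trans hd

lemma indicator_isCoprime (hr : r ≠ 0) (ρ : F[X]) : (if IsCoprime ρ r then (1 : ℂ) else 0) =
    ∑ S ∈ (primeDivisors r).powerset, (-1) ^ S.card * if ∏ P ∈ S, P ∣ ρ then 1 else 0 := by
  have h : (if IsCoprime ρ r then (1 : ℂ) else 0) =
      ∏ P ∈ primeDivisors r, (1 + -(if P ∣ ρ then (1 : ℂ) else 0)) := by
    split_ifs with hc
    · rw [isCoprime_iff_forall hr] at hc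
      exact (Finset.prod_eq_one fun P hP => by rw [if_neg (hc P hP), neg_zero, add_zero]).symm
    · rw [isCoprime_iff_forall hr] at hc
      push Not at hc
      obtain ⟨P, hP, hd⟩ := hc
      exact (Finset.prod_eq_zero hP (by rw [if_pos hd, add_neg_cancel])).symm
  rw [h, Finset.prod_one_add]
  refine Finset.sum_congr rfl fun S hS => ?_
  rw [Finset.prod_neg]
  congr 1
  split_ifs with hd
  · rw [prod_dvd_iff hr (Finset.mem_powerset.mp hS)] at hd
    exact Finset.prod_eq_one fun P hP => if_pos (hd P hP)
  · rw [prod_dvd_iff hr (Finset.mem_powerset.mp hS)] at hd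
    push Not at hd
    obtain ⟨P, hP, hd⟩ := hd
    exact Finset.prod_eq_zero hP (if_neg hd)

/-- An additive character of `F[X]` of exact denominator `r`. -/
structure HasDenominator (ψ : AddChar F[X] ℂ) (r : F[X]) : Prop where
  map_mul : ∀ f, ψ (r * f) = 1
  exists_ne_one : ∀ D, ¬ r ∣ D → ∃ f, ψ (D * f) ≠ 1

lemma sum_filter_dvd_lowDeg {ψ : AddChar F[X] ℂ} (hr : r.Monic) (hψ : HasDenominator ψ r) {D : F[X]}
    (hD : D.Monic) (hDr : D ∣ r) : ∑ ρ ∈ lowDeg F r.natDegree, ψ ρ * (if D ∣ ρ then 1 else 0) =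
      if D = r then 1 else 0 := by
  obtain ⟨E, rfl⟩ := hDr
  have hE : E.Monic := hD.of_mul_monic_left hr
  have himage : (lowDeg F (D * E).natDegree).filter (fun ρ => D ∣ ρ) =
      (lowDeg F E.natDegree).image fun σ => D * σ := by
    ext ρ
    rw [Finset.mem_filter, Finset.mem_image, mem_lowDeg, hD.natDegree_mul hE]
    constructor
    · rintro ⟨h1, σ, rfl⟩
      rw [HayesRing.mul_left_mem_degreeLT_iff hD] at h1
      exact ⟨σ, mem_lowDeg.mpr h1, rfl⟩
    · rintro ⟨σ, hσ, rfl⟩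
      rw [HayesRing.mul_left_mem_degreeLT_iff hD]
      exact ⟨mem_lowDeg.mp hσ, dvd_mul_right _ _⟩
  simp only [mul_ite, mul_one, mul_zero]
  rw [← Finset.sum_filter, himage, Finset.sum_image fun x _ y _ h => mul_left_cancel₀ hD.ne_zero h]
  split_ifs with h
  · have hE1 : E = 1 := mul_left_cancel₀ hD.ne_zero (by rw [← h, mul_one])
    have : lowDeg F E.natDegree = {0} := by
      ext σ
      rw [mem_lowDeg, hE1, natDegree_one, mem_degreeLT, Finset.mem_singleton, Nat.cast_zero,
        Nat.WithBot.lt_zero_iff, degree_eq_bot]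
    rw [this, Finset.sum_singleton, mul_zero, AddChar.map_zero_eq_one]
  · obtain ⟨σ₀, hσ₀⟩ := hψ.exists_ne_one D fun hd => h
      (eq_of_monic_of_associated hD hr (associated_of_dvd_dvd (dvd_mul_right _ _) hd))
    set σ := σ₀ %ₘ E with hσ
    have hσ1 : ψ (D * σ) ≠ 1 := by
      have h1 : D * σ₀ = D * σ + D * E * (σ₀ /ₘ E) := by
        rw [mul_assoc, ← mul_add, hσ, modByMonic_add_div]
      rwa [h1, AddChar.map_add_eq_mul, hψ.map_mul, mul_one] at hσ₀
    have hσm : σ ∈ lowDeg F E.natDegree := by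
      rw [mem_lowDeg, mem_degreeLT, ← degree_eq_natDegree hE.ne_zero]
      exact degree_modByMonic_lt _ hE
    have hshift : ψ (D * σ) * ∑ x ∈ lowDeg F E.natDegree, ψ (D * x) =
        ∑ x ∈ lowDeg F E.natDegree, ψ (D * x) := by
      rw [Finset.mul_sum]
      refine Finset.sum_bij' (fun x _ => σ + x) (fun x _ => x - σ) (fun x hx => ?_) (fun x hx => ?_)
        (fun x _ => add_sub_cancel_left _ _) (fun x _ => add_sub_cancel _ _) fun x _ => ?_
      · rw [mem_lowDeg] at *
        exact Submodule.add_mem _ hσm hx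
      · rw [mem_lowDeg] at *
        exact Submodule.sub_mem _ hx hσm
      · rw [mul_add, AddChar.map_add_eq_mul]
    have h0 : (ψ (D * σ) - 1) * ∑ x ∈ lowDeg F E.natDegree, ψ (D * x) = 0 := by
      rw [sub_mul, hshift, one_mul, sub_self]
    exact (mul_eq_zero.mp h0).resolve_left (sub_ne_zero.mpr hσ1)

/-- The evaluation of Ramanujan sums. -/
theorem sum_isCoprime_eq_muP {ψ : AddChar F[X] ℂ} (hr : r.Monic) (hψ : HasDenominator ψ r) :
    ∑ ρ ∈ lowDeg F r.natDegree, ψ ρ * (if IsCoprime ρ r then 1 else 0) = muP F r := by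
  have h0 := hr.ne_zero
  simp only [indicator_isCoprime h0, Finset.mul_sum]
  rw [Finset.sum_comm]
  have h1 : ∀ S ∈ (primeDivisors r).powerset, ∑ ρ ∈ lowDeg F r.natDegree,
      ψ ρ * ((-1) ^ S.card * if ∏ P ∈ S, P ∣ ρ then 1 else 0) =
      if Squarefree r ∧ S = primeDivisors r then (-1) ^ S.card else 0 := fun S hS => by
    have hS' := Finset.mem_powerset.mp hS
    simp only [mul_left_comm (ψ _)]
    rw [← Finset.mul_sum, sum_filter_dvd_lowDeg hr hψ (monic_prod_subset h0 hS')
      ((prod_dvd_iff h0 hS').mpr fun P hP => ((mem_primeDivisors h0).mp (hS' hP)).2.2),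
      mul_ite, mul_one, mul_zero]
    exact if_congr (prod_eq_iff hr hS') rfl rfl
  rw [Finset.sum_congr rfl h1, muP_eq h0]
  by_cases hsq : Squarefree r
  · simp only [hsq, true_and, if_true]
    rw [Finset.sum_ite_eq_of_mem' _ _ _ (Finset.mem_powerset_self _)]
    push_cast
    rfl
  · simp [hsq]

end MonicPoly

namespace HayesRing

open MonicPoly FiniteFourier

variable {F : Type} [Field F] [Fintype F] {r : F[X]} {l n : ℕ}

lemma phiP_eq (hr : r.Monic) :
    phiP F r = ((lowDeg F r.natDegree).filter fun ρ => IsCoprime ρ r).card := by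
  rw [phiP, ← Nat.card_eq_finsetCard]
  have hmem : ∀ ρ : ((lowDeg F r.natDegree).filter fun ρ => IsCoprime ρ r),
      (ρ : F[X]).degree < r.degree ∧ IsCoprime (ρ : F[X]) r := fun ρ => by
    obtain ⟨h1, h2⟩ := Finset.mem_filter.mp ρ.2
    rw [mem_lowDeg, mem_degreeLT, ← degree_eq_natDegree hr.ne_zero] at h1
    exact ⟨h1, h2⟩
  symm
  refine Nat.card_eq_of_bijective (fun ρ => (isUnit_mk_iff_isCoprime.mpr (hmem ρ).2).unit) ⟨?_, ?_⟩
  · intro ρ ρ' h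
    rw [Units.ext_iff, IsUnit.unit_spec, IsUnit.unit_spec, Ideal.Quotient.eq,
      Ideal.mem_span_singleton] at h
    refine Subtype.ext (sub_eq_zero.mp (eq_zero_of_dvd_of_degree_lt h ?_))
    exact (degree_sub_le _ _).trans_lt (max_lt (hmem ρ).1 (hmem ρ').1)
  · intro u
    obtain ⟨f, hf⟩ := Ideal.Quotient.mk_surjective (u : F[X] ⧸ Ideal.span {r})
    have hmod : Ideal.Quotient.mk (Ideal.span {r}) (f %ₘ r) = u := by
      rw [← hf, Ideal.Quotient.eq, Ideal.mem_span_singleton]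
      exact ⟨-(f /ₘ r), by linear_combination modByMonic_add_div f r⟩
    refine ⟨⟨f %ₘ r, Finset.mem_filter.mpr ⟨?_, ?_⟩⟩, Units.ext hmod⟩
    · rw [mem_lowDeg, mem_degreeLT, ← degree_eq_natDegree hr.ne_zero]
      exact degree_modByMonic_lt _ hr
    · rw [← isUnit_mk_iff_isCoprime, hmod]
      exact u.isUnit

lemma sum_lowDeg_isCoprime (hr : r.Monic) :
    ∑ ρ ∈ lowDeg F r.natDegree, (if IsCoprime ρ r then (1 : ℂ) else 0) = phiP F r := by
  rw [phiP_eq hr, Finset.sum_ite, Finset.sum_const_zero, add_zero, Finset.sum_const, nsmul_eq_mul,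
    mul_one]

lemma sum_fiber {α G : Type*} [Fintype G] (S : Finset α) (κ : α → WithZero G) {Φ : WithZero G → ℂ}
    (h0 : Φ 0 = 0) : ∑ s ∈ S, Φ (κ s) = ∑ g : G, ((S.filter fun s => κ s = g).card : ℂ) * Φ g := by
  simp only [← nsmul_eq_mul, ← Finset.sum_const, Finset.sum_filter]
  rw [Finset.sum_comm]
  refine Finset.sum_congr rfl fun s _ => ?_
  induction κ s using WithZero.recZeroCoe with
  | zero => simp [h0]
  | coe g => simp

lemma sum_monics_grp_ne_zero (hr : r.Monic) (m : ℕ) :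
    ∑ f ∈ monics F (r.natDegree + m), (if grp r l f = 0 then (0 : ℂ) else 1) =
      Fintype.card F ^ m * phiP F r := by
  rw [sum_monics_add hr, ← sum_lowDeg_isCoprime hr, ← Nat.cast_pow, ← card_monics, ← nsmul_eq_mul,
    ← Finset.sum_const]
  refine Finset.sum_congr rfl fun h hh => Finset.sum_congr rfl fun ρ hρ => ?_
  rw [if_congr (grp_eq_zero_iff (mem_monics.mp (mul_mem_monics hr hh hρ)).1) rfl rfl, ite_not,
    if_congr IsCoprime.mul_add_left_left_iff rfl rfl]

lemma card_classGroup [Fintype (classGroup r l)] (hr : r.Monic) :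
    (Fintype.card (classGroup r l) : ℂ) = Fintype.card F ^ l * phiP F r := by
  have h := sum_monics_grp hr le_rfl (fun x : WithZero (classGroup r l) => if x = 0 then (0 : ℂ) else 1)
    (if_pos rfl)
  rw [sum_monics_grp_ne_zero hr] at h
  rw [h]
  simp

/-- The function on classes induced by a function on monic polynomials of degree `n`. -/
def onClasses (n : ℕ) (θ : F[X] → ℂ) (x : WithZero (classGroup r l)) : ℂ :=
  if h : ∃ f ∈ monics F n, x ≠ 0 ∧ grp r l f = x then θ h.choose else 0

lemma onClasses_zero {θ : F[X] → ℂ} : onClasses (r := r) (l := l) n θ 0 = 0 :=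
  dif_neg fun ⟨_, _, h, _⟩ => h rfl

lemma norm_onClasses_le {θ : F[X] → ℂ} (hθ : ∀ f, ‖θ f‖ ≤ 1) (x : WithZero (classGroup r l)) :
    ‖onClasses n θ x‖ ≤ 1 := by
  rw [onClasses]
  split_ifs with h
  · exact hθ _
  · rw [norm_zero]
    exact zero_le_one

lemma onClasses_grp {θ : AddChar F[X] ℂ} (hl : l ≤ n)
    (hθ : ∀ f ∈ degreeLT F (n - l), r ∣ f → θ f = 1) {f : F[X]} (hf : f ∈ monics F n) :
    onClasses n θ (grp r l f) = if IsCoprime f r then θ f else 0 := by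
  have h0 := grp_eq_zero_iff (r := r) (l := l) (mem_monics.mp hf).1
  split_ifs with hc
  · have h : ∃ f' ∈ monics F n, grp r l f ≠ 0 ∧ grp r l f' = grp r l f :=
      ⟨f, hf, fun h => h0.mp h hc, rfl⟩
    rw [onClasses, dif_pos h]
    obtain ⟨h1, h2, h3⟩ := h.choose_spec
    obtain ⟨g, hg⟩ := WithZero.ne_zero_iff_exists.mp h2
    have h4 : cls r l h.choose = cls r l f := by
      rw [unitPart_eq_coe.mp (h3.trans hg.symm), unitPart_eq_coe.mp hg.symm]
    rw [cls_eq_cls_iff (mem_monics.mp h1) (mem_monics.mp hf) hl] at h4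
    have h5 := hθ _ h4.2 h4.1
    rw [← sub_add_cancel h.choose f, AddChar.map_add_eq_mul, h5, one_mul]
  · rw [h0.mpr hc, onClasses_zero]

theorem sum_monics_isCoprime {ψ ω : AddChar F[X] ℂ} (hr : r.Monic) (hψ : HasDenominator ψ r) (m : ℕ)
    (hω : ∀ f ∈ degreeLT F r.natDegree, ω f = 1) :
    ∑ f ∈ monics F (r.natDegree + m), (if IsCoprime f r then (ψ * ω) f else 0) =
      muP F r * ∑ h ∈ monics F m, ω (r * h) := by
  rw [sum_monics_add hr, ← sum_isCoprime_eq_muP hr hψ, Finset.sum_mul_sum, Finset.sum_comm]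
  refine Finset.sum_congr rfl fun ρ hρ => Finset.sum_congr rfl fun h hh => ?_
  rw [if_congr IsCoprime.mul_add_left_left_iff rfl rfl, AddChar.mul_apply, AddChar.map_add_eq_mul,
    AddChar.map_add_eq_mul, hψ.map_mul, hω ρ (mem_lowDeg.mp hρ)]
  split_ifs <;> simp

lemma sum_monics_eq {ω : AddChar F[X] ℂ} (hr : r.Monic) (m : ℕ)
    (hω : ∀ f ∈ degreeLT F r.natDegree, ω f = 1) :
    ∑ f ∈ monics F (r.natDegree + m), ω f =
      Fintype.card F ^ r.natDegree * ∑ h ∈ monics F m, ω (r * h) := by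
  rw [sum_monics_add hr, Finset.mul_sum]
  refine Finset.sum_congr rfl fun h _ => ?_
  rw [Finset.sum_congr rfl fun ρ hρ => by
    rw [AddChar.map_add_eq_mul, hω ρ (mem_lowDeg.mp hρ), mul_one], Finset.sum_const, card_lowDeg,
    nsmul_eq_mul, Nat.cast_pow]

end HayesRing

namespace HayesRing

open MonicPoly FiniteFourier

variable {F : Type} [Field F] [Fintype F] {r : F[X]} {l n : ℕ}

lemma phiP_pos (hr : r.Monic) : 0 < phiP F r := by
  have := finite_quotient_span hr
  exact Nat.card_pos

lemma phiP_le (hr : r.Monic) : phiP F r ≤ Fintype.card F ^ r.natDegree := by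
  rw [phiP_eq hr, ← card_lowDeg]
  exact Finset.card_filter_le _ _

theorem norm_sum_irreds_sub_le {ψ ω : AddChar F[X] ℂ} (hr : r.Monic) (hψ : HasDenominator ψ r)
    (hψ1 : ∀ f, ‖ψ f‖ ≤ 1) (hω1 : ∀ f, ‖ω f‖ ≤ 1) (hω : ∀ f ∈ degreeLT F (n - l), ω f = 1)
    (hd : r.natDegree < n) (hdl : r.natDegree + l ≤ n) :
    ‖n * ∑ P ∈ irreds F n, (ψ * ω) P - muP F r / phiP F r * ∑ f ∈ monics F n, ω f‖ ≤
      √((Fintype.card F : ℝ) ^ (r.natDegree + l)) *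
        ((r.natDegree + l + 2) * √(Fintype.card F : ℝ) ^ n) + 2 * √(Fintype.card F : ℝ) ^ n := by
  have := finite hr l
  have : Fintype (classGroup r l) := Fintype.ofFinite _
  set q := Fintype.card F with hq
  have hq0 : (q : ℂ) ≠ 0 := Nat.cast_ne_zero.mpr Fintype.card_ne_zero
  have hφ : (phiP F r : ℂ) ≠ 0 := Nat.cast_ne_zero.mpr (phiP_pos hr).ne'
  set G := classGroup r l
  have hln : l ≤ n := le_of_add_le_right hdl
  have hθ : ∀ f ∈ degreeLT F (n - l), r ∣ f → (ψ * ω) f = 1 := by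
    rintro _ hf ⟨g, rfl⟩
    rw [AddChar.mul_apply, hψ.map_mul, hω _ hf, one_mul]
  have hω' : ∀ f ∈ degreeLT F r.natDegree, ω f = 1 := fun f hf =>
    hω f (degreeLT_mono (by omega) hf)
  have hθ1 : ∀ f, ‖(ψ * ω) f‖ ≤ 1 := fun f => by
    rw [AddChar.mul_apply, norm_mul]
    exact mul_le_one₀ (hψ1 f) (norm_nonneg _) (hω1 f)
  have hmu := sum_monics_isCoprime hr hψ (n - r.natDegree) hω'
  set θ : AddChar F[X] ℂ := ψ * ω
  set Ψ : WithZero G → ℂ := onClasses n θ with hΨ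
  have hcop : ∀ P ∈ irreds F n, IsCoprime P r := fun P hP => by
    obtain ⟨_, h2, h3⟩ := mem_irreds.mp hP
    exact isCoprime_of_natDegree_lt hr.ne_zero h3 (h2 ▸ hd)
  have hmon : ∀ P ∈ irreds F n, P ∈ monics F n := fun P hP =>
    mem_monics.mpr ⟨(mem_irreds.mp hP).1, (mem_irreds.mp hP).2.1⟩
  set v : G → ℂ := fun g => n * (((irreds F n).filter fun P => grp r l P = g).card : ℂ) with hv
  have hvsum : ∀ Φ : WithZero G → ℂ, Φ 0 = 0 →
      n * ∑ P ∈ irreds F n, Φ (grp r l P) = ∑ g : G, v g * Φ g := fun Φ h0 => by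
    rw [sum_fiber _ _ h0, Finset.mul_sum]
    exact Finset.sum_congr rfl fun g _ => by
      rw [hv, mul_assoc]
      congr!
  have hA : n * ∑ P ∈ irreds F n, θ P = ∑ g : G, v g * Ψ g := by
    rw [← hvsum Ψ onClasses_zero]
    congr 1
    refine Finset.sum_congr rfl fun P hP => ?_
    rw [hΨ, onClasses_grp hln hθ (hmon P hP), if_pos (hcop P hP)]
  have hcard : ∑ g : G, v g = n * ((irreds F n).card : ℂ) := by
    have h := hvsum (fun x => if x = 0 then 0 else 1) (if_pos rfl)
    simp only [WithZero.coe_ne_zero, if_false, mul_one] at h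
    rw [← h, Finset.sum_congr rfl fun P hP => if_neg fun h => ?_, Finset.sum_const, nsmul_eq_mul, mul_one]
    exact (grp_eq_zero_iff (mem_irreds.mp hP).1).mp h (hcop P hP)
  have hΨ1 : ∀ g : G, ‖Ψ g‖ ≤ 1 := fun g => norm_onClasses_le hθ1 _
  have hmain : (q : ℂ) ^ n * (∑ g : G, Ψ g) / Fintype.card G =
      muP F r / phiP F r * ∑ f ∈ monics F n, ω f := by
    have h1 := sum_monics_grp hr hdl Ψ onClasses_zero
    have hn : r.natDegree + (n - r.natDegree) = n := by omega
    have h2 := sum_monics_eq hr (n - r.natDegree) hω'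
    rw [hn] at h2 hmu
    rw [Finset.sum_congr rfl fun f hf => onClasses_grp hln hθ hf, hmu, ← hq] at h1
    have h3 : (q : ℂ) ^ n = (q : ℂ) ^ (n - l - r.natDegree) * (q : ℂ) ^ r.natDegree * (q : ℂ) ^ l := by
      rw [← pow_add, ← pow_add]
      congr 1
      omega
    rw [h2, card_classGroup hr, ← hq, h3, div_mul_eq_mul_div, div_eq_div_iff (by positivity) hφ]
    linear_combination (-(q : ℂ) ^ r.natDegree * (q : ℂ) ^ l * phiP F r) * h1
  have hT : ‖(∑ g : G, Ψ g) / Fintype.card G‖ ≤ 1 := by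
    rw [norm_div, Complex.norm_natCast]
    refine div_le_one_of_le₀ ((norm_sum_le _ _).trans ?_) (Nat.cast_nonneg _)
    refine (Finset.sum_le_sum fun g _ => hΨ1 g).trans ?_
    rw [Finset.sum_const, Finset.card_univ, nsmul_eq_mul, mul_one]
  have hGcard : (Fintype.card G : ℝ) ≤ (q : ℝ) ^ (r.natDegree + l) := by
    have h1 : Fintype.card G = q ^ l * phiP F r := by exact_mod_cast card_classGroup (l := l) hr
    have h2 : q ^ l * phiP F r ≤ q ^ (r.natDegree + l) := by
      rw [add_comm, pow_add]
      exact Nat.mul_le_mul_left _ (phiP_le hr)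
    exact_mod_cast h1.trans_le h2
  set M : ℝ := (r.natDegree + l + 2) * √(q : ℝ) ^ n with hM
  have hM0 : 0 ≤ M := by positivity
  have hcs := norm_sum_mul_sub_le hΨ1 hM0 fun χ hχ => by
    have h := norm_primeSum_le hr hχ (n := n) (by omega)
    rw [primeSum, hvsum _ (map_zero _)] at h
    simpa only [ext_coe] using h
  rw [hA, ← hmain]
  have hpnt : ‖n * ((irreds F n).card : ℂ) - (q : ℂ) ^ n‖ ≤ 2 * √(q : ℝ) ^ n := by
    have h1 : (n : ℝ) * (irreds F n).card ≤ (q : ℝ) ^ n := by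
      exact_mod_cast mul_card_irreds_le n
    have h2 := le_mul_card_irreds (F := F) (n := n) (by omega)
    have h3 : n * ((irreds F n).card : ℂ) - (q : ℂ) ^ n =
        ((n * (irreds F n).card - (q : ℝ) ^ n : ℝ) : ℂ) := by push_cast; ring
    rw [h3, Complex.norm_real, Real.norm_eq_abs, abs_le]
    have h4 : 0 ≤ √(q : ℝ) ^ n := by positivity
    constructor <;> linarith
  have hsplit : ∑ g : G, v g * Ψ g - (q : ℂ) ^ n * (∑ g : G, Ψ g) / Fintype.card G =
      (∑ g : G, v g * Ψ g - (∑ g, v g) * (∑ g : G, Ψ g) / Fintype.card G) +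
      (n * ((irreds F n).card : ℂ) - (q : ℂ) ^ n) * ((∑ g : G, Ψ g) / Fintype.card G) := by
    rw [hcard]
    ring
  rw [hsplit]
  refine (norm_add_le _ _).trans (add_le_add (hcs.trans ?_) ?_)
  · gcongr
  · rw [norm_mul]
    exact (mul_le_of_le_one_right (norm_nonneg _) hT).trans hpnt

end HayesRing

namespace AtInfinity

open MonicPoly

variable {F : Type} [Field F]

lemma toK_mul (f g : F[X]) : toK F (f * g) = toK F f * toK F g := map_mul (aeval (Kt F)) f g

lemma toK_add (f g : F[X]) : toK F (f + g) = toK F f + toK F g := map_add (aeval (Kt F)) f g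

lemma toK_monomial (n : ℕ) (a : F) :
    toK F (monomial n a) = HahnSeries.single (-n : ℤ) a := by
  rw [toK, aeval_monomial, Kt, HahnSeries.single_pow, one_pow, HahnSeries.algebraMap_apply']
  refine (congrArg (· * _) (HahnSeries.ofPowerSeries_C a)).trans ?_
  rw [HahnSeries.C_apply, HahnSeries.single_mul_single, zero_add, mul_one, smul_neg, nsmul_eq_mul,
    mul_one]

lemma coeff_toK_monomial_mul (n : ℕ) (a : F) (y : LaurentSeries F) (k : ℤ) :
    (toK F (monomial n a) * y).coeff k = a * y.coeff (k + n) := by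
  rw [toK_monomial, HahnSeries.coeff_single_mul, sub_neg_eq_add]

lemma coeff_toK_mul (f : F[X]) (y : LaurentSeries F) (k : ℤ) :
    (toK F f * y).coeff k = ∑ i ∈ f.support, f.coeff i * y.coeff (k + i) := by
  change _ = f.sum fun i a => a * y.coeff (k + i)
  induction f using Polynomial.induction_on' with
  | add f g hf hg =>
    rw [toK_add, add_mul, HahnSeries.coeff_add, hf, hg, sum_add_index _ _ _ (fun _ => zero_mul _)
      fun _ _ _ => add_mul _ _ _]
  | monomial n a =>
    exact (coeff_toK_monomial_mul n a y k).trans 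
      (sum_monomial_index a (fun i a => a * y.coeff (k + i)) (zero_mul _)).symm

lemma coeff_toK_of_pos (f : F[X]) {k : ℤ} (hk : 0 < k) : (toK F f).coeff k = 0 := by
  rw [← mul_one (toK F f), coeff_toK_mul]
  refine Finset.sum_eq_zero fun i _ => ?_
  rw [HahnSeries.coeff_one, if_neg (by omega), mul_zero]

lemma coeff_toK_neg_natDegree (f : F[X]) : (toK F f).coeff (-f.natDegree) = f.leadingCoeff := by
  rw [← mul_one (toK F f), coeff_toK_mul, Finset.sum_eq_single f.natDegree]
  · rw [neg_add_cancel, HahnSeries.coeff_one, if_pos rfl, mul_one, leadingCoeff]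
  · intro i _ hi
    rw [HahnSeries.coeff_one, if_neg (by omega), mul_zero]
  · intro h
    rw [notMem_support_iff.mp h, zero_mul]

lemma toK_ne_zero {f : F[X]} (hf : f ≠ 0) : toK F f ≠ 0 := fun h => by
  have h1 := coeff_toK_neg_natDegree f
  rw [h, HahnSeries.coeff_zero] at h1
  exact leadingCoeff_ne_zero.mpr hf h1.symm

lemma order_toK {f : F[X]} (hf : f ≠ 0) : (toK F f).order = -f.natDegree := by
  refine le_antisymm (HahnSeries.order_le_of_coeff_ne_zero ?_) ?_
  · rw [coeff_toK_neg_natDegree]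
    exact leadingCoeff_ne_zero.mpr hf
  · by_contra! h
    refine HahnSeries.coeff_order_eq_zero.not.mpr (toK_ne_zero hf) ?_
    rw [← mul_one (toK F f), coeff_toK_mul, mul_one]
    refine Finset.sum_eq_zero fun i hi => ?_
    have := le_natDegree_of_mem_supp i hi
    rw [HahnSeries.coeff_one, if_neg (by omega), mul_zero]

variable (p : ℕ) [Fact p.Prime] [Algebra (ZMod p) F]

lemma eC_eq (y : LaurentSeries F) :
    eC p F y = ZMod.stdAddChar (Algebra.trace (ZMod p) F (y.coeff 1)) := by
  rw [ZMod.stdAddChar_apply, ZMod.toCircle_apply, eC]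

lemma eC_add (x y : LaurentSeries F) : eC p F (x + y) = eC p F x * eC p F y := by
  rw [eC_eq, eC_eq, eC_eq, HahnSeries.coeff_add, map_add, AddChar.map_add_eq_mul]

lemma eC_eq_one {y : LaurentSeries F} (hy : y.coeff 1 = 0) : eC p F y = 1 := by
  rw [eC_eq, hy, map_zero, AddChar.map_zero_eq_one]

lemma norm_eC (y : LaurentSeries F) : ‖eC p F y‖ = 1 := by
  rw [eC_eq, AddChar.norm_apply]

/-- The additive character `f ↦ e(f y)` on polynomials. -/
def polyChar (y : LaurentSeries F) : AddChar F[X] ℂ where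
  toFun f := eC p F (toK F f * y)
  map_zero_eq_one' := by rw [toK, map_zero, zero_mul, eC_eq_one p (HahnSeries.coeff_zero)]
  map_add_eq_mul' f g := by rw [toK_add, add_mul, eC_add]

lemma polyChar_apply (y : LaurentSeries F) (f : F[X]) : polyChar p y f = eC p F (toK F f * y) := rfl

lemma polyChar_eq_one {y : LaurentSeries F} {m : ℕ} (hy : ∀ k : ℤ, k ≤ m → y.coeff k = 0) {f : F[X]}
    (hf : f ∈ degreeLT F m) : polyChar p y f = 1 := by
  rw [polyChar_apply]
  refine eC_eq_one p ?_
  rw [coeff_toK_mul]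
  refine Finset.sum_eq_zero fun i hi => ?_
  have h : i < m := by
    rw [mem_degreeLT] at hf
    exact_mod_cast (le_degree_of_mem_supp i hi).trans_lt hf
  rw [hy _ (by omega), mul_zero]

lemma exists_eC_ne_one [Finite F] {y : LaurentSeries F} {k : ℕ} (hy : y.coeff (k + 1) ≠ 0) :
    ∃ f : F[X], eC p F (toK F f * y) ≠ 1 := by
  obtain ⟨a, ha⟩ := Algebra.trace_surjective (ZMod p) F 1
  refine ⟨monomial k (a / y.coeff (k + 1)), ?_⟩
  rw [eC_eq, coeff_toK_monomial_mul, add_comm (1 : ℤ),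
    div_mul_cancel₀ _ hy, ha]
  intro h
  rw [← AddChar.map_zero_eq_one (ZMod.stdAddChar (N := p))] at h
  exact one_ne_zero (ZMod.injective_stdAddChar h)

theorem hasDenominator_polyChar [Finite F] {b r : F[X]} (hr : r.Monic) (hb : IsCoprime b r) :
    HasDenominator (polyChar p (toK F b / toK F r)) r := by
  have hr0 := toK_ne_zero hr.ne_zero
  constructor
  · intro f
    rw [polyChar_apply]
    refine eC_eq_one p ?_
    rw [toK_mul, mul_right_comm, mul_div_cancel₀ _ hr0, ← toK_mul]
    exact coeff_toK_of_pos _ one_pos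
  · intro D hD
    have hR0 : (D * b) %ₘ r ≠ 0 := fun h => by
      rw [modByMonic_eq_zero_iff_dvd hr] at h
      exact hD (hb.symm.dvd_of_dvd_mul_right h)
    set R := (D * b) %ₘ r
    set z := toK F R / toK F r with hz
    have hz0 : z ≠ 0 := div_ne_zero (toK_ne_zero hR0) hr0
    have hDz : toK F D * (toK F b / toK F r) = toK F ((D * b) /ₘ r) + z := by
      rw [hz, ← mul_div_assoc, ← toK_mul, div_eq_iff hr0, add_mul, div_mul_cancel₀ _ hr0, ← toK_mul,
        ← toK_add, mul_comm _ r, add_comm, modByMonic_add_div]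
    have hord : z.order + (toK F r).order = (toK F R).order := by
      rw [← HahnSeries.order_mul hz0 hr0, hz, div_mul_cancel₀ _ hr0]
    rw [order_toK hr.ne_zero, order_toK hR0] at hord
    have hlt : R.natDegree < r.natDegree :=
      natDegree_lt_natDegree hR0 (degree_modByMonic_lt _ hr)
    obtain ⟨k, hk⟩ : ∃ k : ℕ, z.order = k + 1 := ⟨r.natDegree - R.natDegree - 1, by omega⟩
    have hcoeff : (toK F D * (toK F b / toK F r)).coeff (k + 1) ≠ 0 := by
      rw [hDz, HahnSeries.coeff_add, coeff_toK_of_pos _ (by omega), zero_add, ← hk]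
      exact HahnSeries.coeff_order_eq_zero.not.mpr hz0
    obtain ⟨f, hf⟩ := exists_eC_ne_one p hcoeff
    refine ⟨f, ?_⟩
    rwa [polyChar_apply, toK_mul, mul_comm (toK F D), mul_assoc]

end AtInfinity

namespace AtInfinity

open MonicPoly

variable {F : Type} [Field F] [Fintype F]

lemma norm_muP_div_phiP_le {r : F[X]} (hr : r.Monic) : ‖(muP F r : ℂ) / phiP F r‖ ≤ 1 := by
  have h1 : ‖(muP F r : ℂ)‖ ≤ 1 := by
    rw [muP]
    split_ifs <;> simp
  have h2 : (1 : ℝ) ≤ phiP F r := by exact_mod_cast HayesRing.phiP_pos hr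
  rw [norm_div, Complex.norm_natCast]
  exact div_le_one_of_le₀ (h1.trans h2) (Nat.cast_nonneg _)

lemma irreds_eq_filter (n : ℕ) : irreds F n = (monics F n).filter Irreducible := by
  ext P
  rw [Finset.mem_filter, mem_irreds, mem_monics, and_assoc]

lemma sum_vonMangoldt (n : ℕ) (Θ : F[X] → ℂ) :
    ∑ f ∈ monics F n, (vonMangoldt' F f : ℂ) * Θ f = n * ∑ P ∈ irreds F n, Θ P := by
  rw [irreds_eq_filter, Finset.sum_filter, Finset.mul_sum]
  refine Finset.sum_congr rfl fun f hf => ?_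
  rw [vonMangoldt', (mem_monics.mp hf).2]
  split_ifs <;> simp

lemma finsum_monics (n : ℕ) (Θ : F[X] → ℂ) :
    ∑ᶠ f ∈ {f : F[X] | f.Monic ∧ f.natDegree = n}, Θ f = ∑ f ∈ monics F n, Θ f := by
  rw [← finsum_mem_coe_finset]
  simp only [Finset.mem_coe, mem_monics, Set.mem_ofPred_eq]

theorem norm_sum_irreds_sub_le_two_mul {ψ ω : AddChar F[X] ℂ} {r : F[X]} (hr : r.Monic)
    (hψ1 : ∀ f, ‖ψ f‖ ≤ 1) (hω1 : ∀ f, ‖ω f‖ ≤ 1) (n : ℕ) :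
    ‖n * ∑ P ∈ irreds F n, (ψ * ω) P - muP F r / phiP F r * ∑ f ∈ monics F n, ω f‖ ≤
      2 * (Fintype.card F : ℝ) ^ n := by
  have h1 : ‖∑ P ∈ irreds F n, (ψ * ω) P‖ ≤ (irreds F n).card := by
    refine (norm_sum_le_of_le _ fun P _ => ?_).trans (by rw [Finset.sum_const, nsmul_one])
    rw [AddChar.mul_apply, norm_mul]
    exact mul_le_one₀ (hψ1 _) (norm_nonneg _) (hω1 _)
  have h2 : ‖∑ f ∈ monics F n, ω f‖ ≤ (Fintype.card F : ℝ) ^ n := by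
    refine (norm_sum_le_of_le _ fun P _ => hω1 P).trans ?_
    rw [Finset.sum_const, nsmul_one, card_monics, Nat.cast_pow]
  have h3 : (n : ℝ) * (irreds F n).card ≤ (Fintype.card F : ℝ) ^ n := by
    exact_mod_cast mul_card_irreds_le n
  refine (norm_sub_le _ _).trans ?_
  rw [two_mul, norm_mul, norm_mul, Complex.norm_natCast]
  refine add_le_add ((mul_le_mul_of_nonneg_left h1 (Nat.cast_nonneg _)).trans h3) ?_
  exact (mul_le_of_le_one_left (norm_nonneg _) (norm_muP_div_phiP_le hr)).trans h2

lemma one_lt_card : (1 : ℝ) < Fintype.card F := by exact_mod_cast Fintype.one_lt_card (α := F)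

lemma natDegree_le_of_pnorm_le {r : F[X]} (hr : r ≠ 0) {N : ℕ}
    (h : pnorm F r ≤ (Fintype.card F : ℝ) ^ ((N : ℝ) / 2)) : 2 * r.natDegree ≤ N := by
  rw [pnorm, if_neg hr, ← Real.rpow_natCast, Real.rpow_le_rpow_left_iff one_lt_card] at h
  have h' : (2 * r.natDegree : ℝ) ≤ N := by linarith
  exact_mod_cast h'

lemma coeff_eq_zero_of_Knorm_lt {r : F[X]} (hr : r ≠ 0) {N : ℕ} {η : LaurentSeries F}
    (h : Knorm F η < (pnorm F r * (Fintype.card F : ℝ) ^ ((N : ℝ) / 2))⁻¹) {k : ℤ}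
    (hk : k ≤ (r.natDegree + N / 2 : ℕ)) : η.coeff k = 0 := by
  rcases eq_or_ne η 0 with rfl | hη
  · rfl
  refine HahnSeries.coeff_eq_zero_of_lt_order ?_
  rw [Knorm, if_neg hη, pnorm, if_neg hr, ← Real.rpow_natCast, ← Real.rpow_intCast,
    ← Real.rpow_add (zero_lt_one.trans one_lt_card), ← Real.rpow_neg (Nat.cast_nonneg _),
    Real.rpow_lt_rpow_left_iff one_lt_card] at h
  have h1 : ((2 * r.natDegree + N : ℤ) : ℝ) < ((2 * η.order : ℤ) : ℝ) := by
    push_cast at h ⊢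
    linarith
  have h2 : (2 * r.natDegree + N : ℤ) < 2 * η.order := by exact_mod_cast h1
  omega

theorem main_bound {b r : F[X]} [Algebra (ZMod p) F] (hr : r.Monic) (hb : IsCoprime b r) {N n : ℕ}
    (hn : n ≤ N) {η : LaurentSeries F} (hd : 2 * r.natDegree ≤ N)
    (hη : ∀ k : ℤ, k ≤ (r.natDegree + N / 2 : ℕ) → η.coeff k = 0) :
    ‖n * ∑ P ∈ irreds F n, (polyChar p (toK F b / toK F r) * polyChar p η) P -
        muP F r / phiP F r * ∑ f ∈ monics F n, polyChar p η f‖ ≤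
      Fintype.card F * (N + 5) * (Fintype.card F : ℝ) ^ ((N : ℝ) * (3 / 4)) := by
  have hq := one_lt_card (F := F)
  have hψ1 : ∀ f, ‖polyChar p (toK F b / toK F r) f‖ ≤ 1 := fun f => (norm_eC p _).le
  have hω1 : ∀ f, ‖polyChar p η f‖ ≤ 1 := fun f => (norm_eC p _).le
  set q : ℝ := (Fintype.card F : ℝ) with hqdef
  have hq0 : 0 < q := zero_lt_one.trans hq
  have hE : 0 < q ^ ((N : ℝ) * (3 / 4)) := Real.rpow_pos_of_pos hq0 _
  have hnN : (n : ℝ) ≤ N := Nat.cast_le.mpr hn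
  have hN0 : (0 : ℝ) ≤ N := Nat.cast_nonneg _
  rcases le_or_gt n r.natDegree with hnd | hnd
  · refine (norm_sum_irreds_sub_le_two_mul hr hψ1 hω1 n).trans ?_
    have h1 : q ^ n ≤ q ^ ((N : ℝ) * (3 / 4)) := by
      rw [← Real.rpow_natCast, Real.rpow_le_rpow_left_iff hq]
      have : ((2 * n : ℕ) : ℝ) ≤ N := by exact_mod_cast (by omega : 2 * n ≤ N)
      push_cast at this
      linarith
    refine mul_le_mul ?_ h1 (by positivity) (by positivity)
    nlinarith
  · set l := n - (r.natDegree + N / 2) with hl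
    have hdl : r.natDegree + l ≤ n := by omega
    have hω : ∀ f ∈ degreeLT F (n - l), polyChar p η f = 1 := fun f hf =>
      polyChar_eq_one p hη (degreeLT_mono (by omega) hf)
    refine (HayesRing.norm_sum_irreds_sub_le hr (hasDenominator_polyChar p hr hb) hψ1 hω1 hω hnd
      hdl).trans ?_
    have hs : ((2 * (r.natDegree + l) : ℕ) : ℝ) ≤ ((N + 1 : ℕ) : ℝ) := by
      exact_mod_cast (by omega : 2 * (r.natDegree + l) ≤ N + 1)
    push_cast at hs
    have h1 : √(q ^ (r.natDegree + l)) * √q ^ n ≤ q * q ^ ((N : ℝ) * (3 / 4)) := by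
      rw [Real.sqrt_eq_rpow, Real.sqrt_eq_rpow, ← Real.rpow_natCast, ← Real.rpow_natCast,
        ← Real.rpow_mul hq0.le, ← Real.rpow_mul hq0.le, ← Real.rpow_add hq0,
        ← Real.rpow_one_add' hq0.le (by positivity), Real.rpow_le_rpow_left_iff hq]
      push_cast
      linarith
    have h2 : √q ^ n ≤ q * q ^ ((N : ℝ) * (3 / 4)) := by
      refine le_trans ?_ h1
      refine le_mul_of_one_le_left (by positivity) ?_
      rw [Real.one_le_sqrt]
      exact one_le_pow₀ hq.le
    calc _ = (r.natDegree + l + 2) * (√(q ^ (r.natDegree + l)) * √q ^ n) + 2 * √q ^ n := by ring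
      _ ≤ (N + 3) * (q * q ^ ((N : ℝ) * (3 / 4))) + 2 * (q * q ^ ((N : ℝ) * (3 / 4))) := by
        gcongr
        · exact_mod_cast hdl.trans hn
        · norm_num
      _ = _ := by ring

lemma natCast_le_mul_rpow {q ε : ℝ} (hq : 1 < q) (hε : 0 < ε) (N : ℕ) :
    (N : ℝ) + 5 ≤ (1 / (ε * Real.log q) + 5) * q ^ ((N : ℝ) * ε) := by
  have hlog : 0 < ε * Real.log q := mul_pos hε (Real.log_pos hq)
  have h1 : N * (ε * Real.log q) + 1 ≤ q ^ ((N : ℝ) * ε) := by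
    have h := Real.add_one_le_exp (Real.log q * (N * ε))
    rw [← Real.rpow_def_of_pos (zero_lt_one.trans hq)] at h
    linarith
  have h2 : (N : ℝ) + 1 / (ε * Real.log q) ≤ 1 / (ε * Real.log q) * q ^ ((N : ℝ) * ε) := by
    have h := mul_le_mul_of_nonneg_left h1 (one_div_pos.mpr hlog).le
    rwa [mul_add, mul_one, mul_comm, mul_assoc, mul_one_div_cancel hlog.ne', mul_one] at h
  have h3 : 0 < 1 / (ε * Real.log q) := one_div_pos.mpr hlog
  have h4 : 0 ≤ N * (ε * Real.log q) := by positivity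
  linarith

end AtInfinity

/-- Hayes–Weil major arc estimate: if `x = b/r + η` with `(b,r) = 1`, `r` monic,
`⟨r⟩ ≤ q^(N/2)` and `⟨η⟩ < (⟨r⟩q^(N/2))⁻¹`, then for `1 ≤ n ≤ N`,
`|Σ_{f monic, deg f = n} Λ'(f)e(fx) − (μ(r)/φ(r))·Σ_{f monic, deg f = n} e(fη)|
  ≤ C(q,ε)·q^(N(3/4+ε))`. -/
theorem hayes_weil_estimate (ε : ℝ) (hε : 0 < ε) :
    ∃ C : ℝ, 0 < C ∧
      ∀ (N n : ℕ) (x η : LaurentSeries Fq) (b r : Polynomial Fq),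
        0 < N → 0 < n → n ≤ N →
        Knorm Fq x < 1 →
        IsCoprime b r → r.Monic →
        pnorm Fq r ≤ (Fintype.card Fq : ℝ) ^ ((N : ℝ) / 2) →
        Knorm Fq η < (pnorm Fq r * (Fintype.card Fq : ℝ) ^ ((N : ℝ) / 2))⁻¹ →
        x = toK Fq b / toK Fq r + η →
        ‖(∑ᶠ f ∈ {f : Polynomial Fq | f.Monic ∧ f.natDegree = n},
            (vonMangoldt' Fq f : ℂ) * eC p Fq (toK Fq f * x)) -
          ((muP Fq r : ℂ) / (phiP Fq r : ℂ)) *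
            ∑ᶠ f ∈ {f : Polynomial Fq | f.Monic ∧ f.natDegree = n},
              eC p Fq (toK Fq f * η)‖ ≤
          C * (Fintype.card Fq : ℝ) ^ ((N : ℝ) * (3 / 4 + ε)) := by
  have hq := AtInfinity.one_lt_card (F := Fq)
  have hq0 := zero_lt_one.trans hq
  have hlog := Real.log_pos hq
  refine ⟨Fintype.card Fq * (1 / (ε * Real.log (Fintype.card Fq)) + 5), by positivity, ?_⟩
  rintro N n x η b r - - hn - hb hr hrN hη rfl
  rw [AtInfinity.finsum_monics, AtInfinity.finsum_monics, AtInfinity.sum_vonMangoldt]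
  have hsplit : ∀ f, eC p Fq (toK Fq f * (toK Fq b / toK Fq r + η)) =
      (AtInfinity.polyChar p (toK Fq b / toK Fq r) * AtInfinity.polyChar p η) f := fun f => by
    rw [AddChar.mul_apply, mul_add, AtInfinity.eC_add]
    rfl
  simp only [hsplit]
  refine (AtInfinity.main_bound p hr hb hn (AtInfinity.natDegree_le_of_pnorm_le hr.ne_zero hrN)
    fun k => AtInfinity.coeff_eq_zero_of_Knorm_lt hr.ne_zero hη).trans ?_
  have h := AtInfinity.natCast_le_mul_rpow hq hε N
  rw [mul_add (N : ℝ), Real.rpow_add hq0, mul_left_comm, mul_comm (_ * _) (_ ^ _)]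
  refine mul_le_mul_of_nonneg_left ?_ (by positivity)
  rw [mul_assoc]
  exact mul_le_mul_of_nonneg_left h hq0.le

end
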